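/- Let x > 0 be real and let N1, N2 ≥ 0 be integers of which exactly one is odd, with N = N1 + N2 and n = ⌊N/2⌋. Assume normalized ground-state vectors ψ_{N1}, ψ_{N2}, ψ_N of the XXZ Hamiltonians H_{N1}(x), H_{N2}(x), H_N(x) exist. Then the overlap satisfies O_{N1,N2} = γ_{N1} · γ_{N2} · det_{i,j=1}^{n} ( (x−1)² C(i+j−1, 2j−i) + x · C(i+j+1, 2j−i+1) ). -/

import Mathlib

open scoped Classical

noncomputable section

/-- Spin configurations of an `N`-site chain: `0` encodes `↑`, `1` encodes `↓`. -/
abbrev Conf (N : ℕ) := Fin N → Fin 2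

def pauliX : Matrix (Fin 2) (Fin 2) ℂ := !![0, 1; 1, 0]
def pauliY : Matrix (Fin 2) (Fin 2) ℂ := !![0, -Complex.I; Complex.I, 0]
def pauliZ : Matrix (Fin 2) (Fin 2) ℂ := !![1, 0; 0, -1]

/-- The operator acting as `A` on site `i` and as the identity elsewhere. -/
def siteOp (N : ℕ) (i : Fin N) (A : Matrix (Fin 2) (Fin 2) ℂ) :
    Matrix (Conf N) (Conf N) ℂ :=
  Matrix.of fun α β =>
    A (α i) (β i) * ∏ j ∈ Finset.univ.erase i, (if α j = β j then (1 : ℂ) else 0)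

/-- Left boundary field `p = (1/2)(1/2 − x)`. -/
def pL (x : ℝ) : ℝ := (1/2) * (1/2 - x)

/-- Right boundary field `p̄ = (1/2)(1/2 − 1/x)`. -/
def pR (x : ℝ) : ℝ := (1/2) * (1/2 - 1/x)

/-- The open XXZ Hamiltonian at `Δ = −1/2` with diagonal boundary fields. -/
def XXZ (N : ℕ) (hN : 0 < N) (x : ℝ) : Matrix (Conf N) (Conf N) ℂ :=
  (-(1/2) : ℂ) • (∑ i : Fin (N-1),
      (siteOp N ⟨i.1, by have := i.2; omega⟩ pauliX *
          siteOp N ⟨i.1+1, by have := i.2; omega⟩ pauliX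
        + siteOp N ⟨i.1, by have := i.2; omega⟩ pauliY *
          siteOp N ⟨i.1+1, by have := i.2; omega⟩ pauliY
        - (1/2 : ℂ) • (siteOp N ⟨i.1, by have := i.2; omega⟩ pauliZ *
          siteOp N ⟨i.1+1, by have := i.2; omega⟩ pauliZ)))
  + ((pL x : ℝ) : ℂ) • siteOp N ⟨0, hN⟩ pauliZ
  + ((pR x : ℝ) : ℂ) • siteOp N ⟨N-1, by omega⟩ pauliZ

/-- The special eigenvalue `E₀`. -/
def E0 (N : ℕ) (x : ℝ) : ℝ := -(3*(N:ℝ) - 1)/4 - (1-x)^2/(2*x)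

/-- The basis state with `⌊N/2⌋` down spins followed by `⌈N/2⌉` up spins. -/
def baseState (N : ℕ) : Conf N := fun i => if i.1 < N/2 then 1 else 0

/-- `ψ` is a normalized ground-state vector of `H_N(x)`; for `N = 0` it is the
scalar `1` by convention. -/
def IsGroundState (N : ℕ) (x : ℝ) (ψ : Conf N → ℂ) : Prop :=
  if h : 0 < N then
    (XXZ N h x).mulVec ψ = ((E0 N x : ℝ) : ℂ) • ψ
    ∧ (∀ φ : Conf N → ℂ, (XXZ N h x).mulVec φ = ((E0 N x : ℝ) : ℂ) • φ → ∃ c : ℂ, φ = c • ψ)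
    ∧ ψ (baseState N) = 1
  else ∀ α, ψ α = 1

/-- The overlap `O_{N1,N2} = ⟨ψ, ψ1 ⊗ ψ2⟩` (bilinear, unconjugated pairing). -/
def overlap (N1 N2 : ℕ) (ψ : Conf (N1+N2) → ℂ) (ψ1 : Conf N1 → ℂ) (ψ2 : Conf N2 → ℂ) : ℂ :=
  ∑ α : Conf N1, ∑ β : Conf N2, ψ (Fin.append α β) * ψ1 α * ψ2 β

/-- The square norm `O_{M,0} = ⟨ψ, ψ⟩` (bilinear pairing). -/
def selfOverlap (M : ℕ) (ψ : Conf M → ℂ) : ℂ := ∑ α : Conf M, ψ α * ψ α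

/-- `γ_N`: `A_V(N+1)` for `N` even, `N_8(N+1)` for `N` odd. -/
def gammaN (N : ℕ) : ℝ :=
  if N % 2 = 0 then
    ((2:ℝ)⁻¹) ^ (N/2) * ∏ i ∈ Finset.Icc 1 (N/2),
      ((Nat.factorial (6*i-2) : ℝ) * (Nat.factorial (2*i-1) : ℝ)) /
        ((Nat.factorial (4*i-2) : ℝ) * (Nat.factorial (4*i-1) : ℝ))
  else
    ∏ i ∈ Finset.range ((N+1)/2),
      (((3*i+1 : ℕ) : ℝ) * (Nat.factorial (6*i) : ℝ) * (Nat.factorial (2*i) : ℝ)) /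
        ((Nat.factorial (4*i) : ℝ) * (Nat.factorial (4*i+1) : ℝ))

/-- Binomial coefficient `C(a,b)` for integers, vanishing unless `0 ≤ b ≤ a`. -/
def zchoose (a b : ℤ) : ℤ := if 0 ≤ b ∧ b ≤ a then (a.toNat).choose b.toNat else 0

/-- The logarithmic bipartite fidelity. -/
def LBF (N1 N2 : ℕ) (ψ : Conf (N1+N2) → ℂ) (ψ1 : Conf N1 → ℂ) (ψ2 : Conf N2 → ℂ) : ℂ :=
  -Complex.log ((overlap N1 N2 ψ ψ1 ψ2)^2 /
    (selfOverlap N1 ψ1 * selfOverlap N2 ψ2 * selfOverlap (N1+N2) ψ))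

/-- A primitive cube root of unity. -/
def om : ℂ := -1/2 + (Real.sqrt 3 / 2 : ℝ) * Complex.I

lemma om_sq : om ^ 2 = -om - 1 := by
  have h : ((Real.sqrt 3 : ℝ) : ℂ) ^ 2 = 3 := by
    rw [← Complex.ofReal_pow, Real.sq_sqrt (by norm_num)]; norm_num
  unfold om
  push_cast
  ring_nf
  rw [Complex.I_sq, h]
  ring

lemma om_cube : om ^ 3 = 1 := by
  linear_combination (om - 1) * om_sq

lemma om_ne_zero : om ≠ 0 := by
  intro h
  have := om_sq
  rw [h] at this
  norm_num at this

lemma om_ne_one : om ≠ 1 := by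
  intro h
  have := om_sq
  rw [h] at this
  norm_num at this

namespace QKZ

open MvPolynomial

abbrev Poly := MvPolynomial ℕ ℂ

/-- Exchange of two neighbouring variables. -/
def sw (i : ℕ) : Poly →ₐ[ℂ] Poly := rename (Equiv.swap i (i + 1))

lemma sw_X_left (i : ℕ) : sw i (X i) = X (i + 1) := by simp [sw]

lemma sw_X_right (i : ℕ) : sw i (X (i + 1)) = X i := by simp [sw]

lemma sw_X_of_ne {i k : ℕ} (h : k ≠ i) (h' : k ≠ i + 1) : sw i (X k) = X k := by
  simp [sw, Equiv.swap_apply_of_ne_of_ne h h']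

lemma sw_C (i : ℕ) (c : ℂ) : sw i (C c) = C c := by simp [sw]

lemma sw_sw (i : ℕ) (p : Poly) : sw i (sw i p) = p := by
  have h : (Equiv.swap i (i + 1) : ℕ → ℕ) ∘ Equiv.swap i (i + 1) = id := by
    funext k
    simp
  simp [sw, rename_rename, h]

lemma sw_comm {i j : ℕ} (h : i + 2 ≤ j) (p : Poly) : sw i (sw j p) = sw j (sw i p) := by
  simp only [sw, rename_rename]
  congr 2
  funext k
  simp only [Function.comp, Equiv.swap_apply_def]
  split_ifs <;> omega

lemma sw_braid (i : ℕ) (p : Poly) :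
    sw i (sw (i + 1) (sw i p)) = sw (i + 1) (sw i (sw (i + 1) p)) := by
  simp only [sw, rename_rename]
  congr 2
  funext k
  simp only [Function.comp, Equiv.swap_apply_def]
  split_ifs <;> omega

lemma X_sub_dvd (i : ℕ) (p : Poly) : (X i - X (i + 1) : Poly) ∣ sw i p - p := by
  induction p using MvPolynomial.induction_on with
  | C a => simp
  | add p r hp hr =>
    rw [map_add]
    have := dvd_add hp hr
    convert this using 1
    ring
  | mul_X p k hp =>
    have h : (X i - X (i + 1) : Poly) ∣ sw i (X k) - X k := by
      by_cases h1 : k = i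
      · subst h1
        rw [sw_X_left]
        exact ⟨-1, by ring⟩
      by_cases h2 : k = i + 1
      · subst h2
        rw [sw_X_right]
      · rw [sw_X_of_ne h1 h2, sub_self]
        exact dvd_zero _
    rw [map_mul]
    have := dvd_add (hp.mul_right (sw i (X k))) (h.mul_left p)
    convert this using 1
    ring

lemma exists_T (i : ℕ) (p : Poly) : ∃ r : Poly,
    (X i - X (i + 1)) * r =
      (C om * X (i + 1) - C om ^ 2 * X i) * sw i p - (C om - C om ^ 2) * X i * p := by
  obtain ⟨s, hs⟩ := X_sub_dvd i p
  refine ⟨(C om * X (i + 1) - C om ^ 2 * X i) * s - C om * p, ?_⟩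
  linear_combination (-(C om * X (i + 1) - C om ^ 2 * X i)) * hs

/-- The exchange operator producing the component with `↑↓` from the one with `↓↑`. -/
def T (i : ℕ) (p : Poly) : Poly := (exists_T i p).choose

lemma T_spec (i : ℕ) (p : Poly) : (X i - X (i + 1)) * T i p =
    (C om * X (i + 1) - C om ^ 2 * X i) * sw i p - (C om - C om ^ 2) * X i * p :=
  (exists_T i p).choose_spec

lemma X_sub_ne {i j : ℕ} (h : i ≠ j) : (X i - X j : Poly) ≠ 0 := by
  rw [sub_ne_zero]
  exact fun e => h (X_injective e)

lemma T_zero (i : ℕ) : T i 0 = 0 := by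
  have := T_spec i 0
  simp only [map_zero, mul_zero, sub_zero, mul_eq_zero] at this
  exact this.resolve_left (X_sub_ne (by omega))

lemma sw_T {i j : ℕ} (h : i + 2 ≤ j ∨ j + 2 ≤ i) (p : Poly) : sw i (T j p) = T j (sw i p) := by
  apply mul_left_cancel₀ (X_sub_ne (show j ≠ j + 1 by omega))
  have h1 := congrArg (sw i) (T_spec j p)
  have h2 := T_spec j (sw i p)
  simp only [map_mul, map_sub, sw_C, map_pow, sw_X_of_ne (show j ≠ i by omega) (by omega),
    sw_X_of_ne (show j + 1 ≠ i by omega) (by omega)] at h1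
  have h3 : sw i (sw j p) = sw j (sw i p) := by
    rcases h with h | h
    · exact sw_comm h p
    · exact (sw_comm h p).symm
  rw [h1, h2, h3]

lemma T_comm {i j : ℕ} (h : i + 2 ≤ j) (p : Poly) : T i (T j p) = T j (T i p) := by
  apply mul_left_cancel₀ (X_sub_ne (show i ≠ i + 1 by omega))
  apply mul_left_cancel₀ (X_sub_ne (show j ≠ j + 1 by omega))
  have h1 := T_spec i (T j p)
  have h2 := T_spec j (T i p)
  rw [sw_T (Or.inl h)] at h1
  rw [sw_T (Or.inr h)] at h2
  have h3 := T_spec j p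
  have h4 := T_spec i p
  have h5 := T_spec j (sw i p)
  have h6 := T_spec i (sw j p)
  have h7 := sw_comm h p
  rw [h7] at h6
  linear_combination (X j - X (j+1)) * h1 - (X i - X (i+1)) * h2 
    + (C om * X (i + 1) - C om ^ 2 * X i) * h5 - (C om - C om ^ 2) * X i * h3
    - (C om * X (j + 1) - C om ^ 2 * X j) * h6 + (C om - C om ^ 2) * X j * h4

/-- Exchange relation for two equal neighbouring spins. -/
def Diag (i : ℕ) (p : Poly) : Prop :=
  (X i - C om * X (i + 1)) * p = (X (i + 1) - C om * X i) * sw i p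

lemma Diag.apply_T {i j : ℕ} (h : i + 2 ≤ j ∨ j + 2 ≤ i) {p : Poly} (hp : Diag i p) :
    Diag i (T j p) := by
  unfold Diag at *
  apply mul_left_cancel₀ (X_sub_ne (show j ≠ j + 1 by omega))
  rw [sw_T h]
  have h1 := T_spec j p
  have h2 := T_spec j (sw i p)
  have h3 := congrArg (sw j) hp
  simp only [map_mul, map_sub, sw_C, sw_X_of_ne (show i ≠ j by omega) (by omega),
    sw_X_of_ne (show i + 1 ≠ j by omega) (by omega)] at h3
  linear_combination (X i - C om * X (i + 1)) * h1 - (X (i + 1) - C om * X i) * h2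
    + (C om * X (j + 1) - C om ^ 2 * X j) * h3 - (C om - C om ^ 2) * X j * hp

lemma C_om_sq : (C om : Poly) ^ 2 = -C om - 1 := by
  rw [← map_pow, om_sq]; simp

lemma braid_left {R : Type*} [CommRing R] [IsDomain R] {q a b c : R} (_hq : q ^ 2 = -q - 1)
    {p sp tp stp tsp stsp u su tu stu r sr : R} (hab : a - b ≠ 0) (hbc : b - c ≠ 0)
    (hac : a - c ≠ 0)
    (d1 : (b - q * c) * p = (c - q * b) * tp)
    (d2 : (a - q * c) * sp = (c - q * a) * stp)
    (d3 : (a - q * b) * tsp = (b - q * a) * stsp)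
    (e1 : (a - b) * u = (q * b - q ^ 2 * a) * sp - (q - q ^ 2) * a * p)
    (e2 : (a - c) * tu = (q * c - q ^ 2 * a) * tsp - (q - q ^ 2) * a * tp)
    (e3 : (b - a) * su = (q * a - q ^ 2 * b) * p - (q - q ^ 2) * b * sp)
    (e4 : (b - c) * stu = (q * c - q ^ 2 * b) * stsp - (q - q ^ 2) * b * stp)
    (f1 : (b - c) * r = (q * c - q ^ 2 * b) * tu - (q - q ^ 2) * b * u)
    (f2 : (a - c) * sr = (q * c - q ^ 2 * a) * stu - (q - q ^ 2) * a * su) :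
    (a - q * b) * r = (b - q * a) * sr := by
  apply mul_left_cancel₀ hab
  apply mul_left_cancel₀ hbc
  apply mul_left_cancel₀ hac
  have key : (a - c) * ((b - c) * ((a - b) * ((a - q * b) * r)))
      - (a - c) * ((b - c) * ((a - b) * ((b - q * a) * sr))) =
      ((a-q*b)*((q-q^2)^2*a*b*(a-c)) - (b-q*a)*(q-q^2)*a*(b-c)*(q*a-q^2*b)
        - q*(q-q^2)*a*(a-b)*(a-q*b)*(b-q*c)) * p
      + (-(a-q*b)*(q-q^2)*b*(a-c)*(q*b-q^2*a) + (b-q*a)*(q-q^2)^2*a*b*(b-c)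
        + q*(q-q^2)*b*(a-b)*(b-q*a)*(a-q*c)) * sp := by
    linear_combination (a - c) * (a - b) * (a - q * b) * f1 
      - (b - c) * (a - b) * (b - q * a) * f2
      + (q * c - q ^ 2 * b) * (a - b) * (a - q * b) * e2
      - (q - q ^ 2) * b * (a - c) * (a - q * b) * e1
      - (q * c - q ^ 2 * a) * (a - b) * (b - q * a) * e4
      - (q - q ^ 2) * a * (b - c) * (b - q * a) * e3
      + (a-b)*(q*c-q^2*b)*(q*c-q^2*a) * d3
      + q*(q-q^2)*a*(a-b)*(a-q*b) * d1 - q*(q-q^2)*b*(a-b)*(b-q*a)*d2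
  have k1 : (a-q*b)*((q-q^2)^2*a*b*(a-c)) - (b-q*a)*(q-q^2)*a*(b-c)*(q*a-q^2*b)
        - q*(q-q^2)*a*(a-b)*(a-q*b)*(b-q*c) = 0 := by
    grind
  have k2 : -(a-q*b)*(q-q^2)*b*(a-c)*(q*b-q^2*a) + (b-q*a)*(q-q^2)^2*a*b*(b-c)
        + q*(q-q^2)*b*(a-b)*(b-q*a)*(a-q*c) = 0 := by
    grind
  rw [k1, k2] at key
  linear_combination key

lemma braid_right {R : Type*} [CommRing R] [IsDomain R] {q a b c : R} (_hq : q ^ 2 = -q - 1)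
    {p sp tp stp tsp tstp u su tu tsu r tr : R} (hab : a - b ≠ 0) (hbc : b - c ≠ 0)
    (hac : a - c ≠ 0)
    (d1 : (a - q * b) * p = (b - q * a) * sp)
    (d2 : (a - q * c) * tp = (c - q * a) * tsp)
    (d3 : (b - q * c) * stp = (c - q * b) * tstp)
    (e1 : (b - c) * u = (q * c - q ^ 2 * b) * tp - (q - q ^ 2) * b * p)
    (e2 : (a - c) * su = (q * c - q ^ 2 * a) * stp - (q - q ^ 2) * a * sp)
    (e3 : (c - b) * tu = (q * b - q ^ 2 * c) * p - (q - q ^ 2) * c * tp)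
    (e4 : (a - b) * tsu = (q * b - q ^ 2 * a) * tstp - (q - q ^ 2) * a * tsp)
    (f1 : (a - b) * r = (q * b - q ^ 2 * a) * su - (q - q ^ 2) * a * u)
    (f2 : (a - c) * tr = (q * c - q ^ 2 * a) * tsu - (q - q ^ 2) * a * tu) :
    (b - q * c) * r = (c - q * b) * tr := by
  apply mul_left_cancel₀ hab
  apply mul_left_cancel₀ hbc
  apply mul_left_cancel₀ hac
  have key : (a - c) * ((b - c) * ((a - b) * ((b - q * c) * r)))
      - (a - c) * ((b - c) * ((a - b) * ((c - q * b) * tr))) =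
      (-q*(q-q^2)*a*(b-q*c)*(b-c)*(a-q*b) + (b-q*c)*(q-q^2)^2*a*b*(a-c)
        - (c-q*b)*(q-q^2)*a*(a-b)*(q*b-q^2*c)) * p
      + (-(b-q*c)*(q-q^2)*a*(a-c)*(q*c-q^2*b) + q*(q-q^2)*a*(c-q*b)*(b-c)*(a-q*c)
        + (c-q*b)*(q-q^2)^2*a*c*(a-b)) * tp := by
    linear_combination (a - c) * (b - c) * (b - q * c) * f1 
      - (b - c) * (a - b) * (c - q * b) * f2
      + (q * b - q ^ 2 * a) * (b - c) * (b - q * c) * e2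
      - (q - q ^ 2) * a * (a - c) * (b - q * c) * e1
      - (q * c - q ^ 2 * a) * (b - c) * (c - q * b) * e4
      - (q - q ^ 2) * a * (a - b) * (c - q * b) * e3
      + (b-c)*(q*b-q^2*a)*(q*c-q^2*a) * d3
      + q*(q-q^2)*a*(b-c)*(b-q*c) * d1 - q*(q-q^2)*a*(b-c)*(c-q*b)*d2
  have k1 : -q*(q-q^2)*a*(b-q*c)*(b-c)*(a-q*b) + (b-q*c)*(q-q^2)^2*a*b*(a-c)
        - (c-q*b)*(q-q^2)*a*(a-b)*(q*b-q^2*c) = 0 := by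
    grind
  have k2 : -(b-q*c)*(q-q^2)*a*(a-c)*(q*c-q^2*b) + q*(q-q^2)*a*(c-q*b)*(b-c)*(a-q*c)
        + (c-q*b)*(q-q^2)^2*a*c*(a-b) = 0 := by
    grind
  rw [k1, k2] at key
  linear_combination key

lemma Diag.apply_T_T_succ {i : ℕ} {p : Poly} (hp : Diag (i + 1) p) :
    Diag i (T (i + 1) (T i p)) := by
  have e1 := T_spec i p
  have e2 := congrArg (sw (i + 1)) e1
  have e3 := congrArg (sw i) e1
  have e4 := congrArg (sw i) e2
  have f1 := T_spec (i + 1) (T i p)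
  have f2 := congrArg (sw i) f1
  have d2 := congrArg (sw i) hp
  have d3 := congrArg (sw (i + 1)) d2
  simp only [map_mul, map_sub, sw_C, map_pow, sw_X_left, sw_X_right, ← sw_braid, sw_sw,
    sw_X_of_ne (show i ≠ i + 1 by omega) (show i ≠ i + 1 + 1 by omega),
    sw_X_of_ne (show i + 1 + 1 ≠ i by omega) (show i + 1 + 1 ≠ i + 1 by omega)] at *
  exact braid_left C_om_sq (X_sub_ne (by omega)) (X_sub_ne (by omega)) (X_sub_ne (by omega))
    hp d2 d3 e1 e2 e3 e4 f1 f2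

lemma Diag.apply_T_T {i : ℕ} {p : Poly} (hp : Diag i p) : Diag (i + 1) (T i (T (i + 1) p)) := by
  have e1 := T_spec (i + 1) p
  have e2 := congrArg (sw i) e1
  have e3 := congrArg (sw (i + 1)) e1
  have e4 := congrArg (sw (i + 1)) e2
  have f1 := T_spec i (T (i + 1) p)
  have f2 := congrArg (sw (i + 1)) f1
  have d1 := hp
  unfold Diag at d1
  have d2 := congrArg (sw (i + 1)) d1
  have d3 := congrArg (sw i) d2
  simp only [map_mul, map_sub, sw_C, map_pow, sw_X_left, sw_X_right, sw_braid, sw_sw,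
    sw_X_of_ne (show i ≠ i + 1 by omega) (show i ≠ i + 1 + 1 by omega),
    sw_X_of_ne (show i + 1 + 1 ≠ i by omega) (show i + 1 + 1 ≠ i + 1 by omega)] at *
  exact braid_right C_om_sq (X_sub_ne (by omega)) (X_sub_ne (by omega)) (X_sub_ne (by omega))
    d1 d2 d3 e1 e2 e3 e4 f1 f2

section Base

variable {R : Type*} [CommRing R]

/-- The factor of the extremal component carried by the down spins. -/
def gD (B q : R) : List R → R
  | [] => 1
  | a :: l => (B - a) * (l.map fun y => (y - q * a) * (a * y - q)).prod * gD B q l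

/-- The factor of the extremal component carried by the up spins. -/
def gU (q : R) : List R → R
  | [] => 1
  | a :: l => (l.map fun y => (y - q * a) * (a * y - q ^ 2)).prod * gU q l

/-- The extremal component, for down spins at `D` followed by up spins at `U`. -/
def base (B q : R) (D U : List R) : R :=
  if U.length = D.length then gD B q D * gU q U * U.prod
  else if U.length = D.length + 1 then gD B q D * gU q U else 0

lemma map_gD {S : Type*} [CommRing S] (f : R →+* S) (B q : R) (l : List R) :
    f (gD B q l) = gD (f B) (f q) (l.map f) := by
  induction l with
  | nil => simp [gD]
  | cons a l ih => simp [gD, ih, map_list_prod, Function.comp_def]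

lemma map_gU {S : Type*} [CommRing S] (f : R →+* S) (q : R) (l : List R) :
    f (gU q l) = gU (f q) (l.map f) := by
  induction l with
  | nil => simp [gU]
  | cons a l ih => simp [gU, ih, map_list_prod, Function.comp_def]

lemma map_base {S : Type*} [CommRing S] (f : R →+* S) (B q : R) (D U : List R) :
    f (base B q D U) = base (f B) (f q) (D.map f) (U.map f) := by
  unfold base
  split_ifs <;> simp_all [map_gD, map_gU, map_list_prod]

lemma gD_swap (B q a b : R) (l r : List R) :
    (a - q * b) * gD B q (l ++ a :: b :: r) = (b - q * a) * gD B q (l ++ b :: a :: r) := by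
  induction l with
  | nil => simp only [List.nil_append, gD, List.map_cons, List.prod_cons]; ring
  | cons c l ih =>
    simp only [List.cons_append, gD, List.map_append, List.map_cons, List.prod_append,
      List.prod_cons]
    linear_combination (B - c) * ((l.map fun y => (y - q * c) * (c * y - q)).prod
      * ((a - q * c) * (c * a - q) * ((b - q * c) * (c * b - q)
      * (r.map fun y => (y - q * c) * (c * y - q)).prod))) * ih

lemma gU_swap (q a b : R) (l r : List R) :
    (a - q * b) * gU q (l ++ a :: b :: r) = (b - q * a) * gU q (l ++ b :: a :: r) := by
  induction l with
  | nil => simp only [List.nil_append, gU, List.map_cons, List.prod_cons]; ring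
  | cons c l ih =>
    simp only [List.cons_append, gU, List.map_append, List.map_cons, List.prod_append,
      List.prod_cons]
    linear_combination ((l.map fun y => (y - q * c) * (c * y - q ^ 2)).prod
      * ((a - q * c) * (c * a - q ^ 2) * ((b - q * c) * (c * b - q ^ 2)
      * (r.map fun y => (y - q * c) * (c * y - q ^ 2)).prod))) * ih

lemma base_swap_left (B q a b : R) (l r U : List R) :
    (a - q * b) * base B q (l ++ a :: b :: r) U =
      (b - q * a) * base B q (l ++ b :: a :: r) U := by
  unfold base
  simp only [List.length_append, List.length_cons]
  split_ifs
  · linear_combination gU q U * U.prod * gD_swap B q a b l r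
  · linear_combination gU q U * gD_swap B q a b l r
  · ring

lemma base_swap_right (B q a b : R) (l r D : List R) :
    (a - q * b) * base B q D (l ++ a :: b :: r) =
      (b - q * a) * base B q D (l ++ b :: a :: r) := by
  unfold base
  simp only [List.length_append, List.length_cons, List.prod_append, List.prod_cons]
  split_ifs
  · linear_combination gD B q D * (l.prod * (a * (b * r.prod))) * gU_swap q a b l r
  · linear_combination gD B q D * gU_swap q a b l r
  · ring

end Base

end QKZ

namespace QKZ
open MvPolynomial

/-- The number of pairs of an up spin to the left of a down spin. -/
def inv : List Bool → ℕ
  | [] => 0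
  | true :: l => inv l
  | false :: l => inv l + l.count true

lemma inv_swap (l r : List Bool) :
    inv (l ++ true :: false :: r) < inv (l ++ false :: true :: r) := by
  induction l with
  | nil => simp [inv]
  | cons c l ih => cases c <;> simp [inv] <;> omega

/-- The extremal component as a polynomial. -/
def baseP (B : ℂ) (α : List Bool) : Poly :=
  base (C B) (C om) ((List.range' 0 (α.count true)).map X)
    ((List.range' (α.count true) (α.count false)).map X)

/-- The components of the polynomial solution of the exchange relations. -/
def P (B : ℂ) (α : List Bool) : Poly :=
  if h : ∃ p : List Bool × List Bool, α = p.1 ++ false :: true :: p.2 then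
    T h.choose.1.length (P B (h.choose.1 ++ true :: false :: h.choose.2))
  else baseP B α
termination_by inv α
decreasing_by
  conv_rhs => rw [h.choose_spec]
  exact inv_swap _ _

lemma eq_replicate_append {α : List Bool}
    (h : ¬ ∃ p : List Bool × List Bool, α = p.1 ++ false :: true :: p.2) :
    α = List.replicate (α.count true) true ++ List.replicate (α.count false) false := by
  induction α with
  | nil => simp
  | cons c l ih =>
    have h' : ¬ ∃ p : List Bool × List Bool, l = p.1 ++ false :: true :: p.2 := by
      rintro ⟨p, hp⟩
      exact h ⟨(c :: p.1, p.2), by simp [hp]⟩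
    have ih := ih h'
    cases c with
    | true =>
      simp only [List.count_cons_self, List.replicate_succ, List.cons_append]
      rw [List.count_cons_of_ne (by simp), ← ih]
    | false =>
      have h0 : l.count true = 0 := by
        by_contra h0
        obtain ⟨k, hk⟩ := Nat.exists_eq_succ_of_ne_zero h0
        rw [hk, List.replicate_succ, List.cons_append] at ih
        exact h ⟨([], List.replicate k true ++ List.replicate (l.count false) false), by
          simpa using ih⟩
      rw [h0] at ih
      simp only [List.count_cons_self]
      rw [List.count_cons_of_ne (by simp), h0, List.replicate_succ]
      simpa using ih

lemma P_sorted (B : ℂ) (n m : ℕ) :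
    P B (List.replicate n true ++ List.replicate m false) =
      base (C B) (C om) ((List.range' 0 n).map X) ((List.range' n m).map X) := by
  have hs : ¬ ∃ p : List Bool × List Bool,
      List.replicate n true ++ List.replicate m false = p.1 ++ false :: true :: p.2 := by
    rintro ⟨⟨l, r⟩, h⟩
    induction n generalizing l with
    | zero =>
      have : true ∈ List.replicate m false := by
        have h : List.replicate m false = l ++ false :: true :: r := by simpa using h
        rw [h]; simp
      simp at this
    | succ n ih =>
      cases l with
      | nil => simp [List.replicate_succ] at h
      | cons c l =>
        simp only [List.replicate_succ, List.cons_append, List.cons.injEq] at h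
        exact ih l h.2
  rw [P, dif_neg hs, baseP]
  simp [List.count_replicate]

lemma P_descent (B : ℂ) (l r : List Bool) :
    P B (l ++ false :: true :: r) = T l.length (P B (l ++ true :: false :: r)) := by
  generalize hk : inv (l ++ false :: true :: r) = k
  induction k using Nat.strong_induction_on generalizing l r with
  | _ k ih =>
    have hex : ∃ p : List Bool × List Bool,
        l ++ false :: true :: r = p.1 ++ false :: true :: p.2 := ⟨(l, r), rfl⟩
    rw [P, dif_pos hex]
    have hspec := hex.choose_spec
    generalize hex.choose = p at hspec
    obtain ⟨l', r'⟩ := p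
    simp only at hspec ⊢
    have far : ∀ (a b c : List Bool),
        inv (a ++ false :: true :: (b ++ false :: true :: c)) = k →
        T a.length (P B (a ++ true :: false :: (b ++ false :: true :: c))) =
        T (a.length + 2 + b.length)
          (P B (a ++ false :: true :: (b ++ true :: false :: c))) := by
      intro a b c hinv
      have h1 := ih _ (hinv ▸ inv_swap _ _) (a ++ true :: false :: b) c (by simp)
      have h2 := ih (inv (a ++ false :: true :: (b ++ true :: false :: c)))
        (by
          have := inv_swap (a ++ false :: true :: b) c
          simp only [List.append_assoc, List.cons_append] at this
          omega) a (b ++ true :: false :: c) rfl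
      simp only [List.append_assoc, List.cons_append, List.length_append,
        List.length_cons] at h1
      rw [h1, h2, T_comm (i := a.length) (j := a.length + (b.length + 1 + 1)) (by omega)]
      congr 1
      omega
    rcases List.append_eq_append_iff.1 hspec with ⟨as, rfl, h⟩ | ⟨bs, rfl, h⟩
    · match as, h with
      | [], h =>
        simp only [List.nil_append, List.cons.injEq, true_and] at h
        subst h
        simp
      | [x], h => simp at h
      | x :: y :: b, h =>
        simp only [List.cons_append, List.cons.injEq] at h
        obtain ⟨rfl, rfl, rfl⟩ := h
        have := far l b r' hk
        simp only [List.append_assoc, List.cons_append, List.length_append, List.length_cons]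
        rw [this]
        congr 1
        omega
    · match bs, h with
      | [], h =>
        simp only [List.nil_append, List.cons.injEq, true_and] at h
        subst h
        simp
      | [x], h => simp at h
      | x :: y :: b, h =>
        simp only [List.cons_append, List.cons.injEq] at h
        obtain ⟨rfl, rfl, rfl⟩ := h
        have := far l' b r (by simpa using hk)
        simp only [List.append_assoc, List.cons_append, List.length_append, List.length_cons]
        rw [this]
        congr 1
        omega

lemma map_sw_range' (i s k : ℕ) (h : i + 1 < s ∨ s + k ≤ i) :
    ((List.range' s k).map X).map (sw i) = ((List.range' s k).map X : List Poly) := by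
  rw [List.map_map]
  apply List.map_congr_left
  intro j hj
  rw [List.mem_range'_1] at hj
  exact sw_X_of_ne (by omega) (by omega)

lemma map_range'_split (s j k : ℕ) : ((List.range' s (j + (k + 2))).map X : List Poly) =
    (List.range' s j).map X ++ X (s + j) :: X (s + j + 1) :: (List.range' (s + j + 2) k).map X := by
  have h := List.range'_append_1 (s := s) (m := j) (n := k + 2)
  rw [← h]
  simp [List.range'_succ]

lemma diag_sorted (B : ℂ) (l r : List Bool) (s : Bool) (n m : ℕ)
    (h : l ++ s :: s :: r = List.replicate n true ++ List.replicate m false) :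
    Diag l.length (P B (l ++ s :: s :: r)) := by
  have hi0 := congrArg (fun L => L[l.length]?) h
  have hi1 := congrArg (fun L => L[l.length + 1]?) h
  have hlen := congrArg List.length h
  simp only [List.getElem?_append, List.length_replicate, List.getElem?_replicate,
    List.length_append, List.length_cons] at hi0 hi1 hlen
  simp only [lt_irrefl, if_false, Nat.sub_self, List.getElem?_cons_zero,
    Nat.add_sub_cancel_left, List.getElem?_cons_succ,
    show ¬ (l.length + 1 < l.length) by omega] at hi0 hi1
  rw [h, P_sorted, Diag]
  have hsw : ∀ L M : List Poly, sw l.length (base (C B) (C om) L M) =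
      base (C B) (C om) (L.map (sw l.length)) (M.map (sw l.length)) := by
    intro L M
    have := map_base (sw l.length : Poly →+* Poly) (C B) (C om) L M
    simpa [sw_C] using this
  rw [hsw]
  rcases lt_or_ge (l.length + 1) n with hn | hn
  · obtain ⟨k, rfl⟩ := Nat.exists_eq_add_of_lt hn
    rw [map_sw_range' _ (l.length + 1 + k + 1) m (by omega),
      show l.length + 1 + k + 1 = l.length + (k + 2) by omega, map_range'_split]
    rw [List.map_append, List.map_cons, List.map_cons, map_sw_range' _ _ _ (by omega),
      map_sw_range' _ _ _ (by omega), zero_add, sw_X_left, sw_X_right]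
    exact base_swap_left _ _ _ _ _ _ _
  · have hn' : n ≤ l.length := by
      by_contra hc
      rw [if_pos (by omega), if_pos (by omega)] at hi0
      rw [if_neg (by omega), if_pos (by omega)] at hi1
      simp_all
    obtain ⟨j, hj⟩ := Nat.exists_eq_add_of_le hn'
    obtain ⟨k, rfl⟩ : ∃ k, m = j + (k + 2) := ⟨m - j - 2, by omega⟩
    rw [map_sw_range' _ 0 n (by omega), map_range'_split, List.map_append, List.map_cons,
      List.map_cons, map_sw_range' _ _ _ (by omega), map_sw_range' _ _ _ (by omega), ← hj,
      sw_X_left, sw_X_right]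
    exact base_swap_right _ _ _ _ _ _ _

lemma P_diag (B : ℂ) (l r : List Bool) (s : Bool) :
    Diag l.length (P B (l ++ s :: s :: r)) := by
  generalize hk : inv (l ++ s :: s :: r) = k
  induction k using Nat.strong_induction_on generalizing l r s with
  | _ k ih =>
    by_cases hex : ∃ p : List Bool × List Bool,
        l ++ s :: s :: r = p.1 ++ false :: true :: p.2
    swap
    · exact diag_sorted B l r s _ _ (eq_replicate_append hex)
    obtain ⟨⟨l', r'⟩, h⟩ := hex
    simp only at h
    have hinv := inv_swap l' r'
    rw [← h, hk] at hinv
    rcases List.append_eq_append_iff.1 h with ⟨as, rfl, h'⟩ | ⟨bs, rfl, h'⟩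
    · match as, h' with
      | [], h' => 
        simp only [List.nil_append, List.cons.injEq] at h'
        simp_all
      | [x], h' =>
        simp only [List.cons_append, List.nil_append, List.cons.injEq] at h'
        obtain ⟨rfl, rfl, rfl⟩ := h'
        have h1 := P_descent B (l ++ [false]) r'
        have h2 := P_descent B l (false :: r')
        have h3 := inv_swap l (false :: r')
        simp only [List.append_assoc, List.cons_append, List.nil_append,
          List.length_append, List.length_singleton] at h1 hinv
        have h4 := ih (inv (l ++ true :: false :: false :: r')) (by omega) (l ++ [true]) r' false
          (by simp)
        simp only [List.append_assoc, List.cons_append, List.nil_append,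
          List.length_append, List.length_singleton] at h4
        rw [h1, h2]
        exact h4.apply_T_T_succ
      | x :: y :: b, h' =>
        simp only [List.cons_append, List.cons.injEq] at h'
        obtain ⟨rfl, rfl, rfl⟩ := h'
        have h1 := P_descent B (l ++ s :: s :: b) r'
        simp only [List.append_assoc, List.cons_append] at h1 hinv
        rw [h1]
        exact (ih _ hinv l _ s rfl).apply_T
          (by simp only [List.length_append, List.length_cons]; omega)
    · match bs, h' with
      | [], h' => 
        simp only [List.nil_append, List.cons.injEq] at h'
        simp_all
      | [x], h' =>
        simp only [List.cons_append, List.nil_append, List.cons.injEq] at h'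
        obtain ⟨rfl, rfl, rfl⟩ := h'
        have h1 := P_descent B l' (true :: r)
        have h2 := P_descent B (l' ++ [true]) r
        have h3 := inv_swap (l' ++ [true]) r
        simp only [List.append_assoc, List.cons_append, List.nil_append,
          List.length_append, List.length_singleton] at h1 h2 h3 hinv ⊢
        have h4 := ih _ (by omega) l' (false :: r) true rfl
        rw [h1, h2]
        exact h4.apply_T_T
      | x :: y :: b, h' =>
        simp only [List.cons_append, List.cons.injEq] at h'
        obtain ⟨rfl, rfl, rfl⟩ := h'
        have h1 := P_descent B l' (b ++ s :: s :: r)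
        simp only [List.append_assoc, List.cons_append] at h1 hinv ⊢
        rw [h1]
        have h4 := ih _ hinv (l' ++ true :: false :: b) r s (by simp)
        simp only [List.append_assoc, List.cons_append, List.length_append,
          List.length_cons] at h4 ⊢
        exact h4.apply_T (j := l'.length) (by omega)

end QKZ

namespace QKZ
open MvPolynomial

lemma degreeOf_lin (k i j : ℕ) (a b : Poly) (ha : a.degreeOf k = 0) (hb : b.degreeOf k = 0) :
    (a * X j - b * X i : Poly).degreeOf k ≤ if k = i ∨ k = j then 1 else 0 := by
  refine (degreeOf_sub_le _ _ _).trans (max_le ?_ ?_)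
  · refine (degreeOf_mul_le _ _ _).trans ?_
    rw [ha, degreeOf_X]
    split_ifs <;> simp_all
  · refine (degreeOf_mul_le _ _ _).trans ?_
    rw [hb, degreeOf_X]
    split_ifs <;> simp_all

lemma degreeOf_T {d : ℕ} {p : Poly} (hp : ∀ k, p.degreeOf k ≤ d) (i k : ℕ) :
    (T i p).degreeOf k ≤ d := by
  by_cases h0 : T i p = 0
  · rw [h0, degreeOf_zero]; exact Nat.zero_le _
  have h1 := congrArg (degreeOf k) (T_spec i p)
  rw [degreeOf_mul_eq (X_sub_ne (by omega)) h0] at h1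
  have hC : ∀ c : ℂ, (C c : Poly).degreeOf k = 0 := fun c => degreeOf_C _ _
  have hC2 : (C om ^ 2 : Poly).degreeOf k = 0 := by rw [← map_pow]; exact hC _
  have hC3 : (C om - C om ^ 2 : Poly).degreeOf k = 0 := by
    rw [← map_pow, ← map_sub]; exact hC _
  have hsw : (sw i p).degreeOf k ≤ d := by
    have := degreeOf_rename_of_injective (p := p) (Equiv.swap i (i + 1)).injective
      (Equiv.swap i (i + 1) k)
    rw [Equiv.swap_apply_self] at this
    exact this.trans_le (hp _)
  have h2 : ((C om * X (i + 1) - C om ^ 2 * X i) * sw i p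
      - (C om - C om ^ 2) * X i * p).degreeOf k ≤ (if k = i ∨ k = i + 1 then 1 else 0) + d := by
    refine (degreeOf_sub_le _ _ _).trans (max_le ?_ ?_)
    · refine (degreeOf_mul_le _ _ _).trans (add_le_add ?_ hsw)
      exact degreeOf_lin _ _ _ _ _ (hC _) hC2
    · refine (degreeOf_mul_le _ _ _).trans (add_le_add ?_ (hp k))
      refine (degreeOf_mul_le _ _ _).trans ?_
      rw [hC3, degreeOf_X]
      split_ifs <;> simp_all
  have h3 : (if k = i ∨ k = i + 1 then 1 else 0) ≤ (X i - X (i + 1) : Poly).degreeOf k := by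
    split_ifs with hk
    · rcases hk with rfl | rfl
      · rw [sub_eq_add_neg, degreeOf_add_eq_of_degreeOf_lt]
        · rw [degreeOf_X_self]
        · rw [degreeOf_neg, degreeOf_X_self, degreeOf_X_of_ne (by omega)]; exact one_pos
      · rw [sub_eq_neg_add, degreeOf_add_eq_of_degreeOf_lt]
        · rw [degreeOf_neg, degreeOf_X_self]
        · rw [degreeOf_neg, degreeOf_X_self, degreeOf_X_of_ne (by omega)]; exact one_pos
    · exact Nat.zero_le _
  omega

lemma degreeOf_pair_prod (c : ℂ) (k a : ℕ) (l : List ℕ) (ha : a ∉ l) :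
    ((l.map X).map fun y : Poly => (y - C om * X a) * (X a * y - C c)).prod.degreeOf k ≤
      if k = a then 2 * l.length else 2 * l.count k := by
  induction l with
  | nil => simp
  | cons b l ih =>
    simp only [List.mem_cons, not_or] at ha
    simp only [List.map_cons, List.prod_cons, List.length_cons]
    refine (degreeOf_mul_le _ _ _).trans ?_
    have h1 := ih ha.2
    have h2 : ((X b - C om * X a) * (X a * X b - C c) : Poly).degreeOf k ≤
        if k = a ∨ k = b then 2 else 0 := by
      have e1 : (X b - C om * X a : Poly).degreeOf k ≤ if k = a ∨ k = b then 1 else 0 := by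
        have := degreeOf_lin k a b 1 (C om) (degreeOf_one _) (degreeOf_C _ _)
        rwa [one_mul] at this
      have e2 : (X a * X b - C c : Poly).degreeOf k ≤ if k = a ∨ k = b then 1 else 0 := by
        refine (degreeOf_sub_le _ _ _).trans (max_le ?_ ?_)
        · refine (degreeOf_mul_le _ _ _).trans ?_
          rw [degreeOf_X, degreeOf_X]
          have := ha.1
          split_ifs <;> simp_all
        · rw [degreeOf_C]; exact Nat.zero_le _
      refine (degreeOf_mul_le _ _ _).trans ?_
      split_ifs at * <;> omega
    rw [List.count_cons]
    have := ha.1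
    by_cases hka : k = a
    · simp only [hka, true_or, if_true] at *
      omega
    · by_cases hkb : k = b
      · subst hkb
        simp only [hka, false_or, if_true, if_false, beq_self_eq_true] at *
        omega
      · simp only [hka, hkb, or_self, if_false] at *
        omega

lemma degreeOf_gU (k : ℕ) (l : List ℕ) (hl : l.Nodup) :
    (gU (C om) (l.map X) : Poly).degreeOf k ≤ if k ∈ l then 2 * (l.length - 1) else 0 := by
  induction l with
  | nil => simp [gU]
  | cons a l ih =>
    rw [List.nodup_cons] at hl
    simp only [List.map_cons, gU]
    refine (degreeOf_mul_le _ _ _).trans ?_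
    have h1 := ih hl.2
    have h2 := degreeOf_pair_prod (om ^ 2) k a l hl.1
    rw [map_pow] at h2
    by_cases hka : k = a
    · subst hka
      simp only [hl.1, if_true, if_false, List.mem_cons, true_or, List.length_cons] at *
      omega
    · simp only [hka, if_false, List.mem_cons, false_or, List.length_cons] at *
      by_cases hkl : k ∈ l
      · rw [List.count_eq_one_of_mem hl.2 hkl] at h2
        have := List.length_pos_of_mem hkl
        simp only [hkl, if_true] at *
        omega
      · rw [List.count_eq_zero_of_not_mem hkl] at h2
        simp only [hkl, if_false] at *
        omega

lemma degreeOf_gD (B : ℂ) (k : ℕ) (l : List ℕ) (hl : l.Nodup) :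
    (gD (C B) (C om) (l.map X) : Poly).degreeOf k ≤ if k ∈ l then 2 * l.length - 1 else 0 := by
  induction l with
  | nil => simp [gD]
  | cons a l ih =>
    rw [List.nodup_cons] at hl
    simp only [List.map_cons, gD]
    refine (degreeOf_mul_le _ _ _).trans ?_
    refine (add_le_add_left (degreeOf_mul_le _ _ _) _).trans ?_
    have h1 := ih hl.2
    have h2 := degreeOf_pair_prod om k a l hl.1
    have h0 : (C B - X a : Poly).degreeOf k ≤ if k = a then 1 else 0 := by
      refine (degreeOf_sub_le _ _ _).trans ?_
      rw [degreeOf_C, degreeOf_X]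
      simp
    by_cases hka : k = a
    · subst hka
      simp only [hl.1, if_true, if_false, List.mem_cons, true_or, List.length_cons] at *
      omega
    · simp only [hka, if_false, List.mem_cons, false_or, List.length_cons] at *
      by_cases hkl : k ∈ l
      · rw [List.count_eq_one_of_mem hl.2 hkl] at h2
        have := List.length_pos_of_mem hkl
        simp only [hkl, if_true] at *
        omega
      · rw [List.count_eq_zero_of_not_mem hkl] at h2
        simp only [hkl, if_false] at *
        omega

lemma degreeOf_prod_X (k : ℕ) (l : List ℕ) :
    ((l.map X).prod : Poly).degreeOf k ≤ l.count k := by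
  induction l with
  | nil => simp
  | cons a l ih =>
    simp only [List.map_cons, List.prod_cons]
    refine (degreeOf_mul_le _ _ _).trans ?_
    rw [degreeOf_X, List.count_cons]
    by_cases h : k = a
    · simp only [h, if_true, beq_self_eq_true] at *; omega
    · simp only [h, if_false] at *; omega

lemma degreeOf_base (B : ℂ) (k n m : ℕ) :
    (base (C B) (C om) ((List.range' 0 n).map X) ((List.range' n m).map X) : Poly).degreeOf k
      ≤ n + m - 1 := by
  have h1 := degreeOf_gD B k (List.range' 0 n) List.nodup_range'
  have h2 := degreeOf_gU k (List.range' n m) List.nodup_range'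
  have h3 := degreeOf_prod_X k (List.range' n m)
  simp only [List.mem_range'_1, List.length_range'] at h1 h2
  have h4 : (List.range' n m).count k ≤ if n ≤ k ∧ k < n + m then 1 else 0 := by
    split_ifs with h
    · exact List.nodup_iff_count_le_one.1 List.nodup_range' _
    · exact (List.count_eq_zero_of_not_mem (by rwa [List.mem_range'_1])).le
  unfold base
  simp only [List.length_map, List.length_range']
  split_ifs with c1 c2
  · refine (degreeOf_mul_le _ _ _).trans ?_
    refine (add_le_add_left (degreeOf_mul_le _ _ _) _).trans ?_
    split_ifs at h1 h2 h4 <;> omega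
  · refine (degreeOf_mul_le _ _ _).trans ?_
    split_ifs at h1 h2 <;> omega
  · rw [degreeOf_zero]; exact Nat.zero_le _

lemma degreeOf_P (B : ℂ) (α : List Bool) (k : ℕ) : (P B α).degreeOf k ≤ α.length - 1 := by
  generalize hk : inv α = w
  induction w using Nat.strong_induction_on generalizing α k with
  | _ w ih =>
    by_cases hex : ∃ p : List Bool × List Bool, α = p.1 ++ false :: true :: p.2
    · obtain ⟨⟨l, r⟩, rfl⟩ := hex
      rw [P_descent]
      have hlen : (l ++ true :: false :: r).length = (l ++ false :: true :: r).length := by simp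
      simp only at hlen ⊢
      rw [← hlen]
      exact degreeOf_T (fun k => ih _ (hk ▸ inv_swap l r) _ k rfl) _ _
    · have h := eq_replicate_append hex
      have hlen := congrArg List.length h
      simp only [List.length_append, List.length_replicate] at hlen
      rw [h, P_sorted]
      simp only [List.length_append, List.length_replicate]
      exact degreeOf_base _ _ _ _

lemma P_eq_zero (B : ℂ) (α : List Bool) (h1 : α.count false ≠ α.count true)
    (h2 : α.count false ≠ α.count true + 1) : P B α = 0 := by
  generalize hk : inv α = w
  induction w using Nat.strong_induction_on generalizing α with
  | _ w ih =>
    by_cases hex : ∃ p : List Bool × List Bool, α = p.1 ++ false :: true :: p.2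
    · obtain ⟨⟨l, r⟩, rfl⟩ := hex
      rw [P_descent, ih _ (hk ▸ inv_swap l r) _ _ _ rfl, T_zero]
      · simp at h1 ⊢; exact h1
      · simp at h2 ⊢; exact h2
    · rw [eq_replicate_append hex, P_sorted, base, if_neg (by simpa), if_neg (by simpa)]

/-- The solution evaluated at a list of spectral parameters. -/
def Psi (B : ℂ) (z : List ℂ) (α : List Bool) : ℂ := eval (fun i => z.getD i 0) (P B α)

lemma eval_sw (p : Poly) (A r : List ℂ) (a b : ℂ) :
    eval (fun i => (A ++ a :: b :: r).getD i 0) (sw A.length p) =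
      eval (fun i => (A ++ b :: a :: r).getD i 0) p := by
  rw [sw, eval_rename]
  congr 1
  congr 1
  funext k
  simp only [Function.comp, Equiv.swap_apply_def, List.getD_eq_getElem?_getD]
  split_ifs with h1 h2
  · subst h1; simp
  · subst h2; simp
  · rcases lt_or_ge k A.length with h | h
    · simp [List.getElem?_append, h]
    · obtain ⟨j, rfl⟩ : ∃ j, k = A.length + (j + 2) := ⟨k - A.length - 2, by omega⟩
      simp [List.getElem?_append]

lemma getD_mid0 (A r : List ℂ) (a b : ℂ) : (A ++ a :: b :: r).getD A.length 0 = a := by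
  simp [List.getD_eq_getElem?_getD]

lemma getD_mid1 (A r : List ℂ) (a b : ℂ) : (A ++ a :: b :: r).getD (A.length + 1) 0 = b := by
  simp [List.getD_eq_getElem?_getD]

lemma Psi_exch (B : ℂ) {A : List ℂ} {α : List Bool} (h : A.length = α.length) (a b : ℂ)
    (r : List ℂ) (β : List Bool) :
    (a - b) * Psi B (A ++ a :: b :: r) (α ++ false :: true :: β) =
      (om * b - om ^ 2 * a) * Psi B (A ++ b :: a :: r) (α ++ true :: false :: β)
      - (om - om ^ 2) * a * Psi B (A ++ a :: b :: r) (α ++ true :: false :: β) := by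
  have := congrArg (eval (fun i => (A ++ a :: b :: r).getD i 0))
    (T_spec A.length (P B (α ++ true :: false :: β)))
  simp only [map_mul, map_sub, map_pow, eval_X, eval_C, eval_sw, getD_mid0, getD_mid1] at this
  unfold Psi
  rw [P_descent, ← h]
  exact this

lemma Psi_exch' (B : ℂ) {A : List ℂ} {α : List Bool} (h : A.length = α.length) (a b : ℂ)
    (r : List ℂ) (β : List Bool) :
    (b - a) * Psi B (A ++ b :: a :: r) (α ++ true :: false :: β) =
      (om * a - om ^ 2 * b) * Psi B (A ++ a :: b :: r) (α ++ false :: true :: β)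
      - (om - om ^ 2) * a * Psi B (A ++ b :: a :: r) (α ++ false :: true :: β) := by
  by_cases hab : a = b
  · subst hab; ring
  have h1 := Psi_exch B h a b r β
  have h2 := Psi_exch B h b a r β
  have hq := om_sq
  apply mul_left_cancel₀ (sub_ne_zero.2 hab)
  generalize Psi B (A ++ a :: b :: r) (α ++ false :: true :: β) = x1 at *
  generalize Psi B (A ++ b :: a :: r) (α ++ false :: true :: β) = x2 at *
  generalize Psi B (A ++ a :: b :: r) (α ++ true :: false :: β) = y1 at *
  generalize Psi B (A ++ b :: a :: r) (α ++ true :: false :: β) = y2 at *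
  have key : (a - b) * ((b - a) * y2) - (a - b) * ((om * a - om ^ 2 * b) * x1
      - (om - om ^ 2) * a * x2) = (-(a-b)^2 - (om * b - om ^ 2 * a)*(om * a - om ^ 2 * b)
      + (om - om ^ 2)^2 * a * b) * y2 := by
    linear_combination (-(om * a - om ^ 2 * b)) * h1 - (om - om ^ 2) * a * h2
  have k1 : (-(a-b)^2 - (om * b - om ^ 2 * a)*(om * a - om ^ 2 * b)
      + (om - om ^ 2)^2 * a * b) = 0 := by grind
  rw [k1] at key
  linear_combination key

lemma Psi_diag (B : ℂ) {A : List ℂ} {α : List Bool} (h : A.length = α.length) (a b : ℂ)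
    (r : List ℂ) (s : Bool) (β : List Bool) :
    (a - om * b) * Psi B (A ++ a :: b :: r) (α ++ s :: s :: β) =
      (b - om * a) * Psi B (A ++ b :: a :: r) (α ++ s :: s :: β) := by
  have := congrArg (eval (fun i => (A ++ a :: b :: r).getD i 0)) (P_diag B α β s)
  rw [← h] at this
  unfold Psi
  simpa only [map_mul, map_sub, eval_X, eval_C, eval_sw, getD_mid0, getD_mid1] using this

lemma Psi_base (B : ℂ) (D U : List ℂ) :
    Psi B (D ++ U) (List.replicate D.length true ++ List.replicate U.length false) =
      base B om D U := by
  rw [Psi, P_sorted, map_base]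
  simp only [eval_C, List.map_map]
  congr 1
  · apply List.ext_getElem (by simp)
    intro i h1 h2
    simp [List.getD_eq_getElem?_getD, List.getElem?_append, h2]
  · apply List.ext_getElem (by simp)
    intro i h1 h2
    simp [List.getD_eq_getElem?_getD, List.getElem?_append, h2]

lemma Psi_eq_zero (B : ℂ) (z : List ℂ) (α : List Bool) (h1 : α.count false ≠ α.count true)
    (h2 : α.count false ≠ α.count true + 1) : Psi B z α = 0 := by
  rw [Psi, P_eq_zero B α h1 h2, map_zero]

/-- `f` is a polynomial function of degree at most `d`. -/
def PolyDeg (d : ℕ) (f : ℂ → ℂ) : Prop :=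
  ∃ p : Polynomial ℂ, p.natDegree ≤ d ∧ ∀ t, f t = p.eval t

lemma PolyDeg.eq_zero {d : ℕ} {f : ℂ → ℂ} (hf : PolyDeg d f) (s : Finset ℂ) (hs : d < s.card)
    (h : ∀ t ∈ s, f t = 0) (t : ℂ) : f t = 0 := by
  obtain ⟨p, hp, e⟩ := hf
  have := Polynomial.eq_zero_of_natDegree_lt_card_of_eval_eq_zero' p s
    (fun i hi => by rw [← e]; exact h i hi) (by omega)
  rw [e, this, Polynomial.eval_zero]

lemma PolyDeg.mono {d e : ℕ} {f : ℂ → ℂ} (hf : PolyDeg d f) (h : d ≤ e) : PolyDeg e f := by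
  obtain ⟨p, hp, e⟩ := hf
  exact ⟨p, hp.trans h, e⟩

lemma PolyDeg.const (c : ℂ) : PolyDeg 0 (fun _ => c) := ⟨Polynomial.C c, by simp, by simp⟩

lemma PolyDeg.mul {d e : ℕ} {f g : ℂ → ℂ} (hf : PolyDeg d f) (hg : PolyDeg e g) :
    PolyDeg (d + e) (fun t => f t * g t) := by
  obtain ⟨p, hp, e1⟩ := hf
  obtain ⟨r, hr, e2⟩ := hg
  exact ⟨p * r, Polynomial.natDegree_mul_le.trans (add_le_add hp hr), by simp [e1, e2]⟩

lemma PolyDeg.add {d : ℕ} {f g : ℂ → ℂ} (hf : PolyDeg d f) (hg : PolyDeg d g) :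
    PolyDeg d (fun t => f t + g t) := by
  obtain ⟨p, hp, e1⟩ := hf
  obtain ⟨r, hr, e2⟩ := hg
  exact ⟨p + r, (Polynomial.natDegree_add_le _ _).trans (max_le hp hr), by simp [e1, e2]⟩

lemma PolyDeg.sub {d : ℕ} {f g : ℂ → ℂ} (hf : PolyDeg d f) (hg : PolyDeg d g) :
    PolyDeg d (fun t => f t - g t) := by
  obtain ⟨p, hp, e1⟩ := hf
  obtain ⟨r, hr, e2⟩ := hg
  exact ⟨p - r, (Polynomial.natDegree_sub_le _ _).trans (max_le hp hr), by simp [e1, e2]⟩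

lemma PolyDeg.pow (k : ℕ) : PolyDeg k (fun t => t ^ k) :=
  ⟨Polynomial.X ^ k, by simp, by simp⟩

/-- The reciprocal of a polynomial function. -/
lemma PolyDeg.exists_rev {d : ℕ} {f : ℂ → ℂ} (hf : PolyDeg d f) :
    ∃ g, PolyDeg d g ∧ ∀ t, t ≠ 0 → g t = t ^ d * f t⁻¹ := by
  obtain ⟨p, hp, e⟩ := hf
  refine ⟨fun t => (p.reflect d).eval t, ⟨p.reflect d, ?_, fun _ => rfl⟩, ?_⟩
  · refine Polynomial.natDegree_le_iff_coeff_eq_zero.2 fun k hk => ?_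
    rw [Polynomial.coeff_reflect, Polynomial.revAt_eq_self_of_lt hk]
    exact Polynomial.coeff_eq_zero_of_natDegree_lt (by omega)
  · intro t ht
    let := invertibleOfNonzero (inv_ne_zero ht)
    have := Polynomial.eval₂_reflect_mul_pow (RingHom.id ℂ) t⁻¹ d p hp
    rw [invOf_eq_inv, inv_inv] at this
    simp only [Polynomial.eval₂_id] at this
    rw [e, ← this, mul_comm, mul_assoc, ← mul_pow, inv_mul_cancel₀ ht, one_pow, mul_one]

lemma polyDeg_eval (p : Poly) (k d : ℕ) (hd : p.degreeOf k ≤ d) (v : ℂ → ℕ → ℂ)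
    (hk : ∀ t, v t k = t) (hv : ∀ t j, j ≠ k → v t j = v 0 j) :
    PolyDeg d (fun t => eval (v t) p) := by
  refine ⟨∑ m ∈ p.support, Polynomial.C (p.coeff m * ∏ i ∈ m.support.erase k, v 0 i ^ m i) *
    Polynomial.X ^ m k, ?_, ?_⟩
  · apply Polynomial.natDegree_sum_le_of_forall_le
    intro m hm
    exact (Polynomial.natDegree_C_mul_X_pow_le _ _).trans ((degreeOf_le_iff.1 hd) m hm)
  · intro t
    beta_reduce
    rw [eval_eq, Polynomial.eval_finsetSum]
    apply Finset.sum_congr rfl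
    intro m hm
    simp only [Polynomial.eval_mul, Polynomial.eval_C, Polynomial.eval_pow, Polynomial.eval_X]
    rw [mul_assoc]
    congr 1
    by_cases hkm : k ∈ m.support
    · rw [← Finset.prod_erase_mul _ _ hkm, hk]
      congr 1
      exact Finset.prod_congr rfl fun j hj => by rw [hv t j (Finset.ne_of_mem_erase hj)]
    · rw [Finset.erase_eq_of_notMem hkm, Finsupp.notMem_support_iff.1 hkm, pow_zero, mul_one]
      exact Finset.prod_congr rfl fun j hj => by
        rw [hv t j (fun e => hkm (e ▸ hj))]

lemma Psi_polyDeg (B : ℂ) (A r : List ℂ) (α : List Bool) :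
    PolyDeg (α.length - 1) (fun t => Psi B (A ++ t :: r) α) := by
  refine polyDeg_eval _ A.length _ (degreeOf_P B α _) _ ?_ ?_
  · intro t; simp [List.getD_eq_getElem?_getD]
  · intro t j hj
    simp only [List.getD_eq_getElem?_getD]
    rcases lt_or_ge j A.length with h | h
    · simp [List.getElem?_append, h]
    · obtain ⟨j, rfl⟩ : ∃ i, j = A.length + (i + 1) := ⟨j - A.length - 1, by omega⟩
      simp [List.getElem?_append]

end QKZ

namespace QKZ
open MvPolynomial

lemma eq_zero_of_finite_compl {f : ℂ → ℂ} (hf : Continuous f) {s : Set ℂ} (hs : s.Finite)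
    (h : ∀ t, t ∉ s → f t = 0) (t : ℂ) : f t = 0 := by
  have hd : Dense sᶜ := hs.countable.dense_compl ℝ
  have := hf.ext_on hd continuous_const (g := fun _ => (0 : ℂ)) (fun t ht => h t ht)
  exact congrFun this t

lemma eq_of_finite_compl {f g : ℂ → ℂ} (hf : Continuous f) (hg : Continuous g) (s : Finset ℂ)
    (h : ∀ t, t ∉ s → f t = g t) (t : ℂ) : f t = g t := by
  have := eq_zero_of_finite_compl (f := fun t => f t - g t) (by fun_prop) s.finite_toSet
    (fun t ht => sub_eq_zero.2 (h t (by simpa using ht))) t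
  exact sub_eq_zero.1 this

lemma continuous_Psi (B : ℂ) (A r : List ℂ) (α : List Bool) :
    Continuous fun t => Psi B (A ++ t :: r) α := by
  obtain ⟨p, -, h⟩ := Psi_polyDeg B A r α
  rw [funext h]
  exact p.continuous

lemma one_sub_om_ne : (1 - om : ℂ) ≠ 0 := sub_ne_zero.2 om_ne_one.symm

lemma om_sq_ne_one : om ^ 2 ≠ 1 := by
  intro h
  have := om_cube
  rw [pow_succ, h, one_mul] at this
  exact om_ne_one this

lemma Psi_pair_diag (B : ℂ) {A : List ℂ} {α : List Bool} (h : A.length = α.length) {z : ℂ}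
    (hz : z ≠ 0) (C : List ℂ) (s : Bool) (β : List Bool) :
    Psi B (A ++ z :: (om * z) :: C) (α ++ s :: s :: β) = 0 := by
  have := Psi_diag B h z (om * z) C s β
  rw [sub_self, zero_mul] at this
  refine (mul_eq_zero.1 this).resolve_left ?_
  rw [show z - om * (om * z) = (1 - om ^ 2) * z by ring]
  exact mul_ne_zero (sub_ne_zero.2 om_sq_ne_one.symm) hz

lemma Psi_pair_singlet (B : ℂ) {A : List ℂ} {α : List Bool} (h : A.length = α.length) {z : ℂ}
    (hz : z ≠ 0) (C : List ℂ) (β : List Bool) :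
    Psi B (A ++ z :: (om * z) :: C) (α ++ false :: true :: β) =
      -om * Psi B (A ++ z :: (om * z) :: C) (α ++ true :: false :: β) := by
  have := Psi_exch B h z (om * z) C β
  apply mul_left_cancel₀ (mul_ne_zero one_sub_om_ne hz)
  linear_combination this

lemma Psi_pair_move (B : ℂ) {A : List ℂ} {α : List Bool} (h : A.length = α.length) {z : ℂ}
    (hz : z ≠ 0) (w : ℂ) (C : List ℂ) (c : Bool) (β : List Bool) :
    Psi B (A ++ w :: z :: (om * z) :: C) (α ++ c :: true :: false :: β) =
      Psi B (A ++ z :: (om * z) :: w :: C) (α ++ true :: false :: c :: β) := by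
  have hc1 : Continuous fun w => Psi B (A ++ z :: (om * z) :: w :: C)
      (α ++ true :: false :: c :: β) := by
    have := continuous_Psi B (A ++ [z, om * z]) C (α ++ true :: false :: c :: β)
    simpa using this
  refine eq_of_finite_compl (continuous_Psi B A _ _) hc1 {z, om * z, om ^ 2 * z}
    (fun w hw => ?_) w
  simp only [Finset.mem_insert, Finset.mem_singleton, not_or] at hw
  obtain ⟨hw1, hw2, hw3⟩ := hw
  have hq := om_sq
  have hq3 := om_cube
  have hA1 : ∀ u : ℂ, ∀ c : Bool, (A ++ [u]).length = (α ++ [c]).length := by simp [h]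
  cases c with
  | false =>
    have e1 := Psi_exch B h w z (om * z :: C) (false :: β)
    have e2 := Psi_pair_diag B (hA1 w true) hz C false β
    have e3 := Psi_diag B (hA1 z true) w (om * z) C false β
    simp only [List.append_assoc, List.cons_append, List.nil_append] at e2 e3
    rw [e2] at e1
    apply mul_left_cancel₀ (mul_ne_zero (sub_ne_zero.2 hw1) (sub_ne_zero.2 hw3))
    generalize Psi B _ _ = x1 at *
    generalize Psi B _ _ = x2 at *
    generalize Psi B _ _ = x3 at *
    grind
  | true =>
    have e1 := Psi_diag B h w z (om * z :: C) true (false :: β)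
    have e2 := Psi_pair_diag B h hz (w :: C) true (false :: β)
    have e3 := Psi_exch B (hA1 z true) (om * z) w C β
    simp only [List.append_assoc, List.cons_append, List.nil_append] at e2 e3
    rw [e2] at e3
    apply mul_left_cancel₀ (sub_ne_zero.2 hw2)
    generalize Psi B _ _ = x1 at *
    generalize Psi B _ _ = x2 at *
    generalize Psi B _ _ = x3 at *
    grind

lemma Psi_pair_front (B : ℂ) {A : List ℂ} {α : List Bool} (h : A.length = α.length) {z : ℂ}
    (hz : z ≠ 0) (C : List ℂ) (β : List Bool) :
    Psi B (A ++ z :: (om * z) :: C) (α ++ true :: false :: β) =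
      Psi B (z :: (om * z) :: (A ++ C)) (true :: false :: (α ++ β)) := by
  induction A using List.reverseRecOn generalizing α C β with
  | nil =>
    obtain rfl : α = [] := by simpa using h.symm
    simp
  | append_singleton A w ih =>
    rcases List.eq_nil_or_concat α with rfl | ⟨α, c, rfl⟩
    · simp at h
    have hlen : A.length = α.length := by simpa using h
    have := Psi_pair_move B hlen hz w C c β
    simp only [List.append_assoc, List.cons_append, List.nil_append, List.concat_eq_append]
    rw [this, ih hlen]

/-- The factor attached to a spectral pair `z, q z`. -/
def pairW (z : ℂ) (L : List ℂ) : ℂ := (L.map fun r => (r - om ^ 2 * z) * (r * z - om)).prod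

/-- The proportionality factor in the reduction at `z, q z`. -/
def redQ (B z : ℂ) (γ : List Bool) (L : List ℂ) : ℂ :=
  (B - z) * (-om) ^ γ.count true * om ^ γ.count false *
    (if γ.count false = γ.count true then om * z else 1) * pairW z L

lemma pairW_append (z : ℂ) (L M : List ℂ) : pairW z (L ++ M) = pairW z L * pairW z M := by
  simp [pairW]

lemma pairW_cons (z a : ℂ) (M : List ℂ) :
    pairW z (a :: M) = (a - om ^ 2 * z) * (a * z - om) * pairW z M := by
  simp [pairW]

lemma redQ_swap (B z a b : ℂ) (l r : List Bool) (A C : List ℂ) :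
    redQ B z (l ++ false :: true :: r) (A ++ a :: b :: C) =
      redQ B z (l ++ true :: false :: r) (A ++ b :: a :: C) := by
  simp only [redQ, pairW_append, pairW_cons, List.count_append, List.count_cons]
  have h1 : ((false == true) = true) = False := by simp
  have h2 : ((true == false) = true) = False := by simp
  simp only [beq_self_eq_true, if_true, h1, h2, if_false, add_zero]
  ring

lemma redQ_swap_right (B z a b : ℂ) (γ : List Bool) (A C : List ℂ) :
    redQ B z γ (A ++ a :: b :: C) = redQ B z γ (A ++ b :: a :: C) := by
  simp only [redQ, pairW_append, pairW_cons]
  ring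

lemma gD_append_singleton (B z : ℂ) (D : List ℂ) :
    gD B om (D ++ [z]) = gD B om D * (B - z) * (-om) ^ D.length * pairW z D := by
  induction D with
  | nil => simp [gD, pairW]
  | cons a D ih =>
    simp only [List.cons_append, gD, ih, List.map_append, List.prod_append, pairW_cons,
      List.length_cons, List.map_cons, List.map_nil, List.prod_cons, List.prod_nil, mul_one]
    have : z - om * a = -om * (a - om ^ 2 * z) := by linear_combination -z * om_cube
    rw [this]
    ring

lemma gU_cons_pair (z : ℂ) (U : List ℂ) :
    gU om ((om * z) :: U) = om ^ U.length * pairW z U * gU om U := by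
  rw [gU]
  congr 1
  induction U with
  | nil => simp [pairW]
  | cons a U ih =>
    simp only [List.map_cons, List.prod_cons, ih, List.length_cons, pairW_cons]
    ring

lemma Psi_pair_base (B : ℂ) {z : ℂ} (hz : z ≠ 0) (D U : List ℂ) :
    Psi B (z :: (om * z) :: (D ++ U)) (true :: false ::
        (List.replicate D.length true ++ List.replicate U.length false)) =
      redQ B z (List.replicate D.length true ++ List.replicate U.length false) (D ++ U) *
      Psi B (D ++ U) (List.replicate D.length true ++ List.replicate U.length false) := by
  have hl : D.length = (List.replicate D.length true).length := by simp
  rw [← Psi_pair_front B hl hz]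
  have e1 := Psi_base B (D ++ [z]) ((om * z) :: U)
  simp only [List.append_assoc, List.cons_append, List.nil_append, List.length_append,
    List.length_cons, List.length_nil, zero_add, List.replicate_succ (n := U.length),
    List.replicate_add D.length 1, List.replicate_one] at e1
  rw [e1, Psi_base]
  simp only [base, List.length_append, List.length_cons, List.length_nil, gD_append_singleton,
    gU_cons_pair, redQ, List.count_append, List.count_replicate, pairW_append, List.prod_cons]
  simp only [zero_add, add_left_inj]
  split_ifs <;> simp_all <;> ring

lemma Psi_reduce_front (B : ℂ) {z : ℂ} (hz : z ≠ 0) (L : List ℂ) (γ : List Bool)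
    (h : L.length = γ.length) :
    Psi B (z :: (om * z) :: L) (true :: false :: γ) = redQ B z γ L * Psi B L γ := by
  generalize hk : inv γ = w
  induction w using Nat.strong_induction_on generalizing γ L with
  | _ w ih =>
    by_cases hex : ∃ p : List Bool × List Bool, γ = p.1 ++ false :: true :: p.2
    · obtain ⟨⟨l, r⟩, rfl⟩ := hex
      simp only at *
      obtain ⟨A, a, b, C, rfl, hA⟩ : ∃ A a b C, L = A ++ a :: b :: C ∧ A.length = l.length := by
        refine ⟨L.take l.length, L[l.length]'(by simp [h]), L[l.length + 1]'(by simp [h]),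
          L.drop (l.length + 2), ?_, by simp [h]⟩
        conv_lhs => rw [← List.take_append_drop l.length L]
        rw [List.drop_eq_getElem_cons (by simp [h]), List.drop_eq_getElem_cons (by simp [h])]
      have key : ∀ a b, a ≠ b → Psi B (z :: (om * z) :: (A ++ a :: b :: C))
          (true :: false :: (l ++ false :: true :: r)) =
          redQ B z (l ++ false :: true :: r) (A ++ a :: b :: C) *
          Psi B (A ++ a :: b :: C) (l ++ false :: true :: r) := by
        intro a b hab
        have hA' : (z :: om * z :: A).length = (true :: false :: l).length := by simp [hA]
        have e1 := Psi_exch B hA' a b C r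
        have e2 := Psi_exch B hA a b C r
        have hlen : ∀ x y : ℂ, (A ++ x :: y :: C).length = (l ++ true :: false :: r).length := by
          intro x y; simpa using h
        have i1 := ih _ (hk ▸ inv_swap l r) _ _ (hlen b a) rfl
        have i2 := ih _ (hk ▸ inv_swap l r) _ _ (hlen a b) rfl
        rw [redQ_swap_right] at i2
        rw [redQ_swap]
        simp only [List.cons_append] at e1
        rw [i1, i2] at e1
        apply mul_left_cancel₀ (sub_ne_zero.2 hab)
        linear_combination e1 - redQ B z (l ++ true :: false :: r) (A ++ b :: a :: C) * e2
      refine eq_of_finite_compl (f := fun a => Psi B (z :: (om * z) :: (A ++ a :: b :: C))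
          (true :: false :: (l ++ false :: true :: r)))
          (g := fun a => redQ B z (l ++ false :: true :: r) (A ++ a :: b :: C) *
            Psi B (A ++ a :: b :: C) (l ++ false :: true :: r)) ?_ ?_ {b} (fun a ha => ?_) a
      · exact continuous_Psi B (z :: om * z :: A) (b :: C) _
      · refine Continuous.mul ?_ (continuous_Psi B A (b :: C) _)
        simp only [redQ, pairW_append, pairW_cons]
        fun_prop
      · exact key a b (by simpa using ha)
    · have hg := eq_replicate_append hex
      generalize hn : γ.count true = n at hg
      generalize hm : γ.count false = m at hg
      clear hn hm
      subst hg
      obtain ⟨D, U, rfl, rfl, rfl⟩ : ∃ D U : List ℂ, L = D ++ U ∧ D.length = n ∧ U.length = m := by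
        refine ⟨L.take n, L.drop n, by simp, ?_, ?_⟩ <;> simp at h ⊢ <;> omega
      exact Psi_pair_base B hz D U

lemma Psi_reduce (B : ℂ) {A : List ℂ} {α : List Bool} (h : A.length = α.length) {z : ℂ}
    (hz : z ≠ 0) {C : List ℂ} {β : List Bool} (hlen : C.length = β.length) :
    Psi B (A ++ z :: (om * z) :: C) (α ++ true :: false :: β) =
      redQ B z (α ++ β) (A ++ C) * Psi B (A ++ C) (α ++ β) := by
  rw [Psi_pair_front B h hz, Psi_reduce_front B hz _ _ (by simp [h, hlen])]

/-- The contraction identity at `q z, z`. -/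
lemma Psi_contract (B : ℂ) {A : List ℂ} {α : List Bool} (h : A.length = α.length) {z : ℂ}
    (hz : z ≠ 0) (C : List ℂ) (β : List Bool) :
    Psi B (A ++ (om * z) :: z :: C) (α ++ true :: false :: β) -
      om * Psi B (A ++ (om * z) :: z :: C) (α ++ false :: true :: β) =
      -om * Psi B (A ++ z :: (om * z) :: C) (α ++ true :: false :: β) := by
  have e1 := Psi_exch' B h z (om * z) C β
  have e2 := Psi_exch B h z (om * z) C β
  have e3 := Psi_pair_singlet B h hz C β
  have hq := om_sq
  apply mul_left_cancel₀ (mul_ne_zero one_sub_om_ne hz)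
  generalize Psi B _ _ = x1 at *
  generalize Psi B _ _ = x2 at *
  generalize Psi B _ _ = x3 at *
  generalize Psi B _ _ = x4 at *
  grind

end QKZ

namespace QKZ
open MvPolynomial

lemma exists_split {L : List ℂ} {l r : List Bool} {x y : Bool}
    (h : L.length = (l ++ x :: y :: r).length) :
    ∃ A a b C, L = A ++ a :: b :: C ∧ A.length = l.length := by
  simp only [List.length_append, List.length_cons] at h
  refine ⟨L.take l.length, L[l.length]'(by omega), L[l.length + 1]'(by omega),
    L.drop (l.length + 2), ?_, by simp only [List.length_take]; omega⟩
  conv_lhs => rw [← List.take_append_drop l.length L]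
  rw [List.drop_eq_getElem_cons (by omega), List.drop_eq_getElem_cons (by omega)]

/-- A relation between two spectator prefixes and suffixes follows from its sorted instances. -/
lemma rel_of_sorted (B : ℂ) {P1 P2 S1 S2 : List ℂ} {p s : List Bool} (hp1 : P1.length = p.length)
    (hp2 : P2.length = p.length) (c1 c2 : ℂ) (n m : ℕ)
    (hb : ∀ D U : List ℂ, D.length = n → U.length = m →
      c1 * Psi B (P1 ++ (D ++ U ++ S1)) (p ++ (List.replicate n true ++ List.replicate m false ++ s))
      = c2 * Psi B (P2 ++ (D ++ U ++ S2))
        (p ++ (List.replicate n true ++ List.replicate m false ++ s)))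
    (L : List ℂ) (γ : List Bool) (hL : L.length = γ.length) (hn : γ.count true = n)
    (hm : γ.count false = m) :
    c1 * Psi B (P1 ++ (L ++ S1)) (p ++ (γ ++ s)) = c2 * Psi B (P2 ++ (L ++ S2)) (p ++ (γ ++ s)) := by
  generalize hk : inv γ = w
  induction w using Nat.strong_induction_on generalizing γ L with
  | _ w ih =>
    by_cases hex : ∃ p : List Bool × List Bool, γ = p.1 ++ false :: true :: p.2
    · obtain ⟨⟨l, r⟩, rfl⟩ := hex
      simp only at *
      obtain ⟨A, a, b, C, rfl, hA⟩ := exists_split hL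
      have hlen : ∀ x y : ℂ, (A ++ x :: y :: C).length = (l ++ true :: false :: r).length := by
        intro x y; simpa using hL
      have hn' : (l ++ true :: false :: r).count true = n := by rw [← hn]; simp
      have hm' : (l ++ true :: false :: r).count false = m := by rw [← hm]; simp
      have h1 : (P1 ++ A).length = (p ++ l).length := by simp [hp1, hA]
      have h2 : (P2 ++ A).length = (p ++ l).length := by simp [hp2, hA]
      have c1' := continuous_Psi B (P1 ++ A) (b :: C ++ S1) (p ++ (l ++ false :: true :: r ++ s))
      have c2' := continuous_Psi B (P2 ++ A) (b :: C ++ S2) (p ++ (l ++ false :: true :: r ++ s))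
      simp only [List.append_assoc, List.cons_append] at *
      refine eq_of_finite_compl (continuous_const.mul c1') (continuous_const.mul c2') {b}
        (fun a ha => ?_) a
      have hab : a ≠ b := by simpa using ha
      have e1 := Psi_exch B h1 a b (C ++ S1) (r ++ s)
      have e2 := Psi_exch B h2 a b (C ++ S2) (r ++ s)
      have i1 := ih _ (hk ▸ inv_swap l r) _ _ (hlen b a) hn' hm' rfl
      have i2 := ih _ (hk ▸ inv_swap l r) _ _ (hlen a b) hn' hm' rfl
      simp only [List.append_assoc, List.cons_append] at *
      apply mul_left_cancel₀ (sub_ne_zero.2 hab)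
      change _ * (c1 * _) = _ * (c2 * _)
      linear_combination c1 * e1 - c2 * e2 + (om * b - om ^ 2 * a) * i1 - (om - om ^ 2) * a * i2
    · have hg := eq_replicate_append hex
      rw [hn, hm] at hg
      subst hg
      obtain ⟨D, U, rfl, hD, hU⟩ : ∃ D U : List ℂ, L = D ++ U ∧ D.length = n ∧ U.length = m := by
        refine ⟨L.take n, L.drop n, by simp, ?_, ?_⟩ <;> simp at hL ⊢ <;> omega
      exact hb D U hD hU

/-- Exceptional values relative to a list. -/
def badSet (e : Finset ℂ) (l : List ℂ) : Finset ℂ :=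
  ({0, 1, om, om ^ 2, -1, -om, -om ^ 2} : Finset ℂ) ∪ e ∪
    l.toFinset.biUnion (fun s => {s, om * s, om ^ 2 * s, s⁻¹, om * s⁻¹, om ^ 2 * s⁻¹})

/-- Lists avoiding a finite set of exceptional relations. -/
def Good (e : Finset ℂ) : List ℂ → Prop
  | [] => True
  | a :: l => a ∉ badSet e l ∧ Good e l

/-- The pairwise relation underlying `Good`. -/
def Gen (a s : ℂ) : Prop :=
  a ≠ s ∧ a ≠ om * s ∧ a ≠ om ^ 2 * s ∧ a * s ≠ 1 ∧ a * s ≠ om ∧ a * s ≠ om ^ 2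

lemma Gen.symm {a s : ℂ} (h : Gen a s) : Gen s a := by
  obtain ⟨h1, h2, h3, h4, h5, h6⟩ := h
  have := om_cube
  refine ⟨h1.symm, fun h => h3 ?_, fun h => h2 ?_, ?_, ?_, ?_⟩
  · rw [h]; linear_combination -a * this
  · rw [h]; linear_combination -a * this
  all_goals rwa [mul_comm]

/-- Nonzero numbers whose square is not a cube root of unity. -/
def Unram (a : ℂ) : Prop := a ≠ 0 ∧ a * a ≠ 1 ∧ a * a ≠ om ∧ a * a ≠ om ^ 2

lemma Good.spec {e : Finset ℂ} {l : List ℂ} (h : Good e l) :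
    (∀ a ∈ l, Unram a ∧ a ∉ e) ∧ l.Pairwise Gen := by
  have hq := om_cube
  induction l with
  | nil => simp
  | cons a l ih =>
    obtain ⟨h1, h2⟩ := h
    obtain ⟨i1, i2⟩ := ih h2
    simp only [badSet, Finset.mem_union, Finset.mem_insert, Finset.mem_singleton, Finset.mem_biUnion,
      List.mem_toFinset, not_or, not_exists, not_and] at h1
    obtain ⟨⟨⟨ha0, ha1, ha2, ha3, ha4, ha5, ha6⟩, hae⟩, hal⟩ := h1
    have hsq : ∀ x c : ℂ, x * x = c * c → x = c ∨ x = -c := fun x c h =>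
      mul_self_eq_mul_self_iff.1 h
    have hu : Unram a := by
      refine ⟨ha0, fun h => ?_, fun h => ?_, fun h => ?_⟩
      · rcases hsq a 1 (by rw [h, one_mul]) with h | h
        exacts [ha1 h, ha4 h]
      · rcases hsq a (om ^ 2) (by rw [h]; linear_combination -om * hq) with h | h
        exacts [ha3 h, ha6 (by rw [h])]
      · rcases hsq a om (by rw [h]; ring) with h | h
        exacts [ha2 h, ha5 h]
    refine ⟨?_, List.pairwise_cons.2 ⟨fun s hs => ?_, i2⟩⟩
    · intro b hb
      rcases List.mem_cons.1 hb with rfl | hb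
      exacts [⟨hu, hae⟩, i1 b hb]
    · obtain ⟨k1, k2, k3, k4, k5, k6⟩ := hal s hs
      have hs0 := (i1 s hs).1.1
      refine ⟨k1, k2, k3, fun h => k4 ?_, fun h => k5 ?_, fun h => k6 ?_⟩
      · exact eq_inv_of_mul_eq_one_left h
      · rw [← div_eq_mul_inv, eq_div_iff hs0, h]
      · rw [← div_eq_mul_inv, eq_div_iff hs0, h]

lemma eq_zero_of_good (e : Finset ℂ) (F : List ℂ → ℂ) (hc : ∀ A r, Continuous fun t => F (A ++ t :: r))
    (k : ℕ) (h : ∀ l, Good e l → l.length = k → F l = 0) (l : List ℂ) (hl : l.length = k) :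
    F l = 0 := by
  have key : ∀ A l, Good e l → A.length + l.length = k → F (A ++ l) = 0 := by
    intro A
    induction A using List.reverseRecOn with
    | nil => intro l hg hl; exact h l hg (by simpa using hl)
    | append_singleton A a ih =>
      intro l hg hl
      rw [List.append_assoc, List.singleton_append]
      refine eq_zero_of_finite_compl (hc A l) (badSet e l).finite_toSet (fun t ht => ?_) a
      exact ih (t :: l) ⟨by simpa only [Finset.mem_coe] using ht, hg⟩ (by simp at hl ⊢; omega)
  simpa using key l [] trivial (by simpa using hl)

lemma Psi_perm (s : Bool) {L L' : List ℂ} (h : L.Perm L') (hg : L.Pairwise Gen) :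
    ∃ c, c ≠ 0 ∧ ∀ (B : ℂ) (A : List ℂ) (α : List Bool) (C : List ℂ) (β : List Bool),
      A.length = α.length → Psi B (A ++ (L ++ C)) (α ++ (List.replicate L.length s ++ β)) =
        c * Psi B (A ++ (L' ++ C)) (α ++ (List.replicate L.length s ++ β)) := by
  induction h with
  | nil => exact ⟨1, one_ne_zero, by simp⟩
  | @cons x l l' h ih =>
    obtain ⟨c, hc, hP⟩ := ih (List.pairwise_cons.1 hg).2
    refine ⟨c, hc, fun B A α C β hA => ?_⟩
    have := hP B (A ++ [x]) (α ++ [s]) C β (by simp [hA])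
    simpa [List.replicate_succ] using this
  | swap x y l =>
    have hxy := (List.pairwise_cons.1 hg).1 x (by simp)
    have h1 : y - om * x ≠ 0 := sub_ne_zero.2 hxy.2.1
    have h2 : x - om * y ≠ 0 := sub_ne_zero.2 hxy.symm.2.1
    refine ⟨(x - om * y) / (y - om * x), div_ne_zero h2 h1, fun B A α C β hA => ?_⟩
    have := Psi_diag B hA y x (l ++ C) s (List.replicate l.length s ++ β)
    simp only [List.cons_append, List.length_cons, List.replicate_succ]
    rw [div_mul_eq_mul_div, eq_div_iff h1, mul_comm, this]
  | trans h1 h2 ih1 ih2 =>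
    obtain ⟨c, hc, hP⟩ := ih1 hg
    obtain ⟨c', hc', hP'⟩ := ih2 (h1.pairwise hg (fun h => h.symm))
    refine ⟨c * c', mul_ne_zero hc hc', fun B A α C β hA => ?_⟩
    rw [hP B A α C β hA, h1.length_eq, hP' B A α C β hA, mul_assoc]

lemma pairW_inv (z w : ℂ) (hw : w ≠ 0) :
    w ^ 2 * ((w⁻¹ - om ^ 2 * z) * (w⁻¹ * z - om)) = (w - om ^ 2 * z) * (w * z - om) := by
  have hq := om_cube
  field_simp
  linear_combination (w ^ 2 * z - z) * hq

lemma prod_inv_D (w : ℂ) (hw : w ≠ 0) (D : List ℂ) :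
    w ^ (2 * D.length) * (D.map fun y => (y - om * w⁻¹) * (w⁻¹ * y - om)).prod =
      (D.map fun y => (y - om * w) * (w * y - om)).prod := by
  induction D with
  | nil => simp
  | cons a D ih =>
    simp only [List.map_cons, List.prod_cons, List.length_cons, ← ih, mul_add, pow_add]
    field_simp

/-- Reflection at the left end, down spin. -/
lemma Psi_refl_left_down (B : ℂ) (w : ℂ) (hw : w ≠ 0) (L : List ℂ) (γ : List Bool)
    (hL : L.length = γ.length) :
    (B - w) * w ^ (2 * γ.count true + 1) * Psi B (w⁻¹ :: L) (true :: γ) =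
      (B * w - 1) * Psi B (w :: L) (true :: γ) := by
  have := rel_of_sorted B (P1 := [w⁻¹]) (P2 := [w]) (S1 := []) (S2 := []) (p := [true]) (s := [])
    rfl rfl ((B - w) * w ^ (2 * γ.count true + 1)) (B * w - 1) (γ.count true) (γ.count false) ?_
    L γ hL rfl rfl
  · simpa using this
  · intro D U hD hU
    have e1 := Psi_base B (w⁻¹ :: D) U
    have e2 := Psi_base B (w :: D) U
    have e3 := prod_inv_D w hw D
    simp only [List.length_cons, List.replicate_succ, List.cons_append, hD, hU] at e1 e2 e3
    simp only [List.append_nil, List.cons_append, List.nil_append, e1, e2, base, List.length_cons,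
      gD, hD, hU, ← e3]
    have e4 : w ^ (2 * γ.count true + 1) * (B - w⁻¹) = w ^ (2 * γ.count true) * (B * w - 1) := by
      field_simp; ring
    split_ifs
    · linear_combination (B - w) * (D.map fun y => (y - om * w⁻¹) * (w⁻¹ * y - om)).prod *
        gD B om D * gU om U * U.prod * e4
    · linear_combination (B - w) * (D.map fun y => (y - om * w⁻¹) * (w⁻¹ * y - om)).prod *
        gD B om D * gU om U * e4
    · simp

lemma gU_append_singleton (z : ℂ) (U : List ℂ) :
    gU om (U ++ [z]) = gU om U * (U.map fun y => (z - om * y) * (y * z - om ^ 2)).prod := by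
  induction U with
  | nil => simp [gU]
  | cons a U ih =>
    simp only [List.cons_append, gU, ih, List.map_append, List.prod_append,
      List.map_cons, List.map_nil, List.prod_cons, List.prod_nil, mul_one]
    ring

lemma prod_inv_U (w : ℂ) (hw : w ≠ 0) (U : List ℂ) :
    w ^ (2 * U.length) * (U.map fun y => (w⁻¹ - om * y) * (y * w⁻¹ - om ^ 2)).prod =
      (U.map fun y => (w - om * y) * (y * w - om ^ 2)).prod := by
  have hq := om_cube
  induction U with
  | nil => simp
  | cons a D ih =>
    simp only [List.map_cons, List.prod_cons, List.length_cons, ← ih, mul_add, pow_add]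
    have : w ^ 2 * ((w⁻¹ - om * a) * (a * w⁻¹ - om ^ 2)) = (w - om * a) * (a * w - om ^ 2) := by
      field_simp
      grind
    rw [← this]
    ring

/-- Reflection at the right end, up spin. -/
lemma Psi_refl_right_up (B : ℂ) (w : ℂ) (hw : w ≠ 0) (L : List ℂ) (γ : List Bool)
    (hL : L.length = γ.length) :
    w ^ (2 * γ.count true) * Psi B (L ++ [w⁻¹]) (γ ++ [false]) =
      Psi B (L ++ [w]) (γ ++ [false]) := by
  have := rel_of_sorted B (P1 := []) (P2 := []) (S1 := [w⁻¹]) (S2 := [w]) (p := []) (s := [false])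
    rfl rfl (w ^ (2 * γ.count true)) 1 (γ.count true) (γ.count false) ?_ L γ hL rfl rfl
  · simpa using this
  · intro D U hD hU
    have e1 := Psi_base B D (U ++ [w⁻¹])
    have e2 := Psi_base B D (U ++ [w])
    have e3 := prod_inv_U w hw U
    simp only [List.length_append, List.length_cons, List.length_nil, zero_add,
      List.replicate_add, List.replicate_one, hD, hU] at e1 e2 e3
    simp only [List.nil_append, List.append_assoc, e1, e2, base, List.length_append,
      List.length_cons, List.length_nil, gU_append_singleton, List.prod_append, List.prod_cons,
      List.prod_nil, hD, hU, ← e3]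
    split_ifs with h1 h2
    · rw [← h1]
      field_simp
      ring
    · have h2 : γ.count false = γ.count true := by omega
      rw [h2]
      ring
    · simp

end QKZ

namespace QKZ
open MvPolynomial

lemma Gen.om_mul {a s : ℂ} (h : Gen a s) : Gen (om * a) s := by
  obtain ⟨h1, h2, h3, h4, h5, h6⟩ := h
  have hq := om_cube
  have key : ∀ {x y : ℂ}, om * x = om * y → x = y := fun h => mul_left_cancel₀ om_ne_zero h
  refine ⟨fun h => h3 (key ?_), fun h => h1 (key h), fun h => h2 (key ?_), fun h => h6 (key ?_),
    fun h => h4 (key ?_), fun h => h5 (key ?_)⟩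
  · linear_combination h - s * hq
  · linear_combination h
  · linear_combination h - hq
  · linear_combination h
  · linear_combination h

lemma Gen.om_sq_mul {a s : ℂ} (h : Gen a s) : Gen (om ^ 2 * a) s := by
  rw [pow_two, mul_assoc]
  exact h.om_mul.om_mul

/-- Candidate zeros attached to a list. -/
def rootSet (c : ℂ) (l : List ℂ) : Finset ℂ :=
  l.toFinset.image (fun s => c * s) ∪ l.toFinset.image (fun s => (c * s)⁻¹)

lemma mem_rootSet {c t : ℂ} {l : List ℂ} (h : t ∈ rootSet c l) :
    ∃ s ∈ l, t = c * s ∨ t = (c * s)⁻¹ := by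
  simp only [rootSet, Finset.mem_union, Finset.mem_image, List.mem_toFinset] at h
  rcases h with ⟨s, hs, rfl⟩ | ⟨s, hs, rfl⟩
  exacts [⟨s, hs, Or.inl rfl⟩, ⟨s, hs, Or.inr rfl⟩]

lemma gen_or_eq {e : Finset ℂ} {l : List ℂ} (hg : (∀ a ∈ l, Unram a ∧ a ∉ e) ∧ l.Pairwise Gen)
    {a b : ℂ} (ha : a ∈ l) (hb : b ∈ l) : a = b ∨ Gen a b := by
  by_cases hab : a = b
  · exact Or.inl hab
  · have : Std.Symm Gen := ⟨fun _ _ h => h.symm⟩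
    exact Or.inr (hg.2.forall ha hb hab)

lemma mul_ne_of_good {e : Finset ℂ} {l : List ℂ}
    (hg : (∀ a ∈ l, Unram a ∧ a ∉ e) ∧ l.Pairwise Gen)
    {a b : ℂ} (ha : a ∈ l) (hb : b ∈ l) : a * b ≠ 1 ∧ a * b ≠ om ∧ a * b ≠ om ^ 2 := by
  rcases gen_or_eq hg ha hb with rfl | h
  · exact (hg.1 a ha).1.2
  · exact h.2.2.2

lemma card_rootSet {e : Finset ℂ} {l : List ℂ}
    (hg : (∀ a ∈ l, Unram a ∧ a ∉ e) ∧ l.Pairwise Gen) {c : ℂ} (hc : c = om ∨ c = om ^ 2) :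
    (rootSet c l).card = 2 * l.length := by
  have hq := om_cube
  have hc0 : c ≠ 0 := by
    rcases hc with rfl | rfl
    exacts [om_ne_zero, pow_ne_zero _ om_ne_zero]
  have hnd : l.Nodup := hg.2.imp fun h => h.1
  have hcard := List.toFinset_card_of_nodup hnd
  rw [rootSet, Finset.card_union_of_disjoint, Finset.card_image_of_injOn,
    Finset.card_image_of_injOn, hcard, two_mul]
  · intro a _ b _ h
    exact mul_left_cancel₀ hc0 (inv_injective h)
  · intro a _ b _ h
    exact mul_left_cancel₀ hc0 h
  · rw [Finset.disjoint_left]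
    intro t h1 h2
    simp only [Finset.mem_image, List.mem_toFinset] at h1 h2
    obtain ⟨a, ha, rfl⟩ := h1
    obtain ⟨b, hb, h⟩ := h2
    have hb0 := (hg.1 b hb).1.1
    obtain ⟨k1, k2, k3⟩ := mul_ne_of_good hg ha hb
    have h' : c ^ 2 * (a * b) = 1 := by
      rw [inv_eq_iff_eq_inv, eq_comm] at h
      have := inv_eq_iff_eq_inv.1 h
      have h3 : (c * a) * (c * b) = 1 := by
        rw [this]; exact inv_mul_cancel₀ (mul_ne_zero hc0 hb0)
      linear_combination h3
    rcases hc with rfl | rfl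
    · exact k2 (by linear_combination om * h' - a * b * hq)
    · exact k3 (by linear_combination om ^ 2 * h' - a * b * (om ^ 3 + 1) * hq)

lemma perm_append_singleton {s : ℂ} {l : List ℂ} (h : s ∈ l) :
    ∃ l', l.Perm (l' ++ [s]) :=
  ⟨l.erase s, (List.perm_cons_erase h).trans (List.perm_append_singleton s _).symm⟩

lemma redQ_inv (B z w : ℂ) (hw : w ≠ 0) (γ : List Bool) (A C : List ℂ) :
    w ^ 2 * redQ B z γ (A ++ w⁻¹ :: C) = redQ B z γ (A ++ w :: C) := by
  simp only [redQ, pairW_append, pairW_cons, ← pairW_inv z w hw]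
  ring

lemma refl_left_up_sorted (B w : ℂ) (hw : w ≠ 0) (n : ℕ) : ∀ (k : ℕ) (D U : List ℂ),
    D.length = n → U.length = k →
    w ^ (2 * n) * Psi B (w⁻¹ :: (D ++ U))
      (false :: (List.replicate n true ++ List.replicate k false)) =
    Psi B (w :: (D ++ U)) (false :: (List.replicate n true ++ List.replicate k false)) := by
  have hq := om_sq
  have hq3 := om_cube
  induction n with
  | zero =>
    intro k D U hD hU
    obtain rfl : D = [] := List.eq_nil_of_length_eq_zero hD
    rcases Nat.eq_zero_or_pos k with rfl | hk
    · obtain rfl : U = [] := List.eq_nil_of_length_eq_zero hU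
      have e1 := Psi_base B [] [w⁻¹]
      have e2 := Psi_base B [] [w]
      simp [base, gU, gD] at e1 e2
      simp [e1, e2]
    · rw [Psi_eq_zero, Psi_eq_zero, mul_zero] <;> simp [List.count_replicate] <;> omega
  | succ n ih =>
    intro k D U hD hU
    by_cases hadm : k = n ∨ k = n + 1
    swap
    · rw [Psi_eq_zero, Psi_eq_zero, mul_zero] <;> simp [List.count_replicate] <;> omega
    rcases Nat.eq_zero_or_pos n with rfl | hn
    · obtain ⟨d, rfl⟩ := List.length_eq_one_iff.1 hD
      rcases hadm with rfl | rfl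
      · obtain rfl : U = [] := List.eq_nil_of_length_eq_zero hU
        refine eq_of_finite_compl (f := fun d => w ^ 2 * Psi B [w⁻¹, d] [false, true])
          (g := fun d => Psi B [w, d] [false, true])
          (continuous_const.mul (continuous_Psi B [w⁻¹] [] _)) (continuous_Psi B [w] [] _)
          {w, w⁻¹} (fun d hd => ?_) d
        simp only [Finset.mem_insert, Finset.mem_singleton, not_or] at hd
        have b1 : ∀ a b, Psi B [a, b] [true, false] = (B - a) * b := by
          intro a b
          have := Psi_base B [a] [b]
          simpa [base, gU, gD] using this
        have e1 := Psi_exch B (A := []) (α := []) rfl w d [] []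
        have e2 := Psi_exch B (A := []) (α := []) rfl w⁻¹ d [] []
        simp only [List.nil_append, b1] at e1 e2
        have n1 : w - d ≠ 0 := sub_ne_zero.2 (Ne.symm hd.1)
        have n2 : w⁻¹ - d ≠ 0 := sub_ne_zero.2 (Ne.symm hd.2)
        apply mul_left_cancel₀ (mul_ne_zero n1 n2)
        calc _ = (w - d) * w ^ 2 * ((w⁻¹ - d) * Psi B [w⁻¹, d] [false, true]) := by ring
          _ = (w⁻¹ - d) * ((w - d) * Psi B [w, d] [false, true]) := by
            rw [e1, e2]
            field_simp
            grind
          _ = _ := by ring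
      · obtain ⟨u, rfl⟩ := List.length_eq_one_iff.1 hU
        refine eq_of_finite_compl (f := fun d => w ^ 2 * Psi B [w⁻¹, d, u] [false, true, false])
          (g := fun d => Psi B [w, d, u] [false, true, false])
          (continuous_const.mul (continuous_Psi B [w⁻¹] [u] _)) (continuous_Psi B [w] [u] _)
          {w, w⁻¹} (fun d hd => ?_) d
        simp only [Finset.mem_insert, Finset.mem_singleton, not_or] at hd
        have b1 : ∀ a b c, Psi B [a, b, c] [true, false, false] =
            (B - a) * ((c - om * b) * (b * c - om ^ 2)) := by
          intro a b c
          have := Psi_base B [a] [b, c]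
          simpa [base, gU, gD] using this
        have e1 := Psi_exch B (A := []) (α := []) rfl w d [u] [false]
        have e2 := Psi_exch B (A := []) (α := []) rfl w⁻¹ d [u] [false]
        simp only [List.nil_append, b1] at e1 e2
        have n1 : w - d ≠ 0 := sub_ne_zero.2 (Ne.symm hd.1)
        have n2 : w⁻¹ - d ≠ 0 := sub_ne_zero.2 (Ne.symm hd.2)
        apply mul_left_cancel₀ (mul_ne_zero n1 n2)
        calc _ = (w - d) * w ^ 2 * ((w⁻¹ - d) * Psi B [w⁻¹, d, u] [false, true, false]) := by ring
          _ = (w⁻¹ - d) * ((w - d) * Psi B [w, d, u] [false, true, false]) := by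
            rw [e1, e2]
            field_simp
            grind
          _ = _ := by ring
    · obtain ⟨k, rfl⟩ : ∃ j, k = j + 1 := ⟨k - 1, by omega⟩
      set γ := List.replicate (n + 1) true ++ List.replicate (k + 1) false with hγ
      have hcont : ∀ A r, Continuous fun t => w ^ (2 * (n + 1)) *
          Psi B (w⁻¹ :: (A ++ t :: r)) (false :: γ) - Psi B (w :: (A ++ t :: r)) (false :: γ) :=
        fun A r => (continuous_const.mul (continuous_Psi B (w⁻¹ :: A) r _)).sub
          (continuous_Psi B (w :: A) r _)
      refine sub_eq_zero.1 (eq_zero_of_good ∅ (fun l => w ^ (2 * (n + 1)) *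
        Psi B (w⁻¹ :: l) (false :: γ) - Psi B (w :: l) (false :: γ)) hcont (n + 1 + (k + 1)) ?_
        (D ++ U) (by simp [hD, hU]))
      clear hD hU D U
      intro l hl hlen
      obtain ⟨D, U, u, rfl, hD, hU⟩ : ∃ D U : List ℂ, ∃ u, l = D ++ (U ++ [u]) ∧
          D.length = n + 1 ∧ U.length = k := by
        have h1 : (l.drop (n + 1)).length = k + 1 := by simp [hlen]
        rcases List.eq_nil_or_concat (l.drop (n + 1)) with h | ⟨U, u, h⟩
        · rw [h] at h1; simp at h1
        · refine ⟨l.take (n + 1), U, u, ?_, by simp [hlen], ?_⟩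
          · conv_lhs => rw [← List.take_append_drop (n + 1) l, h, List.concat_eq_append]
          · rw [h] at h1; simpa using h1
      have hg := hl.spec
      rw [← List.append_assoc] at hg
      have hg' : (∀ a ∈ D ++ U, Unram a ∧ a ∉ (∅ : Finset ℂ)) ∧ (D ++ U).Pairwise Gen :=
        ⟨fun a ha => hg.1 a (List.mem_append_left _ ha), (List.pairwise_append.1 hg.2).1⟩
      have hgD := (List.pairwise_append.1 hg'.2).1
      have hgU := (List.pairwise_append.1 hg'.2).2.1
      have hgDU := (List.pairwise_append.1 hg'.2).2.2
      set f : ℂ → ℂ := fun t => w ^ (2 * (n + 1)) *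
        Psi B (w⁻¹ :: (D ++ (U ++ [t]))) (false :: γ) - Psi B (w :: (D ++ (U ++ [t]))) (false :: γ)
        with hf
      have hdeg : PolyDeg (n + 1 + (k + 1)) f := by
        have h1 := Psi_polyDeg B (w⁻¹ :: (D ++ U)) [] (false :: γ)
        have h2 := Psi_polyDeg B (w :: (D ++ U)) [] (false :: γ)
        have h3 := ((PolyDeg.const (w ^ (2 * (n + 1)))).mul h1).sub (h2.mono (Nat.le_add_left _ 0))
        have h4 : 0 + ((false :: γ).length - 1) = n + 1 + (k + 1) := by simp [hγ]
        rw [h4] at h3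
        simpa [hf] using h3
      have hinv : ∀ t, t ≠ 0 → f t = 0 → f t⁻¹ = 0 := by
        intro t ht h
        have h0 : γ = List.replicate (n + 1) true ++ List.replicate k false ++ [false] := by
          rw [hγ, List.replicate_succ' (n := k), List.append_assoc]
        have hcnt : List.count true (false :: (List.replicate (n + 1) true ++
            List.replicate k false)) = n + 1 := by simp [List.count_replicate]
        have e1 := Psi_refl_right_up B t ht (w⁻¹ :: (D ++ U))
          (false :: (List.replicate (n + 1) true ++ List.replicate k false)) (by simp [hD, hU])
        have e2 := Psi_refl_right_up B t ht (w :: (D ++ U))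
          (false :: (List.replicate (n + 1) true ++ List.replicate k false)) (by simp [hD, hU])
        rw [hcnt] at e1 e2
        simp only [hf, h0, List.append_assoc, List.cons_append] at h e1 e2 ⊢
        apply (mul_eq_zero.1 _).resolve_left (pow_ne_zero (2 * (n + 1)) ht)
        rw [← h, ← e1, ← e2]
        ring
      have hroot : ∀ s ∈ D ++ U, f (om * s) = 0 := by
        intro s hs
        have hs0 : s ≠ 0 := (hg'.1 s hs).1.1
        rcases List.mem_append.1 hs with hs | hs
        · obtain ⟨D', hD'⟩ := perm_append_singleton hs
          have hU' : (U ++ [om * s]).Perm (om * s :: U) := List.perm_append_singleton _ _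
          have hgU' : (U ++ [om * s]).Pairwise Gen := by
            rw [List.pairwise_append]
            refine ⟨hgU, by simp, fun a ha b hb => ?_⟩
            obtain rfl := List.mem_singleton.1 hb
            exact (hgDU s hs a ha).om_mul.symm
          obtain ⟨c1, -, h1⟩ := Psi_perm true hD' hgD
          obtain ⟨c2, -, h2⟩ := Psi_perm false hU' hgU'
          have hlD' : D'.length = n := by
            have := hD'.length_eq; simp [hD] at this; omega
          have key : ∀ v, Psi B (v :: (D ++ (U ++ [om * s]))) (false :: γ) = c1 * c2 *
              (redQ B s (false :: (List.replicate n true ++ List.replicate k false))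
                (v :: (D' ++ U)) * Psi B (v :: (D' ++ U))
                (false :: (List.replicate n true ++ List.replicate k false))) := by
            intro v
            have e1 := h1 B [v] [false] (U ++ [om * s]) (List.replicate (k + 1) false) rfl
            have e2 := h2 B (v :: (D' ++ [s])) (false :: List.replicate (n + 1) true) [] []
              (by simp [hlD'])
            have e3 := Psi_reduce B (A := v :: D') (α := false :: List.replicate n true)
              (C := U) (β := List.replicate k false) (by simp [hlD']) hs0 (by simp [hU])
            simp only [List.length_append, List.length_cons, List.length_nil, hU, hD, zero_add,
              List.append_nil, List.append_assoc, List.cons_append, List.nil_append,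
              List.replicate_succ' (n := n)] at e1 e2 e3
            simp only [hγ, List.replicate_succ' (n := n), List.append_assoc, List.cons_append,
              List.nil_append]
            rw [e1, e2, List.replicate_succ (n := k), e3]
            ring
          simp only [hf]
          have hr := redQ_inv B s w hw (false :: (List.replicate n true ++
            List.replicate k false)) [] (D' ++ U)
          simp only [List.nil_append] at hr
          rw [key, key, ← hr]
          have := ih k D' U hlD' hU
          linear_combination c1 * c2 * w ^ 2 * redQ B s (false :: (List.replicate n true ++
            List.replicate k false)) (w⁻¹ :: (D' ++ U)) * this
        · obtain ⟨U', hU'⟩ := perm_append_singleton hs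
          obtain ⟨c, -, h1⟩ := Psi_perm false hU' hgU
          have hlU' : U'.length + 1 = k := by
            have := hU'.length_eq; simp [hU] at this; omega
          have key : ∀ v, Psi B (v :: (D ++ (U ++ [om * s]))) (false :: γ) = 0 := by
            intro v
            have e1 := h1 B (v :: D) (false :: List.replicate (n + 1) true) [om * s] [false]
              (by simp [hD])
            have e2 := Psi_pair_diag B (A := v :: (D ++ U')) (α := false ::
              (List.replicate (n + 1) true ++ List.replicate U'.length false))
              (by simp [hD]) hs0 [] false []
            simp only [hU, List.append_assoc, List.cons_append, List.nil_append,
              ← List.replicate_succ'] at e1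
            have h5 : List.replicate (k + 1) false =
                List.replicate U'.length false ++ [false, false] := by
              rw [← hlU']; simp [List.replicate_add]
            simp only [List.append_assoc, List.cons_append, ← h5] at e2
            rw [hγ, e1, e2, mul_zero]
          simp only [hf]
          rw [key, key, mul_zero, sub_zero]
      refine hdeg.eq_zero (rootSet om (D ++ U)) ?_ ?_ u
      · rw [card_rootSet hg' (Or.inl rfl)]
        simp only [List.length_append, hD, hU]
        omega
      · intro t ht
        obtain ⟨s, hs, rfl | rfl⟩ := mem_rootSet ht
        · exact hroot s hs
        · exact hinv _ (mul_ne_zero om_ne_zero (hg'.1 s hs).1.1) (hroot s hs)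

/-- Reflection at the left end, up spin. -/
lemma Psi_refl_left_up (B : ℂ) (w : ℂ) (hw : w ≠ 0) (L : List ℂ) (γ : List Bool)
    (hL : L.length = γ.length) :
    w ^ (2 * γ.count true) * Psi B (w⁻¹ :: L) (false :: γ) = Psi B (w :: L) (false :: γ) := by
  have := rel_of_sorted B (P1 := [w⁻¹]) (P2 := [w]) (S1 := []) (S2 := []) (p := [false]) (s := [])
    rfl rfl (w ^ (2 * γ.count true)) 1 (γ.count true) (γ.count false) ?_ L γ hL rfl rfl
  · simpa using this
  · intro D U hD hU
    simpa using refl_left_up_sorted B w hw _ _ D U hD hU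

end QKZ

namespace QKZ
open MvPolynomial

lemma Psi_ud (B u v : ℂ) : Psi B [u, v] [false, true] = om * u * (v - om * B) := by
  have hq := om_sq
  refine eq_of_finite_compl (f := fun u => Psi B [u, v] [false, true])
    (g := fun u => om * u * (v - om * B)) (continuous_Psi B [] [v] _) (by fun_prop) {v}
    (fun u hu => ?_) u
  have huv : u ≠ v := by simpa using hu
  have b1 : ∀ a b, Psi B [a, b] [true, false] = (B - a) * b := by
    intro a b
    have := Psi_base B [a] [b]
    simpa [base, gU, gD] using this
  have e1 := Psi_exch B (A := []) (α := []) rfl u v [] []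
  simp only [List.nil_append, b1] at e1
  apply mul_left_cancel₀ (sub_ne_zero.2 huv)
  simp only [e1]
  ring

lemma Psi_uud (B a b v : ℂ) : Psi B [a, b, v] [false, false, true] =
    (om * B - v) * ((b - om * a) * (a * b - om)) := by
  have hq := om_sq
  have h0 : ∀ A r, Continuous fun t => (fun l => Psi B (l ++ [v]) [false, false, true] -
      (om * B - v) * ((l.getD 1 0 - om * l.getD 0 0) *
        (l.getD 0 0 * l.getD 1 0 - om))) (A ++ t :: r) := by
    intro A r
    have h1 := continuous_Psi B A (r ++ [v]) [false, false, true]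
    have h2 : ∀ j, Continuous fun t => (A ++ t :: r).getD j 0 := by
      intro j
      rcases lt_trichotomy j A.length with h | h | h
      · simp [List.getD, List.getElem?_append_left h, continuous_const]
      · subst h; simpa [List.getD] using continuous_id'
      · obtain ⟨i, rfl⟩ := Nat.exists_eq_add_of_lt h
        have : ∀ t, (A ++ t :: r).getD (A.length + i + 1) 0 = r.getD i 0 := by
          intro t
          simp [List.getD, List.getElem?_append_right, add_assoc]
        simp only [this, continuous_const]
    simp only [List.append_assoc, List.cons_append]
    exact h1.sub (continuous_const.mul (((h2 1).sub (continuous_const.mul (h2 0))).mul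
      (((h2 0).mul (h2 1)).sub continuous_const)))
  have := eq_zero_of_good {v} (fun l => Psi B (l ++ [v]) [false, false, true] -
      (om * B - v) * ((l.getD 1 0 - om * l.getD 0 0) *
        (l.getD 0 0 * l.getD 1 0 - om))) h0 2 ?_ [a, b] rfl
  · simpa [sub_eq_zero] using this
  intro l hl hlen
  obtain ⟨a, b, rfl⟩ := List.length_eq_two.1 hlen
  have hg := hl.spec
  have hav : a ≠ v := by simpa using (hg.1 a (by simp)).2
  have hbv : b ≠ v := by simpa using (hg.1 b (by simp)).2
  have hab : a ≠ b := ((List.pairwise_cons.1 hg.2).1 b (by simp)).1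
  have b1 : ∀ a b c, Psi B [a, b, c] [true, false, false] =
      (B - a) * ((c - om * b) * (b * c - om ^ 2)) := by
    intro a b c
    have := Psi_base B [a] [b, c]
    simpa [base, gU, gD] using this
  have e1 := Psi_exch B (A := [a]) (α := [false]) rfl b v [] []
  have e2 := Psi_exch B (A := []) (α := []) rfl a v [b] [false]
  have e3 := Psi_exch B (A := []) (α := []) rfl a b [v] [false]
  simp only [List.nil_append, List.cons_append, b1] at e1 e2 e3
  apply mul_left_cancel₀ (mul_ne_zero (mul_ne_zero (sub_ne_zero.2 hab) (sub_ne_zero.2 hav))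
    (sub_ne_zero.2 hbv))
  simp only [List.cons_append, List.nil_append, List.getD_cons_zero, List.getD_cons_succ, mul_zero]
  have key : (a - b) * (a - v) * (b - v) * Psi B [a, b, v] [false, false, true] =
      (om * v - om ^ 2 * b) * (a - b) * ((om * v - om ^ 2 * a) *
        ((B - v) * ((b - om * a) * (a * b - om ^ 2))) - (om - om ^ 2) * a *
        ((B - a) * ((b - om * v) * (v * b - om ^ 2)))) - (om - om ^ 2) * b * (a - v) *
      ((om * b - om ^ 2 * a) * ((B - b) * ((v - om * a) * (a * v - om ^ 2))) - (om - om ^ 2) * a *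
        ((B - a) * ((v - om * b) * (b * v - om ^ 2)))) := by
    linear_combination (a - b) * (a - v) * e1 + (om * v - om ^ 2 * b) * (a - b) * e2 -
      (om - om ^ 2) * b * (a - v) * e3
  rw [mul_sub, key]
  clear key e1 e2 e3 b1 h0 hg hl hlen
  generalize om = q at *
  grind

lemma refl_right_down_sorted (B w : ℂ) (hw : w ≠ 0) (n : ℕ) : ∀ (k : ℕ) (D U : List ℂ),
    D.length = n → U.length = k →
    (w - om * B) * w ^ (2 * n + 1) * Psi B (D ++ (U ++ [w⁻¹]))
      (List.replicate n true ++ (List.replicate k false ++ [true])) =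
    (1 - om * B * w) * Psi B (D ++ (U ++ [w]))
      (List.replicate n true ++ (List.replicate k false ++ [true])) := by
  have hq3 := om_cube
  induction n with
  | zero =>
    intro k D U hD hU
    obtain rfl : D = [] := List.eq_nil_of_length_eq_zero hD
    by_cases hadm : k = 1 ∨ k = 2
    swap
    · rw [Psi_eq_zero, Psi_eq_zero, mul_zero, mul_zero] <;> simp [List.count_replicate] <;> omega
    rcases hadm with rfl | rfl
    · obtain ⟨u, rfl⟩ := List.length_eq_one_iff.1 hU
      have e : ∀ v, Psi B ([] ++ ([u] ++ [v])) (List.replicate 0 true ++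
          (List.replicate 1 false ++ [true])) = om * u * (v - om * B) := Psi_ud B u
      rw [e, e]
      field_simp
      ring
    · obtain ⟨a, b, rfl⟩ := List.length_eq_two.1 hU
      have e : ∀ v, Psi B ([] ++ ([a, b] ++ [v])) (List.replicate 0 true ++
          (List.replicate 2 false ++ [true])) = _ := Psi_uud B a b
      rw [e, e]
      field_simp
      ring
  | succ n ih =>
    intro k D U hD hU
    by_cases hadm : k = n + 2 ∨ k = n + 3
    swap
    · rw [Psi_eq_zero, Psi_eq_zero, mul_zero, mul_zero] <;> simp [List.count_replicate] <;> omega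
    obtain ⟨k, rfl⟩ : ∃ j, k = j + 1 := ⟨k - 1, by omega⟩
    set γ := List.replicate (n + 1) true ++ (List.replicate (k + 1) false ++ [true]) with hγ
    have hcont : ∀ A r, Continuous fun t => (w - om * B) * w ^ (2 * (n + 1) + 1) *
        Psi B (A ++ t :: r ++ [w⁻¹]) γ - (1 - om * B * w) * Psi B (A ++ t :: r ++ [w]) γ := by
      intro A r
      have h1 := continuous_Psi B A (r ++ [w⁻¹]) γ
      have h2 := continuous_Psi B A (r ++ [w]) γ
      simp only [List.append_assoc, List.cons_append]
      exact (continuous_const.mul h1).sub (continuous_const.mul h2)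
    have main := eq_zero_of_good {B * om} (fun l => (w - om * B) * w ^ (2 * (n + 1) + 1) *
        Psi B (l ++ [w⁻¹]) γ - (1 - om * B * w) * Psi B (l ++ [w]) γ) hcont (n + 1 + (k + 1)) ?_
        (D ++ U) (by simp [hD, hU])
    · simpa only [sub_eq_zero, List.append_assoc] using main
    clear hD hU D U
    intro l hl hlen
    obtain ⟨d, D, U, rfl, hD, hU⟩ : ∃ d, ∃ D U : List ℂ, l = d :: (D ++ U) ∧
        D.length = n ∧ U.length = k + 1 := by
      rcases l with _ | ⟨d, l⟩
      · simp at hlen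
      · refine ⟨d, l.take n, l.drop n, by simp, ?_, ?_⟩ <;> simp at hlen ⊢ <;> omega
    have hg := hl.spec
    have hg' : (∀ a ∈ D ++ U, Unram a ∧ a ∉ ({B * om} : Finset ℂ)) ∧ (D ++ U).Pairwise Gen :=
      ⟨fun a ha => hg.1 a (List.mem_cons_of_mem _ ha), (List.pairwise_cons.1 hg.2).2⟩
    have hgD := (List.pairwise_append.1 hg'.2).1
    have hgU := (List.pairwise_append.1 hg'.2).2.1
    have hgDU := (List.pairwise_append.1 hg'.2).2.2
    set f : ℂ → ℂ := fun t => (w - om * B) * w ^ (2 * (n + 1) + 1) *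
      Psi B (t :: (D ++ (U ++ [w⁻¹]))) γ - (1 - om * B * w) * Psi B (t :: (D ++ (U ++ [w]))) γ
      with hf
    have hdeg : PolyDeg (n + 1 + (k + 1)) f := by
      have h1 := Psi_polyDeg B [] (D ++ (U ++ [w⁻¹])) γ
      have h2 := Psi_polyDeg B [] (D ++ (U ++ [w])) γ
      have h3 := ((PolyDeg.const ((w - om * B) * w ^ (2 * (n + 1) + 1))).mul h1).sub
        ((PolyDeg.const (1 - om * B * w)).mul h2)
      have h4 : 0 + (γ.length - 1) = n + 1 + (k + 1) := by
        simp only [hγ, List.length_append, List.length_replicate, List.length_singleton]; omega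
      rw [h4] at h3
      simpa [hf] using h3
    have hinv : ∀ t, t ≠ 0 → t ≠ B → f t = 0 → f t⁻¹ = 0 := by
      intro t ht htB h
      have h0 : γ = true :: (List.replicate n true ++ (List.replicate (k + 1) false ++ [true])) := by
        rw [hγ, List.replicate_succ, List.cons_append]
      have hcnt : List.count true (List.replicate n true ++ (List.replicate (k + 1) false ++ [true]))
          = n + 1 := by simp [List.count_replicate]
      have e1 := Psi_refl_left_down B t ht (D ++ (U ++ [w⁻¹]))
        (List.replicate n true ++ (List.replicate (k + 1) false ++ [true])) (by simp [hD, hU])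
      have e2 := Psi_refl_left_down B t ht (D ++ (U ++ [w]))
        (List.replicate n true ++ (List.replicate (k + 1) false ++ [true])) (by simp [hD, hU])
      rw [hcnt, ← h0] at e1 e2
      simp only [hf] at h ⊢
      apply (mul_eq_zero.1 _).resolve_left (mul_ne_zero (sub_ne_zero.2 htB.symm)
        (pow_ne_zero (2 * (n + 1) + 1) ht))
      linear_combination (w - om * B) * w ^ (2 * (n + 1) + 1) * e1 - (1 - om * B * w) * e2 +
        (B * t - 1) * h
    have hroot : ∀ s ∈ D ++ U, f (om ^ 2 * s) = 0 := by
      intro s hs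
      have hs0 : s ≠ 0 := (hg'.1 s hs).1.1
      have ht0 : om ^ 2 * s ≠ 0 := mul_ne_zero (pow_ne_zero 2 om_ne_zero) hs0
      have hts : om * (om ^ 2 * s) = s := by linear_combination s * hq3
      rcases List.mem_append.1 hs with hs | hs
      · obtain ⟨c, -, h1⟩ := Psi_perm true (List.perm_cons_erase hs) hgD
        have hlD' : (D.erase s).length + 1 = n := by
          have := (List.perm_cons_erase hs).length_eq; simp [hD] at this; omega
        have key : ∀ v, Psi B ((om ^ 2 * s) :: (D ++ (U ++ [v]))) γ = 0 := by
          intro v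
          have e1 := h1 B [om ^ 2 * s] [true] (U ++ [v]) (List.replicate (k + 1) false ++ [true]) rfl
          have e2 := Psi_pair_diag B (A := []) (α := []) rfl ht0 (D.erase s ++ (U ++ [v]))
            true (List.replicate (D.erase s).length true ++ (List.replicate (k + 1) false ++ [true]))
          rw [hts] at e2
          simp only [List.nil_append] at e2
          have h5 : γ = true :: true :: (List.replicate (D.erase s).length true ++
              (List.replicate (k + 1) false ++ [true])) := by
            rw [hγ, ← hlD', List.replicate_succ, List.replicate_succ]; rfl
          have h6 : [true] ++ (List.replicate n true ++ (List.replicate (k + 1) false ++ [true]))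
            = γ := by rw [hγ, List.replicate_succ]; rfl
          rw [hD, h6] at e1
          simp only [List.cons_append, List.nil_append] at e1
          rw [e1, h5, e2, mul_zero]
        simp only [hf]
        rw [key, key, mul_zero, mul_zero, sub_zero]
      · have hD' : ((om ^ 2 * s) :: D).Perm (D ++ [om ^ 2 * s]) :=
          (List.perm_append_singleton _ _).symm
        have hgD' : ((om ^ 2 * s) :: D).Pairwise Gen :=
          List.pairwise_cons.2 ⟨fun a ha => (hgDU a ha s hs).symm.om_sq_mul, hgD⟩
        have hU' := List.perm_cons_erase hs
        obtain ⟨c1, -, h1⟩ := Psi_perm true hD' hgD'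
        obtain ⟨c2, -, h2⟩ := Psi_perm false hU' hgU
        have hlU' : (U.erase s).length = k := by
          have := hU'.length_eq; simp [hU] at this; omega
        have key : ∀ v, Psi B ((om ^ 2 * s) :: (D ++ (U ++ [v]))) γ = c1 * c2 *
            (redQ B (om ^ 2 * s) (List.replicate n true ++ (List.replicate k false ++ [true]))
              ((D ++ U.erase s) ++ [v]) * Psi B (D ++ (U.erase s ++ [v]))
              (List.replicate n true ++ (List.replicate k false ++ [true]))) := by
          intro v
          have e1 := h1 B [] [] (U ++ [v]) (List.replicate (k + 1) false ++ [true]) rfl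
          have e2 := h2 B (D ++ [om ^ 2 * s]) (List.replicate (n + 1) true) [v] [true] (by simp [hD])
          have e3 := Psi_reduce B (A := D) (α := List.replicate n true) (C := U.erase s ++ [v])
            (β := List.replicate k false ++ [true]) (by simp [hD]) ht0 (by simp [hlU'])
          rw [hts] at e3
          simp only [List.length_cons, hU, hD, List.append_assoc, List.cons_append,
            List.nil_append] at e1 e2 e3 ⊢
          rw [hγ, e1, e2, mul_assoc c1 c2, ← e3]
          congr 3
          rw [List.replicate_succ' (n := n), List.replicate_succ (n := k)]
          simp
        simp only [hf]
        have hr := redQ_inv B (om ^ 2 * s) w hw (List.replicate n true ++ (List.replicate k false ++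
          [true])) (D ++ U.erase s) []
        rw [key, key, ← hr]
        have := ih k D (U.erase s) hD hlU'
        linear_combination c1 * c2 * w ^ 2 * redQ B (om ^ 2 * s) (List.replicate n true ++
          (List.replicate k false ++ [true])) ((D ++ U.erase s) ++ [w⁻¹]) * this
    have hfd : f d = 0 := hdeg.eq_zero (rootSet (om ^ 2) (D ++ U)) ?_ ?_ d
    · simpa only [hf, List.cons_append, List.append_assoc] using hfd
    · rw [card_rootSet hg' (Or.inr rfl)]
      simp only [List.length_append, hD, hU]
      omega
    · intro t ht
      obtain ⟨s, hs, rfl | rfl⟩ := mem_rootSet ht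
      · exact hroot s hs
      · refine hinv _ (mul_ne_zero (pow_ne_zero 2 om_ne_zero) (hg'.1 s hs).1.1) (fun h => ?_)
          (hroot s hs)
        apply (hg'.1 s hs).2
        rw [Finset.mem_singleton, ← h]
        linear_combination -s * hq3

/-- Reflection at the right end, down spin. -/
lemma Psi_refl_right_down (B : ℂ) (w : ℂ) (hw : w ≠ 0) (L : List ℂ) (γ : List Bool)
    (hL : L.length = γ.length) :
    (w - om * B) * w ^ (2 * γ.count true + 1) * Psi B (L ++ [w⁻¹]) (γ ++ [true]) =
      (1 - om * B * w) * Psi B (L ++ [w]) (γ ++ [true]) := by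
  have := rel_of_sorted B (P1 := []) (P2 := []) (S1 := [w⁻¹]) (S2 := [w]) (p := []) (s := [true])
    rfl rfl ((w - om * B) * w ^ (2 * γ.count true + 1)) (1 - om * B * w) (γ.count true)
    (γ.count false) ?_ L γ hL rfl rfl
  · simpa using this
  · intro D U hD hU
    simpa using refl_right_down_sorted B w hw _ _ D U hD hU

end QKZ

namespace QKZ
open MvPolynomial

lemma Psi_differentiable (B : ℂ) (A r : List ℂ) (α : List Bool) :
    Differentiable ℂ (fun t => Psi B (A ++ t :: r) α) := by
  obtain ⟨p, -, hp⟩ := Psi_polyDeg B A r α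
  have : (fun t => Psi B (A ++ t :: r) α) = fun t => p.eval t := funext hp
  rw [this]
  exact p.differentiable

/-- The derivative, at the homogeneous point, in the parameter of index `i`. -/
def dPsi (B : ℂ) (i k : ℕ) (α : List Bool) : ℂ :=
  deriv (fun t => Psi B (List.replicate i 1 ++ t :: List.replicate k 1) α) 1

lemma hasDerivAt_dPsi (B : ℂ) (i k : ℕ) (α : List Bool) :
    HasDerivAt (fun t => Psi B (List.replicate i 1 ++ t :: List.replicate k 1) α)
      (dPsi B i k α) 1 :=
  (Psi_differentiable B _ _ α 1).hasDerivAt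

/-- The solution at the homogeneous point. -/
def hom (B : ℂ) (α : List Bool) : ℂ := Psi B (List.replicate α.length 1) α

/-- The action of a single bond of the Hamiltonian. -/
def bond (B : ℂ) (l : List Bool) (x y : Bool) (r : List Bool) : ℂ :=
  if x = y then 1 / 4 * hom B (l ++ x :: y :: r)
  else -hom B (l ++ y :: x :: r) - 1 / 4 * hom B (l ++ x :: y :: r)

/-- The indicator of a down spin. -/
def dn (x : Bool) : ℂ := if x then 1 else 0

lemma Psi_ones (B : ℂ) (l r : List Bool) (x y : Bool) :
    Psi B (List.replicate l.length 1 ++ 1 :: 1 :: List.replicate r.length 1) (l ++ x :: y :: r) =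
      hom B (l ++ x :: y :: r) := by
  rw [hom]; congr 1
  simp only [List.length_append, List.length_cons]
  rw [List.replicate_add, List.replicate_succ, List.replicate_succ]

lemma bond_eq (B : ℂ) (l : List Bool) (x y : Bool) (r : List Bool) :
    bond B l x y r = -(om - om ^ 2) * (dPsi B (l.length + 1) r.length (l ++ x :: y :: r) -
      dPsi B l.length (r.length + 1) (l ++ x :: y :: r)) +
      (-3 / 4 + (om + 1 / 2) * (dn x - dn y)) * hom B (l ++ x :: y :: r) := by
  have hq := om_sq
  have hl : (List.replicate l.length (1 : ℂ)).length = l.length := by simp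
  have D1 : ∀ α, HasDerivAt (fun t => Psi B (List.replicate l.length 1 ++ t :: 1 ::
      List.replicate r.length 1) α) (dPsi B l.length (r.length + 1) α) 1 := fun α =>
    hasDerivAt_dPsi B l.length (r.length + 1) α
  have D2 : ∀ α, HasDerivAt (fun t => Psi B (List.replicate l.length 1 ++ 1 :: t ::
      List.replicate r.length 1) α) (dPsi B (l.length + 1) r.length α) 1 := by
    intro α
    have := hasDerivAt_dPsi B (l.length + 1) r.length α
    simp only [List.replicate_succ', List.append_assoc, List.cons_append, List.nil_append] at this
    exact this
  have Did := hasDerivAt_id' (1 : ℂ)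
  by_cases hxy : x = y
  · subst hxy
    have E : (fun t => (t - om * 1) * Psi B (List.replicate l.length 1 ++ t :: 1 ::
        List.replicate r.length 1) (l ++ x :: x :: r)) = fun t => (1 - om * t) *
        Psi B (List.replicate l.length 1 ++ 1 :: t :: List.replicate r.length 1)
          (l ++ x :: x :: r) :=
      funext fun t => Psi_diag B hl t 1 _ x r
    have h1 := (Did.sub_const (om * 1)).mul (D1 (l ++ x :: x :: r))
    have h2 := ((Did.const_mul om).const_sub 1).mul (D2 (l ++ x :: x :: r))
    have h3 := h1.unique (h2.congr_of_eventuallyEq (Filter.Eventually.of_forall fun t => congrFun E t))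
    simp only [Psi_ones] at h3
    rw [bond, if_pos rfl]
    generalize hom B _ = X at *
    linear_combination -om * h3 + X * hq
  · cases x <;> cases y <;> simp only [not_true_eq_false, reduceCtorEq, not_false_eq_true] at hxy
    · have E : (fun t => (t - 1) * Psi B (List.replicate l.length 1 ++ t :: 1 ::
          List.replicate r.length 1) (l ++ true :: false :: r)) = fun t => (om * 1 - om ^ 2 * t) *
          Psi B (List.replicate l.length 1 ++ 1 :: t :: List.replicate r.length 1)
            (l ++ false :: true :: r) - (om - om ^ 2) * 1 *
          Psi B (List.replicate l.length 1 ++ t :: 1 :: List.replicate r.length 1)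
            (l ++ false :: true :: r) :=
        funext fun t => Psi_exch' B hl 1 t _ r
      have h1 := (Did.sub_const 1).mul (D1 (l ++ true :: false :: r))
      have h2 := (((Did.const_mul (om ^ 2)).const_sub (om * 1)).mul
        (D2 (l ++ false :: true :: r))).sub
        ((D1 (l ++ false :: true :: r)).const_mul ((om - om ^ 2) * 1))
      have h3 := h1.unique (h2.congr_of_eventuallyEq (Filter.Eventually.of_forall fun t => congrFun E t))
      simp only [Psi_ones] at h3
      simp only [bond, dn, reduceCtorEq, if_false, if_true]
      linear_combination -h3 + hom B (l ++ false :: true :: r) * hq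
    · have E : (fun t => (t - 1) * Psi B (List.replicate l.length 1 ++ t :: 1 ::
          List.replicate r.length 1) (l ++ false :: true :: r)) = fun t => (om * 1 - om ^ 2 * t) *
          Psi B (List.replicate l.length 1 ++ 1 :: t :: List.replicate r.length 1)
            (l ++ true :: false :: r) - (om - om ^ 2) * t *
          Psi B (List.replicate l.length 1 ++ t :: 1 :: List.replicate r.length 1)
            (l ++ true :: false :: r) :=
        funext fun t => Psi_exch B hl t 1 _ r
      have h1 := (Did.sub_const 1).mul (D1 (l ++ false :: true :: r))
      have h2 := (((Did.const_mul (om ^ 2)).const_sub (om * 1)).mul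
        (D2 (l ++ true :: false :: r))).sub
        ((Did.const_mul (om - om ^ 2)).mul (D1 (l ++ true :: false :: r)))
      have h3 := h1.unique (h2.congr_of_eventuallyEq (Filter.Eventually.of_forall fun t => congrFun E t))
      simp only [Psi_ones] at h3
      simp only [bond, dn, reduceCtorEq, if_false, if_true]
      linear_combination -h3

lemma dPsi_left (B : ℂ) (x : Bool) (γ : List Bool) :
    2 * (B - 1) * dPsi B 0 γ.length (x :: γ) =
      ((B - 1) * 2 * (x :: γ).count true - if x then 2 * B else 0) * hom B (x :: γ) := by
  have D := hasDerivAt_dPsi B 0 γ.length (x :: γ)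
  simp only [List.replicate_zero, List.nil_append] at D
  have Dinv : HasDerivAt (fun w : ℂ => Psi B (w⁻¹ :: List.replicate γ.length 1) (x :: γ))
      (-dPsi B 0 γ.length (x :: γ)) 1 := by
    have hi : HasDerivAt (fun w : ℂ => w⁻¹) (-1) 1 := by
      simpa using hasDerivAt_inv (one_ne_zero (α := ℂ))
    have D' : HasDerivAt (fun t => Psi B (t :: List.replicate γ.length 1) (x :: γ))
      (dPsi B 0 γ.length (x :: γ)) ((1 : ℂ)⁻¹) := by rwa [inv_one]
    have D2 := D'.comp (1 : ℂ) hi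
    rw [mul_neg_one] at D2
    exact D2
  have hn : ∀ᶠ w : ℂ in nhds 1, w ≠ 0 := isOpen_ne.mem_nhds one_ne_zero
  have hpow : ∀ k : ℕ, HasDerivAt (fun w : ℂ => w ^ k) k 1 := fun k => by
    simpa using hasDerivAt_pow k (1 : ℂ)
  have hom1 : Psi B (1 :: List.replicate γ.length 1) (x :: γ) = hom B (x :: γ) := rfl
  cases x
  · have h1 := (hpow (2 * γ.count true)).mul Dinv
    have h2 := h1.congr_of_eventuallyEq (f₁ := fun w =>
      Psi B (w :: List.replicate γ.length 1) (false :: γ)) (hn.mono fun w hw =>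
        (Psi_refl_left_up B w hw _ _ (by simp)).symm)
    have h3 := D.unique h2
    simp only [inv_one, one_pow, hom1] at h3
    push_cast at h3
    simp only [List.count_cons_of_ne (show false ≠ true by simp), Bool.false_eq_true, if_false]
    linear_combination (B - 1) * h3
  · have h1 := (((hasDerivAt_id' (1 : ℂ)).const_sub B).mul (hpow (2 * γ.count true + 1))).mul Dinv
    have h2 := (((hasDerivAt_id' (1 : ℂ)).const_mul B).sub_const 1).mul D
    have h4 := h1.congr_of_eventuallyEq (f₁ := fun w =>
      (B * w - 1) * Psi B (w :: List.replicate γ.length 1) (true :: γ)) (hn.mono fun w hw =>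
        (Psi_refl_left_down B w hw _ _ (by simp)).symm)
    have h3 := h2.unique h4
    simp only [Pi.mul_apply, inv_one, one_pow, hom1] at h3
    push_cast at h3
    simp only [List.count_cons_self, if_true]
    push_cast
    linear_combination h3

lemma dPsi_right (B : ℂ) (x : Bool) (γ : List Bool) :
    2 * (1 - om * B) * dPsi B γ.length 0 (γ ++ [x]) =
      ((1 - om * B) * 2 * (γ ++ [x]).count true + if x then 2 * (om * B) else 0) *
        hom B (γ ++ [x]) := by
  have D := hasDerivAt_dPsi B γ.length 0 (γ ++ [x])
  simp only [List.replicate_zero] at D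
  have Dinv : HasDerivAt (fun w : ℂ => Psi B (List.replicate γ.length 1 ++ [w⁻¹]) (γ ++ [x]))
      (-dPsi B γ.length 0 (γ ++ [x])) 1 := by
    have hi : HasDerivAt (fun w : ℂ => w⁻¹) (-1) 1 := by
      simpa using hasDerivAt_inv (one_ne_zero (α := ℂ))
    have D' : HasDerivAt (fun t => Psi B (List.replicate γ.length 1 ++ [t]) (γ ++ [x]))
      (dPsi B γ.length 0 (γ ++ [x])) ((1 : ℂ)⁻¹) := by rwa [inv_one]
    have D2 := D'.comp (1 : ℂ) hi
    rw [mul_neg_one] at D2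
    exact D2
  have hn : ∀ᶠ w : ℂ in nhds 1, w ≠ 0 := isOpen_ne.mem_nhds one_ne_zero
  have hpow : ∀ k : ℕ, HasDerivAt (fun w : ℂ => w ^ k) k 1 := fun k => by
    simpa using hasDerivAt_pow k (1 : ℂ)
  have hom1 : Psi B (List.replicate γ.length 1 ++ [1]) (γ ++ [x]) = hom B (γ ++ [x]) := by
    rw [hom, ← List.replicate_succ']; simp
  cases x
  · have h1 := (hpow (2 * γ.count true)).mul Dinv
    have h2 := h1.congr_of_eventuallyEq (f₁ := fun w =>
      Psi B (List.replicate γ.length 1 ++ [w]) (γ ++ [false])) (hn.mono fun w hw =>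
        (Psi_refl_right_up B w hw _ _ (by simp)).symm)
    have h3 := D.unique h2
    simp only [inv_one, one_pow, hom1] at h3
    push_cast at h3
    simp only [List.count_append, List.count_singleton, Bool.false_eq_true, if_false]
    simp only [beq_iff_eq, Bool.false_eq_true, if_false, add_zero]
    linear_combination (1 - om * B) * h3
  · have h1 := (((hasDerivAt_id' (1 : ℂ)).sub_const (om * B)).mul
      (hpow (2 * γ.count true + 1))).mul Dinv
    have h2 := (((hasDerivAt_id' (1 : ℂ)).const_mul (om * B)).const_sub 1).mul D
    have h4 := h1.congr_of_eventuallyEq (f₁ := fun w =>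
      (1 - om * B * w) * Psi B (List.replicate γ.length 1 ++ [w]) (γ ++ [true]))
        (hn.mono fun w hw => (Psi_refl_right_down B w hw _ _ (by simp)).symm)
    have h3 := h2.unique h4
    simp only [Pi.mul_apply, inv_one, one_pow, hom1] at h3
    push_cast at h3
    simp only [List.count_append, List.count_singleton_self, if_true]
    push_cast
    linear_combination h3

end QKZ

namespace QKZ
open MvPolynomial

lemma siteOp_mulVec {N : ℕ} (i : Fin N) (A : Matrix (Fin 2) (Fin 2) ℂ) (ψ : Conf N → ℂ)
    (α : Conf N) : (siteOp N i A).mulVec ψ α = ∑ s, A (α i) s * ψ (Function.update α i s) := by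
  have h : ∀ β : Conf N, siteOp N i A α β =
      ∑ s, if β = Function.update α i s then A (α i) s else 0 := by
    intro β
    simp only [siteOp, Matrix.of_apply]
    rw [Finset.sum_eq_single (β i)]
    · have : (∏ j ∈ Finset.univ.erase i, (if α j = β j then (1 : ℂ) else 0)) =
          if β = Function.update α i (β i) then 1 else 0 := by
        rw [Finset.prod_ite_zero]
        simp only [Finset.prod_const_one, Finset.mem_erase, Finset.mem_univ, and_true]
        congr 1
        apply propext
        rw [Function.eq_update_iff]
        simp only [true_and, eq_comm, ne_eq]
      rw [this, mul_ite, mul_one, mul_zero]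
    · intro s _ hs
      rw [if_neg]
      rintro h
      apply hs
      rw [h]; simp
    · simp
  simp only [Matrix.mulVec, dotProduct, h, Finset.sum_mul, ite_mul, zero_mul]
  rw [Finset.sum_comm]
  simp

/-- The list of spins of a configuration; `true` is a down spin. -/
def sl {N : ℕ} (α : Conf N) : List Bool := List.ofFn fun i => decide (α i = 1)

lemma sl_length {N : ℕ} (α : Conf N) : (sl α).length = N := by simp [sl]

lemma sl_update {N : ℕ} (α : Conf N) (i : Fin N) (s : Fin 2) :
    sl (Function.update α i s) = (sl α).set i (decide (s = 1)) := by
  apply List.ext_getElem (by simp [sl])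
  intro k h1 h2
  simp only [sl, List.getElem_ofFn, List.getElem_set, Function.update_apply, Fin.ext_iff]
  by_cases h : k = i.1
  · simp [h]
  · simp [h, Ne.symm h]

lemma exists_sl_split {N : ℕ} (α : Conf N) (i : ℕ) (hi : i + 1 < N) :
    ∃ l r, sl α = l ++ decide (α ⟨i, by omega⟩ = 1) :: decide (α ⟨i + 1, hi⟩ = 1) :: r ∧
      l.length = i := by
  refine ⟨(sl α).take i, (sl α).drop (i + 2), ?_, by simp [sl_length]; omega⟩
  conv_lhs => rw [← List.take_append_drop i (sl α)]
  rw [List.drop_eq_getElem_cons (by simp [sl_length]; omega),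
    List.drop_eq_getElem_cons (by simp [sl_length]; omega)]
  simp [sl]

lemma bond_mulVec {N : ℕ} (B : ℂ) (α : Conf N) (i : ℕ) (hi : i + 1 < N) (l r : List Bool)
    (x y : Bool) (hx : x = decide (α ⟨i, by omega⟩ = 1)) (hy : y = decide (α ⟨i + 1, hi⟩ = 1))
    (h : sl α = l ++ x :: y :: r) (hl : l.length = i) :
    (-(1 / 2) : ℂ) * ((siteOp N ⟨i, by omega⟩ pauliX * siteOp N ⟨i + 1, hi⟩ pauliX
        + siteOp N ⟨i, by omega⟩ pauliY * siteOp N ⟨i + 1, hi⟩ pauliY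
        - (1 / 2 : ℂ) • (siteOp N ⟨i, by omega⟩ pauliZ * siteOp N ⟨i + 1, hi⟩ pauliZ)).mulVec
      (fun α => hom B (sl α)) α) = bond B l x y r := by
  have hne : (⟨i + 1, hi⟩ : Fin N) ≠ ⟨i, by omega⟩ := by simp [Fin.ext_iff]
  simp only [Matrix.add_mulVec, Matrix.sub_mulVec, Matrix.smul_mulVec, ← Matrix.mulVec_mulVec,
    Pi.add_apply, Pi.sub_apply, Pi.smul_apply, smul_eq_mul, siteOp_mulVec, Function.update_of_ne hne,
    sl_update, h]
  have hset : ∀ u v, ((l ++ x :: y :: r).set i u).set (i + 1) v = l ++ u :: v :: r := by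
    intro u v
    subst hl
    simp
  simp only [hset]
  have h01 : ∀ a : Fin 2, a = 0 ∨ a = 1 := by decide
  rcases h01 (α ⟨i, by omega⟩) with h0 | h0 <;> rcases h01 (α ⟨i + 1, hi⟩) with h1 | h1 <;>
    rw [h0] at hx <;> rw [h1] at hy <;> subst hx hy <;>
    simp [h0, h1, pauliX, pauliY, pauliZ, bond, Fin.sum_univ_two] <;>
    ring_nf <;> simp [Complex.I_sq] <;> ring

/-- The boundary parameter attached to the anisotropy of the boundary fields. -/
def Bx (x : ℝ) : ℂ := (x + om) / (x + om ^ 2)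

lemma om_im : om.im = Real.sqrt 3 / 2 := by simp [om]

lemma om_im_ne : om.im ≠ 0 := by
  rw [om_im]; positivity

lemma add_om_ne (x : ℝ) : (x + om : ℂ) ≠ 0 := fun h => by
  have := congrArg Complex.im h
  simp [om_im_ne] at this

lemma add_om_sq_ne (x : ℝ) : (x + om ^ 2 : ℂ) ≠ 0 := fun h => by
  have := congrArg Complex.im h
  rw [om_sq] at this
  simp [om_im_ne] at this

lemma hom_eigen {N : ℕ} (h : 0 < N) (x : ℝ) (hx : 0 < x) :
    (XXZ N h x).mulVec (fun α => hom (Bx x) (sl α)) =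
      ((E0 N x : ℝ) : ℂ) • fun α => hom (Bx x) (sl α) := by
  funext α
  have hq := om_sq
  set B := Bx x with hB
  have hx0 : (x : ℂ) ≠ 0 := by exact_mod_cast hx.ne'
  have hBx : B * (x + om ^ 2) = x + om := div_mul_cancel₀ _ (add_om_sq_ne x)
  set X := hom B (sl α) with hX
  set d : ℕ → ℂ := fun i => dPsi B i (N - 1 - i) (sl α) with hd
  set e : ℕ → ℂ := fun i => dn ((sl α).getD i false) with he
  have hbond : ∀ i : Fin (N - 1), (-(1 / 2) : ℂ) *
      ((siteOp N ⟨i.1, by omega⟩ pauliX * siteOp N ⟨i.1 + 1, by omega⟩ pauliX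
        + siteOp N ⟨i.1, by omega⟩ pauliY * siteOp N ⟨i.1 + 1, by omega⟩ pauliY
        - (1 / 2 : ℂ) • (siteOp N ⟨i.1, by omega⟩ pauliZ *
          siteOp N ⟨i.1 + 1, by omega⟩ pauliZ)).mulVec (fun α => hom B (sl α)) α) =
      (-(om - om ^ 2) * d (i.1 + 1) - (om + 1 / 2) * X * e (i.1 + 1) + -3 / 4 * X * (i.1 + 1 : ℕ)) -
      (-(om - om ^ 2) * d i.1 - (om + 1 / 2) * X * e i.1 + -3 / 4 * X * (i.1 : ℕ)) := by
    intro i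
    have hi : i.1 + 1 < N := by omega
    obtain ⟨l, r, h1, h2⟩ := exists_sl_split α i.1 hi
    have hN : N = l.length + (r.length + 2) := by
      have := congrArg List.length h1
      simpa [sl_length] using this
    rw [bond_mulVec B α i.1 hi l r _ _ rfl rfl h1 h2, bond_eq, ← h1, h2]
    have e1 : N - 1 - (i.1 + 1) = r.length := by omega
    have e2 : N - 1 - i.1 = r.length + 1 := by omega
    generalize decide (α ⟨i.1, _⟩ = 1) = u at h1 ⊢
    generalize decide (α ⟨i.1 + 1, _⟩ = 1) = v at h1 ⊢
    rw [← h2] at e1 e2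
    simp only [hd, he, ← h2]
    rw [e1, e2, ← hX]
    simp only [h1]
    simp only [List.getD_eq_getElem?_getD, List.getElem?_append_right (Nat.le_add_right _ _),
      List.getElem?_append_right le_rfl]
    simp only [Nat.sub_self, Nat.add_sub_cancel_left, List.getElem?_cons_zero,
      List.getElem?_cons_succ, Option.getD_some]
    push_cast
    ring
  have hz : ∀ (i : ℕ) (hi : i < N), (siteOp N ⟨i, hi⟩ pauliZ).mulVec (fun α => hom B (sl α)) α =
      (1 - 2 * e i) * X := by
    intro i hi
    have h1 : e i = dn (decide (α ⟨i, hi⟩ = 1)) := by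
      simp [he, sl, List.getD_eq_getElem?_getD, hi]
    have h2 : ∀ s, s = α ⟨i, hi⟩ → Function.update α ⟨i, hi⟩ s = α := by
      rintro s rfl; exact Function.update_eq_self _ _
    have h01 : ∀ a : Fin 2, a = 0 ∨ a = 1 := by decide
    rw [siteOp_mulVec, h1, Fin.sum_univ_two]
    rcases h01 (α ⟨i, hi⟩) with h0 | h0
    · rw [h2 0 h0.symm, h0]; simp [pauliZ, dn, hX]
    · rw [h2 1 h0.symm, h0]; simp [pauliZ, dn, hX]; ring
  have hleft : 2 * (B - 1) * d 0 = ((B - 1) * 2 * (sl α).count true - 2 * B * e 0) * X := by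
    rcases hs : sl α with _ | ⟨y, γ⟩
    · have := sl_length α; rw [hs] at this; simp at this; omega
    · have hl : N - 1 - 0 = γ.length := by have := sl_length α; rw [hs] at this; simp at this; omega
      have := dPsi_left B y γ
      simp only [hd, he, hX, hs, hl, List.getD_cons_zero]
      rw [this]
      cases y <;> simp [dn]
  have hright : 2 * (1 - om * B) * d (N - 1) =
      ((1 - om * B) * 2 * (sl α).count true + 2 * (om * B) * e (N - 1)) * X := by
    rcases List.eq_nil_or_concat (sl α) with hs | ⟨γ, y, hs⟩
    · have := sl_length α; rw [hs] at this; simp at this; omega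
    · rw [List.concat_eq_append] at hs
      have hl : N - 1 = γ.length := by have := sl_length α; rw [hs] at this; simp at this; omega
      have := dPsi_right B y γ
      simp only [hd, he, hX, hs, hl, Nat.sub_self]
      rw [this]
      cases y <;> simp [dn, List.getD_eq_getElem?_getD]
  have hd0 : (om - om ^ 2) * d 0 = ((om - om ^ 2) * (sl α).count true - (x + om) * e 0) * X := by
    have h1 : (B - 1) * (x + om ^ 2) = om - om ^ 2 := by linear_combination hBx
    linear_combination (x + om ^ 2) / 2 * hleft - (d 0 - (sl α).count true * X) * h1 +
      e 0 * X * -hBx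
  have hdN : (om - om ^ 2) * d (N - 1) = ((om - om ^ 2) * (sl α).count true +
      (om ^ 2 + 1 / x) * e (N - 1)) * X := by
    have h1 : (1 - om * B) * (x + om ^ 2) = x * (1 - om) := by linear_combination -om * hBx
    have h2 : x * (om - om ^ 2) * (d (N - 1) - (sl α).count true * X) =
        om * (om * B) * (x + om ^ 2) * e (N - 1) * X := by
      linear_combination om * (x + om ^ 2) / 2 * hright - om * (d (N - 1) - (sl α).count true * X) * h1
    have h3 : om * (om * B) * (x + om ^ 2) = om ^ 2 * x + 1 := by
      linear_combination om ^ 2 * hBx + om_cube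
    rw [h3] at h2
    apply mul_left_cancel₀ hx0
    field_simp
    linear_combination h2
  simp only [XXZ, Matrix.add_mulVec, Matrix.smul_mulVec, Matrix.sum_mulVec, Pi.add_apply,
    Pi.smul_apply, smul_eq_mul, Finset.sum_apply, hz, Finset.mul_sum]
  rw [Finset.sum_congr rfl fun i _ => hbond i]
  rw [Fin.sum_univ_eq_sum_range (fun i : ℕ =>
    (-(om - om ^ 2) * d (i + 1) - (om + 1 / 2) * X * e (i + 1) + -3 / 4 * X * (i + 1 : ℕ)) -
      (-(om - om ^ 2) * d i - (om + 1 / 2) * X * e i + -3 / 4 * X * (i : ℕ))) (N - 1),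
    Finset.sum_range_sub (fun i : ℕ =>
      (-(om - om ^ 2) * d i - (om + 1 / 2) * X * e i + -3 / 4 * X * (i : ℕ)))]
  have hN1 : ((N - 1 : ℕ) : ℂ) = N - 1 := by rw [Nat.cast_sub h]; simp
  have hE : ((E0 N x : ℝ) : ℂ) = -(3 * (N : ℂ) - 1) / 4 - (1 - x) ^ 2 / (2 * x) := by
    simp [E0]
  have hpL : ((pL x : ℝ) : ℂ) = 1 / 2 * (1 / 2 - x) := by simp [pL]
  have hpR : ((pR x : ℝ) : ℂ) = 1 / 2 * (1 / 2 - 1 / x) := by simp [pR]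
  rw [hN1, hE, hpL, hpR, Nat.cast_zero, ← hX]
  have hfin : (-3 / 4 * (N - 1) + (1 / 2) * (1 / 2 - x) + 1 / 2 * (1 / 2 - 1 / x) : ℂ) =
      -(3 * (N : ℂ) - 1) / 4 - (1 - x) ^ 2 / (2 * x) := by
    field_simp
    ring
  rw [← hfin]
  linear_combination -hdN + hd0 - e (N - 1) * X * hq

/-- The component of the solution on the extremal configuration. -/
def fN (B : ℂ) (N : ℕ) : ℂ :=
  hom B (List.replicate (N / 2) true ++ List.replicate (N - N / 2) false)

lemma sl_baseState (N : ℕ) :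
    sl (baseState N) = List.replicate (N / 2) true ++ List.replicate (N - N / 2) false := by
  apply List.ext_getElem (by simp [sl_length]; omega)
  intro i h1 h2
  simp only [sl, List.getElem_ofFn, baseState, List.getElem_append, List.length_replicate,
    List.getElem_replicate]
  split_ifs <;> simp

lemma hom_eq_of_isGroundState {N : ℕ} {x : ℝ} (hx : 0 < x) {ψ : Conf N → ℂ}
    (h : IsGroundState N x ψ) (α : Conf N) : hom (Bx x) (sl α) = fN (Bx x) N * ψ α := by
  rw [IsGroundState] at h
  split_ifs at h with hN
  · obtain ⟨-, h2, h3⟩ := h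
    obtain ⟨c, hc⟩ := h2 _ (hom_eigen hN x hx)
    have e1 := congrFun hc α
    have e2 := congrFun hc (baseState N)
    simp only [Pi.smul_apply, smul_eq_mul, h3, mul_one, sl_baseState] at e1 e2
    rw [e1, fN, e2]
  · obtain rfl : N = 0 := by omega
    rw [h, mul_one, fN]
    simp [sl]

lemma gD_ones (B : ℂ) (n : ℕ) :
    gD B om (List.replicate n 1) = (B - 1) ^ n * (1 - om) ^ (n * (n - 1)) := by
  induction n with
  | zero => simp [gD]
  | succ n ih =>
    rw [List.replicate_succ, gD, ih]
    simp only [List.map_replicate, List.prod_replicate, mul_one]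
    rcases n with _ | n
    · simp
    · rw [show (n + 1 + 1) * (n + 1 + 1 - 1) = 2 * (n + 1) + (n + 1) * (n + 1 - 1) by
        simp only [Nat.add_sub_cancel]; ring, pow_add (1 - om),
        show (1 - om) ^ (2 * (n + 1)) = ((1 - om) * (1 - om)) ^ (n + 1) by rw [pow_mul, sq]]
      ring

lemma gU_ones (m : ℕ) : gU om (List.replicate m 1) = 3 ^ (m * (m - 1) / 2) := by
  induction m with
  | zero => simp [gU]
  | succ n ih =>
    rw [List.replicate_succ, gU, ih]
    simp only [List.map_replicate, List.prod_replicate, mul_one]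
    have h3 : (1 - om) * (1 - om ^ 2) = 3 := by
      linear_combination om_cube - om_sq
    rw [h3, ← pow_add]
    congr 1
    rcases n with _ | n
    · simp
    · simp only [Nat.add_sub_cancel]
      rw [show (n + 1 + 1) * (n + 1) = (n + 1) * n + (n + 1) * 2 by ring,
        Nat.add_mul_div_right _ _ two_pos, add_comm]

lemma fN_eq (B : ℂ) (N : ℕ) : fN B N = (B - 1) ^ (N / 2) * (1 - om) ^ ((N / 2) * (N / 2 - 1)) *
    3 ^ ((N - N / 2) * (N - N / 2 - 1) / 2) := by
  have h := Psi_base B (List.replicate (N / 2) 1) (List.replicate (N - N / 2) 1)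
  simp only [List.length_replicate] at h
  have h1 : List.replicate (N / 2) (1 : ℂ) ++ List.replicate (N - N / 2) 1 =
      List.replicate (List.replicate (N / 2) true ++ List.replicate (N - N / 2) false).length 1 := by
    simp
  rw [h1] at h
  rw [fN, hom, h, base, gD_ones, gU_ones]
  simp only [List.length_replicate, List.prod_replicate, one_pow, mul_one]
  split_ifs with h2 h3
  · rfl
  · rfl
  · omega

lemma fN_ne_zero (x : ℝ) (N : ℕ) : fN (Bx x) N ≠ 0 := by
  rw [fN_eq]
  have h1 : Bx x - 1 ≠ 0 := by
    intro h
    have hBx : Bx x * (x + om ^ 2) = x + om := div_mul_cancel₀ _ (add_om_sq_ne x)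
    have : om * (1 - om) = 0 := by linear_combination (x + om ^ 2) * h - hBx
    exact mul_ne_zero om_ne_zero one_sub_om_ne this
  exact mul_ne_zero (mul_ne_zero (pow_ne_zero _ h1) (pow_ne_zero _ one_sub_om_ne))
    (pow_ne_zero _ three_ne_zero)

end QKZ

namespace QKZ

/-- Sum over all spin lists of a given length. -/
def sumS : ℕ → (List Bool → ℂ) → ℂ
  | 0, f => f []
  | n + 1, f => sumS n (fun l => f (true :: l)) + sumS n (fun l => f (false :: l))

lemma sumS_congr {n : ℕ} {f g : List Bool → ℂ} (h : ∀ l, l.length = n → f l = g l) :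
    sumS n f = sumS n g := by
  induction n generalizing f g with
  | zero => exact h [] rfl
  | succ n ih =>
    rw [sumS, sumS, ih fun l hl => h (true :: l) (by simp [hl]),
      ih fun l hl => h (false :: l) (by simp [hl])]

lemma sumS_add {n : ℕ} (f g : List Bool → ℂ) :
    sumS n (fun l => f l + g l) = sumS n f + sumS n g := by
  induction n generalizing f g with
  | zero => rfl
  | succ n ih => simp only [sumS, ih]; ring

lemma sumS_mul {n : ℕ} (c : ℂ) (f : List Bool → ℂ) :
    sumS n (fun l => c * f l) = c * sumS n f := by
  induction n generalizing f with
  | zero => rfl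
  | succ n ih => simp only [sumS, ih]; ring

lemma sumS_append (a b : ℕ) (f : List Bool → ℂ) :
    sumS (a + b) f = sumS a fun α => sumS b fun β => f (α ++ β) := by
  induction a generalizing f with
  | zero => simp [sumS]
  | succ a ih => rw [Nat.add_right_comm, sumS, sumS, ih, ih]; rfl

lemma sumS_pair (a b : ℕ) (f : List Bool → ℂ) :
    sumS (a + (b + 2)) f = sumS a fun α => sumS b fun β =>
      f (α ++ true :: true :: β) + f (α ++ true :: false :: β) +
      (f (α ++ false :: true :: β) + f (α ++ false :: false :: β)) := by
  rw [sumS_append]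
  refine sumS_congr fun α _ => ?_
  simp only [sumS, ← sumS_add]

lemma sumS_eq_sum (n : ℕ) (f : List Bool → ℂ) :
    sumS n f = ∑ α : Conf n, f (sl α) := by
  induction n generalizing f with
  | zero => simp [sumS, sl]
  | succ n ih =>
    rw [sumS, ih, ih, ← (Fin.consEquiv fun _ => Fin 2).sum_comp, Fintype.sum_prod_type,
      Fin.sum_univ_two, add_comm]
    simp [sl, Fin.consEquiv, List.ofFn_succ]

lemma sumS_polyDeg {n d : ℕ} {f : ℂ → List Bool → ℂ} (h : ∀ l, l.length = n → PolyDeg d (f · l)) :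
    PolyDeg d (fun t => sumS n (f t)) := by
  induction n generalizing f with
  | zero => exact h [] rfl
  | succ n ih =>
    exact (ih fun l hl => h (true :: l) (by simp [hl])).add
      (ih fun l hl => h (false :: l) (by simp [hl]))

/-- Entrywise inverses. -/
def iv (l : List ℂ) : List ℂ := l.map (·⁻¹)

@[simp] lemma iv_nil : iv [] = [] := rfl
@[simp] lemma iv_cons (a : ℂ) (l : List ℂ) : iv (a :: l) = a⁻¹ :: iv l := rfl
@[simp] lemma iv_append (l r : List ℂ) : iv (l ++ r) = iv l ++ iv r := by simp [iv]
@[simp] lemma iv_length (l : List ℂ) : (iv l).length = l.length := by simp [iv]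

/-- The overlap of the inhomogeneous solutions. -/
def ov (B : ℂ) (z1 z2 : List ℂ) : ℂ :=
  sumS z1.length fun α => sumS z2.length fun β =>
    Psi B (iv z1 ++ iv z2) (α ++ β) * Psi B z1 α * Psi B z2 β

lemma Psi_eq_zero' (B : ℂ) (z : List ℂ) (α : List Bool) (h : α.count true ≠ α.length / 2) :
    Psi B z α = 0 := by
  have := List.count_false_add_count_true α
  apply Psi_eq_zero <;> omega

lemma bil_exch (B : ℂ) {A1 A2 : List ℂ} {α1 α2 : List Bool} (h1 : A1.length = α1.length)
    (h2 : A2.length = α2.length) {a b : ℂ} (ha : a ≠ 0) (hb : b ≠ 0) (C1 C2 : List ℂ)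
    (γ1 γ2 : List Bool) :
    let f := fun (a b : ℂ) (s t : Bool) => Psi B (A1 ++ a⁻¹ :: b⁻¹ :: C1) (α1 ++ s :: t :: γ1) *
      Psi B (A2 ++ a :: b :: C2) (α2 ++ s :: t :: γ2)
    f a b true true + f a b true false + (f a b false true + f a b false false) =
    f b a true true + f b a true false + (f b a false true + f b a false false) := by
  intro f
  by_cases hab : a = b
  · rw [hab]
  have hab' := sub_ne_zero.2 hab
  have hdiag : ∀ s, f a b s s = f b a s s := by
    intro s
    have e1 := Psi_diag B h1 a⁻¹ b⁻¹ C1 s γ1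
    have e2 := Psi_diag B h2 a b C2 s γ2
    simp only [f]
    generalize Psi B (A1 ++ a⁻¹ :: b⁻¹ :: C1) _ = x1 at *
    generalize Psi B (A1 ++ b⁻¹ :: a⁻¹ :: C1) _ = x2 at *
    generalize Psi B (A2 ++ a :: b :: C2) _ = y1 at *
    generalize Psi B (A2 ++ b :: a :: C2) _ = y2 at *
    have e1' : (b - om * a) * x1 = (a - om * b) * x2 := by
      field_simp at e1
      linear_combination e1
    by_cases hc : a - om * b = 0
    · have hd : b - om * a ≠ 0 := by
        rw [show b - om * a = (1 - om ^ 2) * b - om * (a - om * b) by ring, hc, mul_zero, sub_zero]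
        exact mul_ne_zero (sub_ne_zero.2 om_sq_ne_one.symm) hb
      rw [hc, zero_mul] at e1' e2
      rw [(mul_eq_zero.1 e1').resolve_left hd, (mul_eq_zero.1 e2.symm).resolve_left hd]
      ring
    · apply mul_left_cancel₀ hc
      linear_combination x1 * e2 + y2 * e1'
  rw [hdiag true, hdiag false]
  suffices f a b true false + f a b false true = f b a true false + f b a false true by
    linear_combination this
  have e1 := Psi_exch B h1 a⁻¹ b⁻¹ C1 γ1
  have e2 := Psi_exch B h1 b⁻¹ a⁻¹ C1 γ1
  have e3 := Psi_exch B h2 a b C2 γ2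
  have e4 := Psi_exch B h2 b a C2 γ2
  simp only [f]
  generalize Psi B (A1 ++ a⁻¹ :: b⁻¹ :: C1) (α1 ++ false :: true :: γ1) = r2 at *
  generalize Psi B (A1 ++ b⁻¹ :: a⁻¹ :: C1) (α1 ++ false :: true :: γ1) = r2' at *
  generalize Psi B (A2 ++ a :: b :: C2) (α2 ++ false :: true :: γ2) = p2 at *
  generalize Psi B (A2 ++ b :: a :: C2) (α2 ++ false :: true :: γ2) = p2' at *
  generalize Psi B (A1 ++ a⁻¹ :: b⁻¹ :: C1) (α1 ++ true :: false :: γ1) = r1 at *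
  generalize Psi B (A1 ++ b⁻¹ :: a⁻¹ :: C1) (α1 ++ true :: false :: γ1) = r1' at *
  generalize Psi B (A2 ++ a :: b :: C2) (α2 ++ true :: false :: γ2) = p1 at *
  generalize Psi B (A2 ++ b :: a :: C2) (α2 ++ true :: false :: γ2) = p1' at *
  field_simp at e1 e2
  have hq := om_sq
  have k : (a - b) ^ 2 + (om * b - om ^ 2 * a) * (om * a - om ^ 2 * b)
      - (om - om ^ 2) ^ 2 * a * b = 0 := by clear * - hq; grind
  apply mul_left_cancel₀ (pow_ne_zero 2 hab')
  have e1' : (b - a) * r2 = (om * a - om ^ 2 * b) * r1' - (om - om ^ 2) * b * r1 := by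
    linear_combination e1
  have e2' : (a - b) * r2' = (om * b - om ^ 2 * a) * r1 - (om - om ^ 2) * a * r1' := by
    linear_combination e2
  linear_combination (a - b) * r2 * e3 + (a - b) * r2' * e4 + (p1 * r1 - p1' * r1') * k
    - ((om * b - om ^ 2 * a) * p1' - (om - om ^ 2) * a * p1) * e1'
    + ((om * a - om ^ 2 * b) * p1 - (om - om ^ 2) * b * p1') * e2'

lemma ov_swap_left (B : ℂ) (A C z2 : List ℂ) {a b : ℂ} (ha : a ≠ 0) (hb : b ≠ 0) :
    ov B (A ++ a :: b :: C) z2 = ov B (A ++ b :: a :: C) z2 := by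
  have hl : ∀ a b : ℂ, (A ++ a :: b :: C).length = A.length + (C.length + 2) := by simp
  simp only [ov, hl, sumS_pair]
  refine sumS_congr fun α hα => sumS_congr fun γ hγ => ?_
  simp only [← sumS_add]
  refine sumS_congr fun β hβ => ?_
  have := bil_exch B (A1 := iv A) (A2 := A) (α1 := α) (α2 := α) (by simp [hα]) hα.symm ha hb
    (iv C ++ iv z2) C (γ ++ β) γ
  simp only [iv_append, iv_cons, List.append_assoc, List.cons_append] at this ⊢
  linear_combination Psi B z2 β * this

lemma ov_swap_right (B : ℂ) (z1 A C : List ℂ) {a b : ℂ} (ha : a ≠ 0) (hb : b ≠ 0) :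
    ov B z1 (A ++ a :: b :: C) = ov B z1 (A ++ b :: a :: C) := by
  have hl : ∀ a b : ℂ, (A ++ a :: b :: C).length = A.length + (C.length + 2) := by simp
  simp only [ov, hl, sumS_pair]
  refine sumS_congr fun β hβ => sumS_congr fun α hα => sumS_congr fun γ hγ => ?_
  have := bil_exch B (A1 := iv z1 ++ iv A) (A2 := A) (α1 := β ++ α) (α2 := α)
    (by simp [hα, hβ]) hα.symm ha hb (iv C) C γ γ
  simp only [iv_append, iv_cons, List.append_assoc] at this ⊢
  linear_combination Psi B z1 β * this

lemma perm_invariant {f : List ℂ → ℂ}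
    (h : ∀ A C (a b : ℂ), a ≠ 0 → b ≠ 0 → f (A ++ a :: b :: C) = f (A ++ b :: a :: C))
    {l l' : List ℂ} (hp : l.Perm l') (h0 : ∀ a ∈ l, a ≠ 0) : f l = f l' := by
  suffices ∀ A, f (A ++ l) = f (A ++ l') from this []
  induction hp with
  | nil => simp
  | cons x _ ih =>
    intro A
    have := ih (fun a ha => h0 a (by simp [ha])) (A ++ [x])
    simpa using this
  | swap x y l => exact fun A => h A l y x (h0 _ (by simp)) (h0 _ (by simp))
  | trans h1 _ ih1 ih2 =>
    exact fun A => (ih1 h0 A).trans (ih2 (fun a ha => h0 a (h1.mem_iff.2 ha)) A)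

lemma refl_left_bil (B w : ℂ) (hw : w ≠ 0) (h1 : w ≠ B) (L1 L2 : List ℂ)
    (s : Bool) (γ1 γ2 : List Bool) (hl1 : L1.length = γ1.length) (hl2 : L2.length = γ2.length) :
    w ^ (2 * ((L1.length + 1) / 2)) * (Psi B (w⁻¹ :: L1) (s :: γ1) * Psi B (w :: L2) (s :: γ2)) =
    w ^ (2 * ((L2.length + 1) / 2)) *
      (Psi B (w :: L1) (s :: γ1) * Psi B (w⁻¹ :: L2) (s :: γ2)) := by
  by_cases c1 : (s :: γ1).count true = (s :: γ1).length / 2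
  swap
  · rw [Psi_eq_zero' B _ _ c1, Psi_eq_zero' B _ _ c1]; ring
  by_cases c2 : (s :: γ2).count true = (s :: γ2).length / 2
  swap
  · rw [Psi_eq_zero' B _ _ c2, Psi_eq_zero' B _ _ c2]; ring
  rw [hl1, hl2]
  rw [List.length_cons] at c1 c2
  rw [← c1, ← c2]
  cases s
  · have e1 := Psi_refl_left_up B w hw L1 γ1 hl1
    have e2 := Psi_refl_left_up B w hw L2 γ2 hl2
    simp only [List.count_cons, beq_iff_eq, Bool.false_eq_true, if_false, add_zero]
    linear_combination Psi B (w :: L2) (false :: γ2) * e1 - Psi B (w :: L1) (false :: γ1) * e2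
  · have e1 := Psi_refl_left_down B w hw L1 γ1 hl1
    have e2 := Psi_refl_left_down B w hw L2 γ2 hl2
    simp only [List.count_cons, beq_iff_eq, if_true]
    apply mul_left_cancel₀ (sub_ne_zero.2 h1.symm)
    linear_combination w * Psi B (w :: L2) (true :: γ2) * e1 -
      w * Psi B (w :: L1) (true :: γ1) * e2

lemma refl_right_bil (B w : ℂ) (hw : w ≠ 0) (h1 : w ≠ om * B) (L1 L2 : List ℂ)
    (s : Bool) (γ1 γ2 : List Bool) (hl1 : L1.length = γ1.length) (hl2 : L2.length = γ2.length) :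
    w ^ (2 * ((L1.length + 1) / 2)) *
      (Psi B (L1 ++ [w⁻¹]) (γ1 ++ [s]) * Psi B (L2 ++ [w]) (γ2 ++ [s])) =
    w ^ (2 * ((L2.length + 1) / 2)) *
      (Psi B (L1 ++ [w]) (γ1 ++ [s]) * Psi B (L2 ++ [w⁻¹]) (γ2 ++ [s])) := by
  by_cases c1 : (γ1 ++ [s]).count true = (γ1 ++ [s]).length / 2
  swap
  · rw [Psi_eq_zero' B _ _ c1, Psi_eq_zero' B _ _ c1]; ring
  by_cases c2 : (γ2 ++ [s]).count true = (γ2 ++ [s]).length / 2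
  swap
  · rw [Psi_eq_zero' B _ _ c2, Psi_eq_zero' B _ _ c2]; ring
  rw [hl1, hl2]
  simp only [List.length_append, List.length_singleton] at c1 c2
  rw [← c1, ← c2]
  cases s
  · have e1 := Psi_refl_right_up B w hw L1 γ1 hl1
    have e2 := Psi_refl_right_up B w hw L2 γ2 hl2
    simp only [List.count_append, List.count_cons, List.count_nil, beq_iff_eq, Bool.false_eq_true,
      if_false, add_zero]
    linear_combination Psi B (L2 ++ [w]) (γ2 ++ [false]) * e1 -
      Psi B (L1 ++ [w]) (γ1 ++ [false]) * e2
  · have e1 := Psi_refl_right_down B w hw L1 γ1 hl1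
    have e2 := Psi_refl_right_down B w hw L2 γ2 hl2
    simp only [List.count_append, List.count_cons, List.count_nil, beq_iff_eq, if_true, zero_add]
    apply mul_left_cancel₀ (sub_ne_zero.2 h1)
    linear_combination w * Psi B (L2 ++ [w]) (γ2 ++ [true]) * e1 -
      w * Psi B (L1 ++ [w]) (γ1 ++ [true]) * e2

/-- The rescaled overlap, invariant under inversion of each variable. -/
def Fov (B : ℂ) (z1 z2 : List ℂ) : ℂ :=
  z1.prod ^ ((z1.length + z2.length) / 2 - z1.length / 2) *
    z2.prod ^ ((z1.length + z2.length) / 2 - z2.length / 2) * ov B z1 z2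

lemma Fov_perm_left (B : ℂ) (z2 : List ℂ) {l l' : List ℂ} (hp : l.Perm l')
    (h0 : ∀ a ∈ l, a ≠ 0) : Fov B l z2 = Fov B l' z2 := by
  rw [Fov, Fov, hp.prod_eq, hp.length_eq, perm_invariant (f := fun l => ov B l z2)
    (fun A C a b ha hb => ov_swap_left B A C z2 ha hb) hp h0]

lemma Fov_perm_right (B : ℂ) (z1 : List ℂ) {l l' : List ℂ} (hp : l.Perm l')
    (h0 : ∀ a ∈ l, a ≠ 0) : Fov B z1 l = Fov B z1 l' := by
  rw [Fov, Fov, hp.prod_eq, hp.length_eq, perm_invariant (f := fun l => ov B z1 l)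
    (fun A C a b ha hb => ov_swap_right B z1 A C ha hb) hp h0]

lemma Fov_inv_left (B : ℂ) (z2 : List ℂ) (w : ℂ) (L : List ℂ) (hw : w ≠ 0) (hB : w ≠ B) :
    Fov B (w⁻¹ :: L) z2 = Fov B (w :: L) z2 := by
  have key : w ^ (2 * ((L.length + 1 + z2.length) / 2)) * ov B (w :: L) z2 =
      w ^ (2 * ((L.length + 1) / 2)) * ov B (w⁻¹ :: L) z2 := by
    simp only [ov, List.length_cons, sumS, ← sumS_add, ← sumS_mul]
    refine sumS_congr fun α hα => sumS_congr fun β hβ => ?_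
    have h := fun s => refl_left_bil B w hw hB (iv L ++ iv z2) L s (α ++ β) α
      (by simp [hα, hβ]) hα.symm
    simp only [List.length_append, iv_length, Nat.add_right_comm _ _ 1] at h
    simp only [iv_cons, inv_inv, List.cons_append]
    linear_combination Psi B z2 β * (h true + h false)
  simp only [Fov, List.length_cons, List.prod_cons]
  obtain ⟨k, hk⟩ : ∃ k, (L.length + 1 + z2.length) / 2 = (L.length + 1) / 2 + k :=
    Nat.exists_eq_add_of_le (by omega)
  rw [hk] at key ⊢
  rw [Nat.add_sub_cancel_left]
  generalize ov B (w :: L) z2 = x at *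
  generalize ov B (w⁻¹ :: L) z2 = y at *
  have key2 : w ^ (2 * k) * x = y := by
    apply mul_left_cancel₀ (pow_ne_zero (2 * ((L.length + 1) / 2)) hw)
    rw [← key]; ring
  rw [← key2, mul_pow, mul_pow, inv_pow, two_mul, pow_add]
  field_simp

lemma Fov_inv_right (B : ℂ) (z1 : List ℂ) (w : ℂ) (L : List ℂ) (hw : w ≠ 0) (hB : w ≠ om * B) :
    Fov B z1 (L ++ [w⁻¹]) = Fov B z1 (L ++ [w]) := by
  have key : w ^ (2 * ((z1.length + (L.length + 1)) / 2)) * ov B z1 (L ++ [w]) =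
      w ^ (2 * ((L.length + 1) / 2)) * ov B z1 (L ++ [w⁻¹]) := by
    simp only [ov, List.length_append, List.length_singleton, sumS_append, ← sumS_mul]
    refine sumS_congr fun α hα => sumS_congr fun β hβ => ?_
    have h := fun s => refl_right_bil B w hw hB (iv z1 ++ iv L) L s (α ++ β) β
      (by simp [hα, hβ]) hβ.symm
    simp only [List.length_append, iv_length, add_assoc, List.append_assoc] at h
    simp only [iv_append, iv_cons, iv_nil, inv_inv, sumS]
    linear_combination Psi B z1 α * (h true + h false)
  simp only [Fov, List.length_append, List.length_singleton, List.prod_append, List.prod_singleton]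
  obtain ⟨k, hk⟩ : ∃ k, (z1.length + (L.length + 1)) / 2 = (L.length + 1) / 2 + k :=
    Nat.exists_eq_add_of_le (by omega)
  rw [hk] at key ⊢
  rw [Nat.add_sub_cancel_left]
  generalize ov B z1 (L ++ [w]) = x at *
  generalize ov B z1 (L ++ [w⁻¹]) = y at *
  have key2 : w ^ (2 * k) * x = y := by
    apply mul_left_cancel₀ (pow_ne_zero (2 * ((L.length + 1) / 2)) hw)
    rw [← key]; ring
  rw [← key2, mul_pow, mul_pow, inv_pow, two_mul, pow_add]
  field_simp

lemma Fov_poly_left (B : ℂ) (L z2 : List ℂ) (h : (L.length + 1 + z2.length) % 2 = 1) :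
    ∃ g, PolyDeg (L.length + z2.length + L.length) g ∧ ∀ t, t ≠ 0 →
      t ^ ((L.length + 1 + z2.length) / 2 + (L.length + 1) / 2) * Fov B (t :: L) z2 = g t := by
  have hP : ∀ γ : List Bool, γ.length = L.length + 1 + z2.length →
      ∃ g, PolyDeg (L.length + z2.length) g ∧ ∀ t, t ≠ 0 →
        g t = t ^ (L.length + z2.length) * Psi B (t⁻¹ :: (iv L ++ iv z2)) γ := by
    intro γ hγ
    have := Psi_polyDeg B [] (iv L ++ iv z2) γ
    rw [hγ, show L.length + 1 + z2.length - 1 = L.length + z2.length by omega] at this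
    exact this.exists_rev
  choose! G hG1 hG2 using hP
  refine ⟨fun t => (L.prod ^ ((L.length + 1 + z2.length) / 2 - (L.length + 1) / 2) *
    z2.prod ^ ((L.length + 1 + z2.length) / 2 - z2.length / 2)) * sumS (L.length + 1) fun α =>
      sumS z2.length fun β => G (α ++ β) t * Psi B (t :: L) α * Psi B z2 β, ?_, ?_⟩
  · refine ((PolyDeg.const _).mul (sumS_polyDeg fun α hα => sumS_polyDeg fun β hβ => ?_)).mono
      (zero_add _).le
    refine (((hG1 _ (by simp [hα, hβ])).mul ?_).mul (PolyDeg.const _)).mono (add_zero _).le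
    have := Psi_polyDeg B [] L α
    rwa [hα] at this
  · intro t ht
    have e : sumS (L.length + 1) (fun α => sumS z2.length fun β => G (α ++ β) t * Psi B (t :: L) α *
        Psi B z2 β) = t ^ (L.length + z2.length) * ov B (t :: L) z2 := by
      simp only [ov, List.length_cons, ← sumS_mul]
      refine sumS_congr fun α hα => sumS_congr fun β hβ => ?_
      rw [hG2 _ (by simp [hα, hβ]) t ht, iv_cons, List.cons_append]
      ring
    simp only [e, Fov, List.length_cons, List.prod_cons, mul_pow]
    have : t ^ (L.length + z2.length) = t ^ ((L.length + 1 + z2.length) / 2 + (L.length + 1) / 2) *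
        t ^ ((L.length + 1 + z2.length) / 2 - (L.length + 1) / 2) := by
      rw [← pow_add]
      congr 1
      omega
    rw [this]
    ring

lemma Fov_poly_right (B : ℂ) (z1 L : List ℂ) (h : (z1.length + (L.length + 1)) % 2 = 1) :
    ∃ g, PolyDeg (L.length + z1.length + L.length) g ∧ ∀ t, t ≠ 0 →
      t ^ ((z1.length + (L.length + 1)) / 2 + (L.length + 1) / 2) * Fov B z1 (t :: L) = g t := by
  have hP : ∀ γ : List Bool, γ.length = z1.length + (L.length + 1) →
      ∃ g, PolyDeg (L.length + z1.length) g ∧ ∀ t, t ≠ 0 →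
        g t = t ^ (L.length + z1.length) * Psi B (iv z1 ++ t⁻¹ :: iv L) γ := by
    intro γ hγ
    have := Psi_polyDeg B (iv z1) (iv L) γ
    rw [hγ, show z1.length + (L.length + 1) - 1 = L.length + z1.length by omega] at this
    exact this.exists_rev
  choose! G hG1 hG2 using hP
  refine ⟨fun t => (z1.prod ^ ((z1.length + (L.length + 1)) / 2 - z1.length / 2) *
    L.prod ^ ((z1.length + (L.length + 1)) / 2 - (L.length + 1) / 2)) * sumS z1.length fun α =>
      sumS (L.length + 1) fun β => G (α ++ β) t * Psi B z1 α * Psi B (t :: L) β, ?_, ?_⟩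
  · refine ((PolyDeg.const _).mul (sumS_polyDeg fun α hα => sumS_polyDeg fun β hβ => ?_)).mono
      (zero_add _).le
    refine (((hG1 _ (by simp [hα, hβ])).mul (PolyDeg.const _)).mul ?_)
    have := Psi_polyDeg B [] L β
    rwa [hβ] at this
  · intro t ht
    have e : sumS z1.length (fun α => sumS (L.length + 1) fun β => G (α ++ β) t * Psi B z1 α *
        Psi B (t :: L) β) = t ^ (L.length + z1.length) * ov B z1 (t :: L) := by
      simp only [ov, List.length_cons, ← sumS_mul]
      refine sumS_congr fun α hα => sumS_congr fun β hβ => ?_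
      rw [hG2 _ (by simp [hα, hβ]) t ht, iv_cons]
      ring
    simp only [e, Fov, List.length_cons, List.prod_cons, mul_pow]
    have : t ^ (L.length + z1.length) =
        t ^ ((z1.length + (L.length + 1)) / 2 + (L.length + 1) / 2) *
        t ^ ((z1.length + (L.length + 1)) / 2 - (L.length + 1) / 2) := by
      rw [← pow_add]
      congr 1
      omega
    rw [this]
    ring

end QKZ

namespace QKZ
open MvPolynomial

/-- The scalar factor of the reduction at `z, q z` in terms of the remaining length. -/
def redC (B z : ℂ) (m : ℕ) : ℂ :=
  (B - z) * (-om) ^ (m / 2) * om ^ (m - m / 2) * (if m % 2 = 0 then om * z else 1)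

lemma Psi_reduce' (B : ℂ) {A : List ℂ} {α : List Bool} (h : A.length = α.length) {z : ℂ}
    (hz : z ≠ 0) {C : List ℂ} {β : List Bool} (h' : C.length = β.length) :
    Psi B (A ++ z :: (om * z) :: C) (α ++ true :: false :: β) =
      redC B z (A.length + C.length) * pairW z (A ++ C) * Psi B (A ++ C) (α ++ β) := by
  rw [Psi_reduce B h hz h']
  by_cases c : (α ++ β).count true = (α ++ β).length / 2
  · have c' : (α ++ β).count false = (α ++ β).length - (α ++ β).length / 2 := by
      have := List.count_false_add_count_true (α ++ β)
      omega
    have hl : (α ++ β).length = A.length + C.length := by simp [h, h']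
    rw [redQ, c, c', redC, hl]
    congr 3
    refine if_congr ?_ rfl rfl
    omega
  · rw [Psi_eq_zero' B _ _ c]; ring

lemma om_inv : om⁻¹ = om ^ 2 := by
  refine inv_eq_of_mul_eq_one_right ?_
  rw [← pow_succ', om_cube]

lemma bil_pair (B : ℂ) {A1 A2 : List ℂ} {α1 α2 : List Bool} (h1 : A1.length = α1.length)
    (h2 : A2.length = α2.length) {z : ℂ} (hz : z ≠ 0) (C1 C2 : List ℂ)
    (γ1 γ2 : List Bool) (h1' : C1.length = γ1.length) (h2' : C2.length = γ2.length) :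
    let f := fun (s t : Bool) => Psi B (A1 ++ z⁻¹ :: (om * z)⁻¹ :: C1) (α1 ++ s :: t :: γ1) *
      Psi B (A2 ++ z :: (om * z) :: C2) (α2 ++ s :: t :: γ2)
    f true true + f true false + (f false true + f false false) =
      -om * (redC B (om * z)⁻¹ (A1.length + C1.length) * pairW (om * z)⁻¹ (A1 ++ C1)) *
        (redC B z (A2.length + C2.length) * pairW z (A2 ++ C2)) *
        (Psi B (A1 ++ C1) (α1 ++ γ1) * Psi B (A2 ++ C2) (α2 ++ γ2)) := by
  intro f
  have hu : (om * z)⁻¹ ≠ 0 := inv_ne_zero (mul_ne_zero om_ne_zero hz)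
  have hd : ∀ s, f s s = 0 := fun s => by
    simp only [f]; rw [Psi_pair_diag B h2 hz, mul_zero]
  have e : z⁻¹ = om * (om * z)⁻¹ := by
    have := om_ne_zero
    field_simp
  have k := Psi_contract B h1 hu C1 γ1
  rw [← e] at k
  rw [e, Psi_reduce' B h1 hu h1', ← e] at k
  rw [hd, hd]
  simp only [f]
  rw [Psi_pair_singlet B h2 hz, Psi_reduce' B h2 hz h2']
  linear_combination (redC B z (A2.length + C2.length) * pairW z (A2 ++ C2)
    * Psi B (A2 ++ C2) (α2 ++ γ2)) * k

lemma ov_pair_left (B : ℂ) {z : ℂ} (hz : z ≠ 0) (L z2 : List ℂ) :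
    ov B (z :: (om * z) :: L) z2 =
      -om * (redC B (om * z)⁻¹ (L.length + z2.length) * pairW (om * z)⁻¹ (iv L ++ iv z2)) *
        (redC B z L.length * pairW z L) * ov B L z2 := by
  have hl : (z :: (om * z) :: L).length = 0 + (L.length + 2) := by simp
  simp only [ov, hl, sumS_pair]
  simp only [sumS, List.nil_append, ← sumS_add]
  rw [← sumS_mul]
  refine sumS_congr fun γ hγ => ?_
  rw [← sumS_mul]
  refine sumS_congr fun β hβ => ?_
  have := bil_pair B (A1 := []) (A2 := []) (α1 := []) (α2 := []) rfl rfl hz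
    (iv L ++ iv z2) L (γ ++ β) γ (by simp [hγ, hβ]) hγ.symm
  simp only [iv_cons, List.nil_append, List.cons_append, List.length_append, iv_length,
    List.length_nil, zero_add] at this ⊢
  linear_combination Psi B z2 β * this

lemma ov_pair_right (B : ℂ) {z : ℂ} (hz : z ≠ 0) (z1 L : List ℂ) :
    ov B z1 (z :: (om * z) :: L) =
      -om * (redC B (om * z)⁻¹ (z1.length + L.length) * pairW (om * z)⁻¹ (iv z1 ++ iv L)) *
        (redC B z L.length * pairW z L) * ov B z1 L := by
  have hl : (z :: (om * z) :: L).length = 0 + (L.length + 2) := by simp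
  simp only [ov, hl, sumS_pair]
  simp only [sumS, List.nil_append]
  rw [← sumS_mul]
  refine sumS_congr fun α hα => ?_
  rw [← sumS_mul]
  refine sumS_congr fun γ hγ => ?_
  have := bil_pair B (A1 := iv z1) (A2 := []) (α1 := α) (α2 := []) (by simp [hα]) rfl hz
    (iv L) L γ γ (by simp [hγ]) hγ.symm
  simp only [iv_cons, List.nil_append, iv_length,
    List.length_nil, zero_add] at this ⊢
  linear_combination Psi B z1 α * this

/-- The invariant variable `z + z⁻¹`. -/
def xx (z : ℂ) : ℂ := z + z⁻¹

lemma pairW_eq {z : ℂ} (hz : z ≠ 0) (L : List ℂ) (hL : ∀ a ∈ L, a ≠ 0) :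
    pairW z L = L.prod * z ^ L.length * (L.map fun r => xx r - xx (om ^ 2 * z)).prod := by
  induction L with
  | nil => simp [pairW]
  | cons a L ih =>
    have ha := hL a (by simp)
    rw [pairW_cons, ih fun b hb => hL b (by simp [hb])]
    have e : (a - om ^ 2 * z) * (a * z - om) = a * z * (xx a - xx (om ^ 2 * z)) := by
      simp only [xx, mul_inv, ← inv_pow, om_inv]
      have hq := om_sq
      field_simp
      clear * - hq
      grind
    rw [e]
    simp only [List.prod_cons, List.length_cons, List.map_cons]
    ring

lemma iv_prod (L : List ℂ) : (iv L).prod = L.prod⁻¹ := by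
  induction L with
  | nil => simp
  | cons a L ih => rw [iv_cons, List.prod_cons, ih, List.prod_cons, mul_inv]

lemma pairW_iv {z : ℂ} (hz : z ≠ 0) (L : List ℂ) (hL : ∀ a ∈ L, a ≠ 0) :
    pairW (om * z)⁻¹ (iv L) = (L.prod)⁻¹ * (om ^ 2) ^ L.length * (z ^ L.length)⁻¹ *
      (L.map fun r => xx r - xx (om ^ 2 * z)).prod := by
  rw [pairW_eq (inv_ne_zero (mul_ne_zero om_ne_zero hz)) _ (by
    intro a ha
    obtain ⟨b, hb, rfl⟩ := List.mem_map.1 ha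
    exact inv_ne_zero (hL b hb)), iv_prod, iv_length]
  have e : (iv L).map (fun r => xx r - xx (om ^ 2 * (om * z)⁻¹)) =
      L.map (fun r => xx r - xx (om ^ 2 * z)) := by
    rw [iv, List.map_map]
    refine List.map_congr_left fun a _ => ?_
    have hq := om_sq
    have h3 := om_cube
    have : om ^ 2 * (om * z)⁻¹ = (om ^ 2 * z)⁻¹ := by
      have := om_ne_zero
      field_simp
      exact h3
    simp only [Function.comp, this, xx, inv_inv]
    ring
  rw [e, mul_inv, om_inv, mul_pow, inv_pow]
  ring

lemma xx_boundary {B z : ℂ} (hB : B ≠ 0) (hz : z ≠ 0) :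
    (B - z) * (B - (om * z)⁻¹) = om * B * (xx (om ^ 2 * B) - xx (om ^ 2 * z)) := by
  simp only [xx, mul_inv, ← inv_pow, om_inv]
  have hq := om_sq
  field_simp
  clear * - hq
  grind

/-- The constant of proportionality in the product formula for the overlap. -/
def cst (B : ℂ) (n1 n2 : ℕ) : ℂ :=
  B ^ (n1 + n2) * (-om) ^ (n1 * n1 + 2 * n1 + (n2 * n2 + 2 * n2) + n1 * n2)

lemma om_pow_add (k j : ℕ) : om ^ (k + 3 * j) = om ^ k := by
  rw [pow_add, pow_mul, om_cube, one_pow, mul_one]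

lemma pair_arith (B z P1 P2 Q1 Q2 Y o : ℂ) (hz : z ≠ 0) (hP1 : P1 ≠ 0) (hP2 : P2 ≠ 0)
    (hY : (B - z) * (B - (om * z)⁻¹) = om * B * Y) (l m : ℕ) (h : (l + m) % 2 = 1) :
    (z * (om * z * P1)) ^ ((l + 2 + m) / 2 - (l + 2) / 2) * P2 ^ ((l + 2 + m) / 2 - m / 2) *
      (-om * (redC B (om * z)⁻¹ (l + m) * ((P1 * P2)⁻¹ * (om ^ 2) ^ (l + m) *
        (z ^ (l + m))⁻¹ * (Q1 * Q2))) * (redC B z l * (P1 * z ^ l * Q1)) * o) =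
    -B * (-om) ^ ((l + m) / 2 + l / 2) * (Q1 ^ 2 * Q2 * Y) *
      (P1 ^ ((l + m) / 2 - l / 2) * P2 ^ ((l + m) / 2 - m / 2) * o) := by
  have hom := om_ne_zero
  have e1 : (l + 2 + m) / 2 - (l + 2) / 2 = (l + m) / 2 - l / 2 := by omega
  have e2 : (l + 2 + m) / 2 - m / 2 = (l + m) / 2 - m / 2 + 1 := by omega
  rw [e1, e2]
  simp only [redC, h]
  rcases Nat.even_or_odd' l with ⟨a, rfl | rfl⟩
  · obtain ⟨b, rfl⟩ : ∃ b, m = 2 * b + 1 := ⟨m / 2, by omega⟩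
    rw [show (2 * a + (2 * b + 1)) / 2 = a + b by omega, show 2 * a / 2 = a by omega,
      show (2 * b + 1) / 2 = b by omega, show a + b - a = b by omega, show a + b - b = a by omega,
      show 2 * a + (2 * b + 1) - (a + b) = a + b + 1 by omega, show 2 * a - a = a by omega]
    have k := om_pow_add 0 (2 * a + 2 * b + 2)
    generalize B - (om * z)⁻¹ = G at *
    generalize B - z = H at *
    simp only [neg_pow om, mul_pow, Nat.mul_mod_right, one_ne_zero, if_true,
      if_false, pow_add, pow_mul] at k ⊢
    field_simp
    ring_nf at k ⊢
    linear_combination (exp := 1) (-((z ^ b)^2 * Q1 ^ 2 * Q2 * o * (om ^ a) ^ 6 * (om ^ b) ^ 6 * om ^ 5)) * hY - z ^ (2*b) * Q1 ^ 2 * Q2 * o * B * Y * k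
  · obtain ⟨b, rfl⟩ : ∃ b, m = 2 * b := ⟨m / 2, by omega⟩
    rw [show (2 * a + 1 + 2 * b) / 2 = a + b by omega, show (2 * a + 1) / 2 = a by omega,
      show 2 * b / 2 = b by omega, show a + b - a = b by omega, show a + b - b = a by omega,
      show 2 * a + 1 + 2 * b - (a + b) = a + b + 1 by omega, show 2 * a + 1 - a = a + 1 by omega]
    have k := om_pow_add 0 (2 * a + 2 * b + 2)
    generalize B - (om * z)⁻¹ = G at *
    generalize B - z = H at *
    simp only [neg_pow om, mul_pow, one_ne_zero, Nat.mul_add_mod_self_left,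
      Nat.reduceMod, if_false, pow_add, pow_mul] at k ⊢
    field_simp
    ring_nf at k ⊢
    linear_combination (exp := 1) (-((z ^ b)^2 * Q1 ^ 2 * Q2 * o * (om ^ a) ^ 6 * (om ^ b) ^ 6 * om ^ 5)) * hY - z ^ (2*b) * Q1 ^ 2 * Q2 * o * B * Y * k

lemma Fov_pair_left {B z : ℂ} (hB : B ≠ 0) (hz : z ≠ 0) (L z2 : List ℂ) (hL : ∀ a ∈ L, a ≠ 0)
    (h2 : ∀ a ∈ z2, a ≠ 0) (h : (L.length + z2.length) % 2 = 1) :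
    Fov B (z :: (om * z) :: L) z2 =
      -B * (-om) ^ ((L.length + z2.length) / 2 + L.length / 2) *
        ((L.map fun r => xx r - xx (om ^ 2 * z)).prod ^ 2 *
        (z2.map fun r => xx r - xx (om ^ 2 * z)).prod * (xx (om ^ 2 * B) - xx (om ^ 2 * z))) *
        Fov B L z2 := by
  have := pair_arith B z L.prod z2.prod (L.map fun r => xx r - xx (om ^ 2 * z)).prod
    (z2.map fun r => xx r - xx (om ^ 2 * z)).prod _ (ov B L z2) hz
    (List.prod_ne_zero fun k => hL 0 k rfl) (List.prod_ne_zero fun k => h2 0 k rfl)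
    (xx_boundary hB hz) L.length z2.length h
  rw [Fov, Fov, ov_pair_left B hz, pairW_append, pairW_iv hz L hL, pairW_iv hz z2 h2,
    pairW_eq hz L hL]
  simp only [List.prod_cons, List.length_cons]
  refine Eq.trans ?_ this
  rw [mul_inv, pow_add _ L.length, pow_add _ L.length, mul_inv]
  ring

lemma Fov_pair_right {B z : ℂ} (hB : B ≠ 0) (hz : z ≠ 0) (z1 L : List ℂ) (hL : ∀ a ∈ L, a ≠ 0)
    (h1 : ∀ a ∈ z1, a ≠ 0) (h : (z1.length + L.length) % 2 = 1) :
    Fov B z1 (z :: (om * z) :: L) =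
      -B * (-om) ^ ((z1.length + L.length) / 2 + L.length / 2) *
        ((L.map fun r => xx r - xx (om ^ 2 * z)).prod ^ 2 *
        (z1.map fun r => xx r - xx (om ^ 2 * z)).prod * (xx (om ^ 2 * B) - xx (om ^ 2 * z))) *
        Fov B z1 L := by
  have := pair_arith B z L.prod z1.prod (L.map fun r => xx r - xx (om ^ 2 * z)).prod
    (z1.map fun r => xx r - xx (om ^ 2 * z)).prod _ (ov B z1 L) hz
    (List.prod_ne_zero fun k => hL 0 k rfl) (List.prod_ne_zero fun k => h1 0 k rfl)
    (xx_boundary hB hz) L.length z1.length (by omega)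
  rw [Fov, Fov, ov_pair_right B hz, pairW_append, pairW_iv hz L hL, pairW_iv hz z1 h1,
    pairW_eq hz L hL]
  simp only [List.prod_cons, List.length_cons, Nat.add_comm z1.length]
  refine Eq.trans ?_ (this.trans ?_)
  · rw [mul_inv, pow_add _ L.length, pow_add _ L.length, mul_inv]
    ring
  · ring

end QKZ

namespace QKZ
open Polynomial Matrix

/-- The alternant `det f_j(v_i)`. -/
def alt {n : ℕ} (f : ℕ → ℂ → ℂ) (v : Fin n → ℂ) : ℂ := det (of fun i j : Fin n => f j (v i))

lemma perm_equiv {l l' : List ℂ} (h : l.Perm l') :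
    ∃ e : Fin l.length ≃ Fin l'.length, ∀ i, l.get i = l'.get (e i) := by
  induction h with
  | nil => exact ⟨Equiv.refl _, fun _ => rfl⟩
  | cons x _ ih =>
    obtain ⟨e, he⟩ := ih
    refine ⟨(finSuccEquiv _).trans (e.optionCongr.trans (finSuccEquiv _).symm), fun i => ?_⟩
    refine Fin.cases ?_ (fun i => ?_) i
    · rfl
    · simp only [Equiv.trans_apply, finSuccEquiv_succ, Equiv.optionCongr_apply, Option.map_some,
        finSuccEquiv_symm_some]
      exact he i
  | swap x y l =>
    refine ⟨Equiv.swap (0 : Fin (l.length + 2)) 1, fun i => ?_⟩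
    refine Fin.cases ?_ (fun i => Fin.cases ?_ (fun i => ?_) i) i
    · change y = (x :: y :: l).get (Equiv.swap (0 : Fin (l.length + 2)) 1 0)
      rw [Equiv.swap_apply_left]; rfl
    · change x = (x :: y :: l).get (Equiv.swap (0 : Fin (l.length + 2)) 1 1)
      rw [Equiv.swap_apply_right]; rfl
    · change l.get i = (x :: y :: l).get (Equiv.swap (0 : Fin (l.length + 2)) 1 i.succ.succ)
      rw [Equiv.swap_apply_of_ne_of_ne (Fin.succ_ne_zero _) (by simp [Fin.ext_iff])]; rfl
  | trans _ _ ih1 ih2 =>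
    obtain ⟨e1, h1⟩ := ih1
    obtain ⟨e2, h2⟩ := ih2
    exact ⟨e1.trans e2, fun i => (h1 i).trans (h2 _)⟩

lemma alt_perm {l l' : List ℂ} (h : l.Perm l') :
    ∃ ε : ℂ, ε ≠ 0 ∧ ∀ f, alt f l.get = ε * alt f l'.get := by
  obtain ⟨e, he⟩ := perm_equiv h
  let c : Fin l.length ≃ Fin l'.length := finCongr h.length_eq
  refine ⟨((Equiv.Perm.sign (e.trans c.symm) : ℤˣ) : ℤ), ?_, fun f => ?_⟩
  · rw [Int.cast_ne_zero]
    exact Units.ne_zero _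
  · have := det_permute (e.trans c.symm)
      ((of fun i j : Fin l'.length => f j (l'.get i)).submatrix c c)
    rw [det_submatrix_equiv_self] at this
    rw [alt, alt, ← this]
    congr 1
    ext i j
    simp only [of_apply, submatrix_apply, id, he, Equiv.trans_apply, Equiv.apply_symm_apply]
    rfl

/-- The Vandermonde product. -/
def vdm {n : ℕ} (v : Fin n → ℂ) : ℂ := alt (fun j x => x ^ j) v

lemma vdm_eq {n : ℕ} (v : Fin n → ℂ) : vdm v = ∏ i, ∏ j ∈ Finset.Ioi i, (v j - v i) :=
  det_vandermonde v

lemma vdm_cons {n : ℕ} (v : Fin (n + 1) → ℂ) :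
    vdm v = (∏ i : Fin n, (v i.succ - v 0)) * vdm fun i : Fin n => v i.succ := by
  rw [vdm_eq, vdm_eq, Fin.prod_univ_succ, Fin.prod_Ioi_zero]
  simp_rw [Fin.prod_Ioi_succ]

lemma vdm_ne_zero {n : ℕ} {v : Fin n → ℂ} : vdm v ≠ 0 ↔ Function.Injective v :=
  det_vandermonde_ne_zero_iff

lemma vdm_list_ne_zero {l : List ℂ} (h : l.Nodup) : vdm l.get ≠ 0 :=
  vdm_ne_zero.2 (List.nodup_iff_injective_get.1 h)

lemma vdm_list_cons (a : ℂ) (l : List ℂ) :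
    vdm (a :: l).get = (l.map fun b => b - a).prod * vdm l.get := by
  rw [show vdm (a :: l).get = _ from vdm_cons (n := l.length) (a :: l).get]
  congr 1
  rw [← List.prod_ofFn]
  congr 1
  refine List.ext_get (by simp) fun n h1 h2 => ?_
  simp
  rfl

/-- `X³ - 3X`. -/
def tt (X : ℂ) : ℂ := X ^ 3 - 3 * X

/-- The functions `1, X, T, XT, T², …`. -/
def phi (j : ℕ) (X : ℂ) : ℂ := tt X ^ (j / 2) * X ^ (j % 2)

/-- The symmetric function `det φ_j(X_i) / det X_i^j`. -/
def SS (l : List ℂ) : ℂ := alt phi l.get / vdm l.get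

lemma SS_perm {l l' : List ℂ} (h : l.Perm l') : SS l = SS l' := by
  obtain ⟨ε, hε, h⟩ := alt_perm h
  rw [SS, SS, vdm, vdm, h, h, mul_div_mul_left _ _ hε]

/-- `φ_j` as a polynomial. -/
def phiP (j : ℕ) : ℂ[X] := (X ^ 3 - C 3 * X) ^ (j / 2) * X ^ (j % 2)

lemma phiP_eval (j : ℕ) (x : ℂ) : (phiP j).eval x = phi j x := by
  simp [phiP, phi, tt]

lemma phiP_natDegree (j : ℕ) : (phiP j).natDegree ≤ 3 * (j / 2) + j % 2 := by
  unfold phiP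
  compute_degree
  omega

lemma alt_cons_poly (l : List ℂ) :
    ∃ p : ℂ[X], p.natDegree ≤ 3 * (l.length / 2) + l.length % 2 ∧
      ∀ x, alt phi (x :: l).get = p.eval x := by
  refine ⟨∑ j : Fin (l.length + 1), phiP j * C ((-1) ^ (j : ℕ) *
    det ((of fun i j : Fin (l.length + 1) => phi j ((0 :: l).get i)).submatrix
      Fin.succ j.succAbove)), ?_, fun x => ?_⟩
  · refine natDegree_sum_le_of_forall_le _ _ fun j _ => ?_
    refine (natDegree_mul_C_le _ _).trans ((phiP_natDegree _).trans ?_)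
    have := j.2
    omega
  · rw [alt]
    refine (det_succ_row_zero (n := l.length) _).trans ?_
    rw [eval_finsetSum]
    refine Finset.sum_congr rfl fun j _ => ?_
    rw [eval_mul, eval_C, phiP_eval]
    simp only [of_apply]
    change (-1) ^ (j : ℕ) * phi j x * _ = _
    rw [mul_left_comm, ← mul_assoc]
    rfl

lemma SS_poly {l : List ℂ} (h : l.Nodup) :
    ∃ r : ℂ[X], r.natDegree ≤ l.length / 2 ∧ ∀ x, x ∉ l → SS (x :: l) = r.eval x := by
  obtain ⟨p, hp, he⟩ := alt_cons_poly l
  have hroot : ∀ x ∈ l, p.IsRoot x := by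
    intro x hx
    obtain ⟨i, rfl⟩ := List.get_of_mem hx
    rw [IsRoot.def, ← he]
    refine det_zero_of_row_eq (i := (0 : Fin (l.length + 1))) (j := i.succ)
      (Fin.succ_ne_zero _).symm ?_
    rfl
  have hdvd : (l.map fun a => X - C a).prod ∣ p := by
    by_cases h0 : p = 0
    · rw [h0]; exact dvd_zero _
    have := (Multiset.prod_X_sub_C_dvd_iff_le_roots h0 (l : Multiset ℂ)).2 (by
      rw [Multiset.le_iff_subset (by simpa using h)]
      intro x hx
      exact (mem_roots h0).2 (hroot x (by simpa using hx)))
    simpa using this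
  obtain ⟨r, rfl⟩ := hdvd
  have hmon : ((l.map fun a => X - C a).prod).Monic := by
    simpa using monic_multiset_prod_of_monic (l : Multiset ℂ) (fun a => X - C a)
      fun a _ => monic_X_sub_C a
  have hdeg : ((l.map fun a => X - C a).prod).natDegree = l.length := by
    have := natDegree_multiset_prod_X_sub_C_eq_card (l : Multiset ℂ)
    simpa using this
  refine ⟨r * C (((-1) ^ l.length * vdm l.get)⁻¹), ?_, fun x hx => ?_⟩
  · by_cases h0 : r = 0
    · simp [h0]
    rw [hmon.natDegree_mul' h0, hdeg] at hp
    have := natDegree_mul_C_le r ((-1) ^ l.length * vdm l.get)⁻¹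
    omega
  · have e : eval x (l.map fun a => X - C a).prod =
        (-1) ^ l.length * (l.map fun b => b - x).prod := by
      clear * -
      induction l with
      | nil => simp
      | cons a l ih =>
        rw [List.map_cons, List.prod_cons, eval_mul, ih, List.map_cons, List.prod_cons]
        simp only [eval_sub, eval_X, eval_C, List.length_cons]
        ring
    have h1 : (l.map fun b => b - x).prod ≠ 0 := by
      rw [Ne, List.prod_eq_zero_iff, List.mem_map]
      rintro ⟨a, ha, h⟩
      exact hx (by rwa [← sub_eq_zero.1 h])
    have h2 := vdm_list_ne_zero h
    rw [SS, he, vdm_list_cons, eval_mul, eval_mul, eval_C, e]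
    field_simp
    rw [← pow_mul, mul_comm l.length, pow_mul]
    norm_num

/-- One reduction step for the alternant of `φ`. -/
lemma alt_pair {x y : ℂ} (h : tt x = tt y) (l : List ℂ) :
    alt phi (x :: y :: l).get = (y - x) * (l.map fun a => tt a - tt x).prod * alt phi l.get := by
  set n := l.length with hn
  let e : Fin 2 ⊕ Fin n ≃ Fin (n + 2) := finSumFinEquiv.trans (finCongr (Nat.add_comm 2 n))
  let v : Fin (n + 2) → ℂ := (x :: y :: l).get
  let U : Matrix (Fin (n + 2)) (Fin (n + 2)) ℂ :=
    of fun k j => if k = j then 1 else if k.1 + 2 = j.1 then -tt x else 0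
  let M : Matrix (Fin (n + 2)) (Fin (n + 2)) ℂ := of fun i j => phi j (v i)
  have hU : U.det = 1 := by
    rw [det_of_isUpperTriangular]
    · simp [U]
    · intro i j hij
      have hij : j < i := hij
      simp only [U, of_apply]
      rw [if_neg hij.ne', if_neg (by have := Fin.lt_def.1 hij; omega)]
  have hv2 : ∀ k : Fin n, v k.succ.succ = l.get k := fun k => rfl
  have hMU : (M * U).submatrix e e = fromBlocks
      (of fun i j : Fin 2 => phi j (if i = 0 then x else y)) 0
      (of fun (i : Fin n) (j : Fin 2) => phi j (l.get i))
      (of fun (i j : Fin n) => (tt (l.get i) - tt x) * phi j (l.get i)) := by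
    have er : ∀ k : Fin n, e (Sum.inr k) = k.succ.succ := fun k => by
      ext; simp [e]
    have el0 : e (Sum.inl 0) = 0 := by ext; simp [e]
    have el1 : e (Sum.inl 1) = 1 := by ext; simp [e]
    have c0 : ∀ i, (M * U) i 0 = 1 := fun i => by
      rw [mul_apply, Finset.sum_eq_single 0]
      · simp [M, U, phi]
      · intro k _ hk
        simp [U, hk]
      · simp
    have c1 : ∀ i, (M * U) i 1 = v i := fun i => by
      rw [mul_apply, Finset.sum_eq_single 1]
      · simp [M, U, phi]
      · intro k _ hk
        simp [U, hk]
      · simp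
    have c2 : ∀ i (j : Fin n), (M * U) i j.succ.succ = (tt (v i) - tt x) * phi j (v i) := by
      intro i j
      have hne : (⟨j.1, by omega⟩ : Fin (n + 2)) ≠ j.succ.succ := by
        simp only [Ne, Fin.ext_iff, Fin.val_succ]; omega
      rw [mul_apply, ← Finset.sum_subset (Finset.subset_univ {⟨j.1, by omega⟩, j.succ.succ})]
      · rw [Finset.sum_pair hne]
        simp only [M, U, of_apply, if_neg hne, Fin.val_succ, if_true, phi]
        rw [show (j.1 + 1 + 1) / 2 = j.1 / 2 + 1 by omega,
          show (j.1 + 1 + 1) % 2 = j.1 % 2 by omega]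
        ring
      · intro k _ hk
        simp only [Finset.mem_insert, Finset.mem_singleton, not_or] at hk
        simp only [U, of_apply, if_neg hk.2]
        rw [if_neg, mul_zero]
        intro h
        apply hk.1
        ext
        simpa using h
    ext i j
    rw [submatrix_apply]
    rcases i with i | i <;> rcases j with j | j
    · fin_cases i <;> fin_cases j <;> simp [el0, el1, c0, c1, phi, v]
    · fin_cases i
      · simp [el0, er, c2, v]
      · simp [el1, er, c2, v, h]
    · fin_cases j
      · simp [el0, c0, phi]
      · simp [el1, c1, phi, er, hv2]
    · simp [er, c2, hv2]
  have hM : alt phi (x :: y :: l).get = ((M * U).submatrix e e).det := by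
    rw [det_submatrix_equiv_self, det_mul, hU, mul_one]; rfl
  rw [hM, hMU, det_fromBlocks_zero₁₂]
  have hp : (l.map fun a => tt a - tt x).prod = ∏ i : Fin n, (tt (l.get i) - tt x) := by
    rw [← List.prod_ofFn]
    congr 1
    exact List.ext_get (by simp [hn]) fun k h1 h2 => by simp
  rw [hp, alt]
  have hc := det_mul_column (fun i : Fin n => tt (l.get i) - tt x)
    (of fun i j : Fin n => phi j (l.get i))
  simp only [of_apply] at hc
  have h2 : det (of fun i j : Fin 2 => phi j (if i = 0 then x else y)) = y - x := by
    rw [det_fin_two]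
    simp [phi]
  rw [hc, h2, mul_assoc]

lemma SS_pair {z : ℂ} (hz : z ≠ 0) {l : List ℂ}
    (h : (xx z :: xx (om * z) :: l).Nodup) :
    SS (xx z :: xx (om * z) :: l) = (l.map fun a => a - xx (om ^ 2 * z)).prod * SS l := by
  have hq := om_sq
  have h3 := om_cube
  have htt : ∀ w : ℂ, w ≠ 0 → tt (xx w) = w ^ 3 + (w ^ 3)⁻¹ := fun w hw => by
    simp only [tt, xx]; field_simp; ring
  have hom := om_ne_zero
  have e1 : tt (xx z) = tt (xx (om * z)) := by
    rw [htt _ hz, htt _ (mul_ne_zero hom hz), mul_pow, h3, one_mul]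
  have e2 : ∀ a, tt a - tt (xx z) = (a - xx z) * (a - xx (om * z)) * (a - xx (om ^ 2 * z)) := by
    intro a
    have hi := om_inv
    simp only [tt, xx, mul_inv, ← inv_pow, hi]
    generalize hw : z⁻¹ = w
    have : z * w = 1 := by rw [← hw, mul_inv_cancel₀ hz]
    clear * - hq this
    grind
  have e3 : (l.map fun a => tt a - tt (xx z)).prod = (l.map fun a => a - xx z).prod *
      (l.map fun a => a - xx (om * z)).prod * (l.map fun a => a - xx (om ^ 2 * z)).prod := by
    simp only [e2, List.prod_map_mul]
  have hl : l.Nodup := (List.nodup_cons.1 (List.nodup_cons.1 h).2).2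
  have h0 := vdm_list_ne_zero h
  have h1 := vdm_list_ne_zero hl
  rw [SS, SS, alt_pair e1, e3]
  rw [vdm_list_cons, vdm_list_cons, List.map_cons, List.prod_cons] at h0 ⊢
  have k1 := left_ne_zero_of_mul (left_ne_zero_of_mul h0)
  have k2 := right_ne_zero_of_mul (left_ne_zero_of_mul h0)
  have k3 := left_ne_zero_of_mul (right_ne_zero_of_mul h0)
  field_simp

end QKZ

namespace QKZ
open Polynomial

/-- The excluded values attached to the boundary parameter. -/
def bS (B : ℂ) : Finset ℂ :=
  {B, om * B, om ^ 2 * B, B⁻¹, om * B⁻¹, om ^ 2 * B⁻¹}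

lemma mem_bS {B a : ℂ} : a ∈ bS B ↔ a = B ∨ a = om * B ∨ a = om ^ 2 * B ∨
    a = B⁻¹ ∨ a = om * B⁻¹ ∨ a = om ^ 2 * B⁻¹ := by simp [bS]

lemma om_mul_mem {B a : ℂ} (h : om * a ∈ bS B) : a ∈ bS B := by
  have h3 := om_cube
  have key : ∀ {x y : ℂ}, om * x = om * y → x = y := fun h => mul_left_cancel₀ om_ne_zero h
  rw [mem_bS] at h ⊢
  rcases h with h | h | h | h | h | h
  · right; right; left; apply key; linear_combination h - B * h3
  · left; exact key h
  · right; left; apply key; linear_combination h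
  · right; right; right; right; right; apply key; linear_combination h - B⁻¹ * h3
  · right; right; right; left; exact key h
  · right; right; right; right; left; apply key; linear_combination h

lemma om_sq_mul_mem {B a : ℂ} (h : om ^ 2 * a ∈ bS B) : a ∈ bS B := by
  rw [pow_two, mul_assoc] at h
  exact om_mul_mem (om_mul_mem h)

/-- Genericity of a list of spectral parameters. -/
def Gd (B : ℂ) (l : List ℂ) : Prop := (∀ a ∈ l, Unram a ∧ a ∉ bS B) ∧ l.Pairwise Gen

lemma Gd.perm {B : ℂ} {l l' : List ℂ} (h : Gd B l) (hp : l.Perm l') : Gd B l' :=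
  ⟨fun a ha => h.1 a (hp.mem_iff.2 ha), (hp.pairwise_iff fun h => h.symm).1 h.2⟩

lemma Gd.sublist {B : ℂ} {l l' : List ℂ} (h : Gd B l) (hp : l'.Sublist l) : Gd B l' :=
  ⟨fun a ha => h.1 a (hp.subset ha), h.2.sublist hp⟩

lemma xx_inv (a : ℂ) : xx a⁻¹ = xx a := by simp [xx, add_comm]

lemma xx_eq {a b : ℂ} (ha : a ≠ 0) (hb : b ≠ 0) (h : xx a = xx b) : a = b ∨ a * b = 1 := by
  simp only [xx] at h
  field_simp at h
  have : (a - b) * (a * b - 1) = 0 := by linear_combination h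
  rcases mul_eq_zero.1 this with h | h
  · exact Or.inl (sub_eq_zero.1 h)
  · exact Or.inr (sub_eq_zero.1 h)

lemma Gen.xx_ne {a b : ℂ} (ha : a ≠ 0) (hb : b ≠ 0) (h : Gen a b) : xx a ≠ xx b := fun e =>
  (xx_eq ha hb e).elim h.1 h.2.2.2.1

lemma xx_ne_boundary {B a : ℂ} (hB : B ≠ 0) (ha : a ≠ 0) (h : a ∉ bS B) :
    xx a ≠ xx (om ^ 2 * B) := fun e => by
  apply h
  rw [mem_bS]
  rcases xx_eq ha (mul_ne_zero (pow_ne_zero 2 om_ne_zero) hB) e with h | h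
  · exact Or.inr (Or.inr (Or.inl h))
  · right; right; right; right; left
    rw [eq_mul_inv_iff_mul_eq₀ hB]
    linear_combination om * h - a * B * om_cube

lemma Gd.nodup {B : ℂ} {l : List ℂ} (h : Gd B l) : (l.map xx).Nodup := by
  refine List.pairwise_map.2 (List.Pairwise.imp_of_mem (fun ha hb hab => ?_) h.2)
  exact hab.xx_ne (h.1 _ ha).1.1 (h.1 _ hb).1.1

lemma Gd.nodup' {B : ℂ} (hB : B ≠ 0) {l : List ℂ} (h : Gd B l) :
    (xx (om ^ 2 * B) :: l.map xx).Nodup := by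
  refine List.nodup_cons.2 ⟨fun hm => ?_, h.nodup⟩
  obtain ⟨a, ha, e⟩ := List.mem_map.1 hm
  exact xx_ne_boundary hB (h.1 a ha).1.1 (h.1 a ha).2 e

/-- A value is admissible relative to `l` if it avoids the boundary values and the variables `l`
up to inversion. -/
lemma xx_root {B s c : ℂ} {R : List ℂ} (hB : B ≠ 0) (h : Gd B (s :: R)) (hc : c = om ∨ c = om ^ 2) :
    xx (c * s) ∉ xx (om ^ 2 * B) :: (s :: R).map xx := by
  obtain ⟨h1, h2⟩ := h
  obtain ⟨⟨hs0, hs1, hs2, hs3⟩, hsB⟩ := h1 s (by simp)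
  have h3 := om_cube
  have hc0 : c ≠ 0 := by
    rcases hc with rfl | rfl
    exacts [om_ne_zero, pow_ne_zero _ om_ne_zero]
  have hg : ∀ a ∈ R, Gen (c * s) a := by
    intro a ha
    have := (List.pairwise_cons.1 h2).1 a ha
    rcases hc with rfl | rfl
    exacts [this.om_mul, this.om_sq_mul]
  have hB' : c * s ∉ bS B := fun hm => hsB (by
    rcases hc with rfl | rfl
    exacts [om_mul_mem hm, om_sq_mul_mem hm])
  have hself : xx (c * s) ≠ xx s := by
    intro e
    rcases xx_eq (mul_ne_zero hc0 hs0) hs0 e with h | h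
    · have : c = 1 := mul_right_cancel₀ hs0 (by rw [h, one_mul])
      rcases hc with rfl | rfl
      exacts [om_ne_one this, om_sq_ne_one this]
    · rcases hc with rfl | rfl
      · apply hs3
        linear_combination om ^ 2 * h - s * s * h3
      · apply hs2
        linear_combination om * h - s * s * h3
  simp only [List.map_cons, List.mem_cons, List.mem_map, not_or]
  refine ⟨xx_ne_boundary hB (mul_ne_zero hc0 hs0) hB', hself, ?_⟩
  rintro ⟨a, ha, e⟩
  exact (hg a ha).xx_ne (mul_ne_zero hc0 hs0) (h1 a (by simp [ha])).1.1 e.symm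

lemma card_roots {B : ℂ} {l : List ℂ} (h : Gd B l) :
    (rootSet om l ∪ rootSet (om ^ 2) l).card = 4 * l.length := by
  rw [Finset.card_union_of_disjoint, card_rootSet h (Or.inl rfl), card_rootSet h (Or.inr rfl)]
  · omega
  rw [Finset.disjoint_left]
  intro t h1 h2
  obtain ⟨a, ha, h1⟩ := mem_rootSet h1
  obtain ⟨b, hb, h2⟩ := mem_rootSet h2
  have h3 := om_cube
  have hom := om_ne_zero
  have ha0 := (h.1 a ha).1.1
  have hb0 := (h.1 b hb).1.1
  obtain ⟨k1, -⟩ := mul_ne_of_good h ha hb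
  have kk : om * a ≠ om ^ 2 * b := by
    intro e
    have e : a = om * b := mul_left_cancel₀ hom (by linear_combination e)
    rcases gen_or_eq h ha hb with rfl | hg
    · have : (1 : ℂ) = om := mul_right_cancel₀ ha0 (by linear_combination e)
      exact om_ne_one this.symm
    · exact hg.2.1 e
  have kk2 : om * a * (om ^ 2 * b) ≠ 1 := fun e => k1 (by linear_combination e - a * b * h3)
  rcases h1 with rfl | rfl <;> rcases h2 with h2 | h2
  · exact kk h2
  · apply kk2
    rw [h2]; exact inv_mul_cancel₀ (mul_ne_zero (pow_ne_zero 2 hom) hb0)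
  · apply kk2
    rw [← h2]; exact mul_inv_cancel₀ (mul_ne_zero hom ha0)
  · exact kk (inv_injective h2)

lemma polyDeg_xx {r : ℂ[X]} {j : ℕ} (h : r.natDegree ≤ j) :
    ∃ g, PolyDeg (2 * j) g ∧ ∀ t, t ≠ 0 → t ^ j * r.eval (xx t) = g t := by
  refine ⟨_, ⟨∑ i ∈ Finset.range (j + 1), C (r.coeff i) * ((X ^ 2 + 1) ^ i * X ^ (j - i)), ?_,
    fun t => rfl⟩, fun t ht => ?_⟩
  · refine natDegree_sum_le_of_forall_le _ _ fun i hi => ?_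
    have := Finset.mem_range.1 hi
    refine (natDegree_C_mul_le _ _).trans ?_
    have e : ((X ^ 2 + 1 : ℂ[X]) ^ i * X ^ (j - i)).natDegree ≤ 2 * i + (j - i) := by
      compute_degree
      omega
    omega
  · rw [eval_eq_sum_range' (Nat.lt_succ_of_le h), Finset.mul_sum, eval_finsetSum]
    refine Finset.sum_congr rfl fun i hi => ?_
    have := Finset.mem_range.1 hi
    simp only [eval_mul, eval_C, eval_pow, eval_add, eval_X, eval_one]
    obtain ⟨k, rfl⟩ : ∃ k, j = i + k := ⟨j - i, by omega⟩
    have e : t ^ 2 + 1 = t * xx t := by simp only [xx]; field_simp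
    rw [e, Nat.add_sub_cancel_left]
    ring

end QKZ

namespace QKZ
open Polynomial

/-- The list of invariant variables together with the boundary one. -/
def bd (B : ℂ) (W : List ℂ) : List ℂ := W.map xx ++ [xx (om ^ 2 * B)]

lemma interp {B : ℂ} (hB : B ≠ 0) (Φ : List ℂ → ℂ) (W L : List ℂ) (t0 c : ℂ) (d k : ℕ)
    (hg : Gd B (t0 :: L ++ W))
    (hperm : ∀ l l' : List ℂ, l.Perm l' → (∀ a ∈ l, a ≠ 0) → Φ l = Φ l')
    (hinv : ∀ w, w ≠ 0 → w ∉ bS B → Φ (w⁻¹ :: L) = Φ (w :: L))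
    (hpoly : ∃ g, PolyDeg d g ∧ ∀ t, t ≠ 0 → t ^ k * Φ (t :: L) = g t)
    (hk : L.length / 2 + (L.length + W.length + 1) / 2 ≤ k)
    (hd : k + (L.length / 2 + (L.length + W.length + 1) / 2) ≤ d)
    (hd' : d < 4 * L.length)
    (hpair : ∀ s R, L.Perm (s :: R) → ∀ z, z ≠ 0 →
      (xx z :: xx (om * z) :: (R.map xx ++ bd B W)).Nodup →
      Φ (z :: om * z :: R) =
        c * SS ((z :: om * z :: R).map xx) * SS ((z :: om * z :: R).map xx ++ bd B W)) :
    Φ (t0 :: L) = c * SS ((t0 :: L).map xx) * SS ((t0 :: L).map xx ++ bd B W) := by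
  have hgL : Gd B L := hg.sublist (by
    rw [List.cons_append]
    exact (List.sublist_append_left _ _).trans (List.sublist_cons_self _ _))
  have hgLW : Gd B (L ++ W) := hg.sublist (by
    rw [List.cons_append]
    exact List.sublist_cons_self _ _)
  have hperm2 : ∀ l : List ℂ, (xx (om ^ 2 * B) :: (l ++ W).map xx).Perm (l.map xx ++ bd B W) := by
    intro l
    rw [bd, List.map_append, ← List.append_assoc]
    exact (List.perm_append_singleton _ _).symm
  have hn2 : (L.map xx ++ bd B W).Nodup := (hperm2 L).nodup_iff.1 (hgLW.nodup' hB)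
  have hn1 : (L.map xx).Nodup := hgL.nodup
  obtain ⟨g, hgd, hge⟩ := hpoly
  obtain ⟨r1, hr1, he1⟩ := SS_poly hn1
  obtain ⟨r2, hr2, he2⟩ := SS_poly hn2
  have hl2 : (L.map xx ++ bd B W).length = L.length + W.length + 1 := by simp [bd, add_assoc]
  rw [List.length_map] at hr1
  rw [hl2] at hr2
  obtain ⟨g1, hg1, hge1⟩ := polyDeg_xx hr1
  obtain ⟨g2, hg2, hge2⟩ := polyDeg_xx hr2
  set j1 := L.length / 2
  set j2 := (L.length + W.length + 1) / 2
  -- the comparison at a value where the right-hand side is generic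
  have hrhs : ∀ t, t ≠ 0 → xx t ∉ L.map xx ++ bd B W →
      t ^ k * (c * SS ((t :: L).map xx) * SS ((t :: L).map xx ++ bd B W)) =
        c * t ^ (k - (j1 + j2)) * g1 t * g2 t := by
    intro t ht hm
    rw [← hge1 t ht, ← hge2 t ht, List.map_cons, List.cons_append, he2 _ hm, he1 _ (fun h => hm
      (List.mem_append_left _ h))]
    obtain ⟨i, hi⟩ : ∃ i, k = i + (j1 + j2) := ⟨k - (j1 + j2), by omega⟩
    rw [hi, Nat.add_sub_cancel, pow_add, pow_add]
    ring
  have hpd : PolyDeg d (fun t => g t - c * t ^ (k - (j1 + j2)) * g1 t * g2 t) := by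
    refine (hgd.mono le_rfl).sub (PolyDeg.mono ((((PolyDeg.const c).mul
      (PolyDeg.pow (k - (j1 + j2)))).mul hg1).mul hg2) ?_)
    omega
  have hpair' : ∀ s ∈ L, ∀ cc, (cc = om ∨ cc = om ^ 2) →
      cc * s ≠ 0 ∧ xx (cc * s) ∉ L.map xx ++ bd B W ∧
      Φ ((cc * s) :: L) = c * SS ((cc * s :: L).map xx) * SS ((cc * s :: L).map xx ++ bd B W) := by
    intro s hs cc hcc
    have hs0 : s ≠ 0 := (hgL.1 s hs).1.1
    have hc0 : cc ≠ 0 := by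
      rcases hcc with rfl | rfl
      exacts [om_ne_zero, pow_ne_zero _ om_ne_zero]
    have hcs := mul_ne_zero hc0 hs0
    obtain ⟨R, hR⟩ : ∃ R, L.Perm (s :: R) := ⟨_, List.perm_cons_erase hs⟩
    have hg' : Gd B (s :: (R ++ W)) := hgLW.perm (by
      rw [← List.cons_append]; exact hR.append_right W)
    have hx := xx_root hB hg' hcc
    have hx' : xx (cc * s) ∉ L.map xx ++ bd B W := fun hm => hx (by
      have := (hperm2 L).mem_iff.2 hm
      rw [← List.cons_append]
      refine (List.Perm.mem_iff ?_).1 this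
      exact List.Perm.cons _ ((hR.append_right W).map xx))
    have hL0 : ∀ a ∈ cc * s :: L, a ≠ 0 := by
      intro a ha
      rcases List.mem_cons.1 ha with rfl | ha
      exacts [hcs, (hgL.1 a ha).1.1]
    refine ⟨hcs, hx', ?_⟩
    have hnd : (xx (cc * s) :: (L.map xx ++ bd B W)).Nodup := List.nodup_cons.2 ⟨hx', hn2⟩
    have hRp : (L.map xx ++ bd B W).Perm (xx s :: (R.map xx ++ bd B W)) := by
      rw [← List.cons_append, ← List.map_cons]
      exact (hR.map xx).append_right _
    have finish : ∀ z, z ≠ 0 → (cc * s :: L).Perm (z :: om * z :: R) →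
        (xx z :: xx (om * z) :: (R.map xx ++ bd B W)).Nodup →
        Φ ((cc * s) :: L) =
          c * SS ((cc * s :: L).map xx) * SS ((cc * s :: L).map xx ++ bd B W) := by
      intro z hz hp hnd
      rw [hperm _ _ hp hL0, hpair s R hR z hz hnd, SS_perm (hp.map xx),
        SS_perm ((hp.map xx).append_right (bd B W))]
    have hnd2 := ((hRp.cons (xx (cc * s))).nodup_iff).1 hnd
    rcases hcc with rfl | rfl
    · exact finish s hs0 ((hR.cons _).trans (List.Perm.swap _ _ _))
        ((List.Perm.swap _ _ _).nodup_iff.1 hnd2)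
    · have e : om * (om ^ 2 * s) = s := by linear_combination s * om_cube
      refine finish (om ^ 2 * s) hcs ?_ ?_
      · rw [e]; exact hR.cons _
      · rw [e]; exact hnd2
  have hroot : ∀ s ∈ L, ∀ cc, (cc = om ∨ cc = om ^ 2) → ∀ t, (t = cc * s ∨ t = (cc * s)⁻¹) →
      g t - c * t ^ (k - (j1 + j2)) * g1 t * g2 t = 0 := by
    intro s hs cc hcc t ht
    obtain ⟨h0, hm, he⟩ := hpair' s hs cc hcc
    have hsB : cc * s ∉ bS B := fun hm => (hgL.1 s hs).2 (by
      rcases hcc with rfl | rfl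
      exacts [om_mul_mem hm, om_sq_mul_mem hm])
    rcases ht with rfl | rfl
    · rw [← hrhs _ h0 hm, ← hge _ h0, he, sub_self]
    · rw [← hrhs _ (inv_ne_zero h0) (by rwa [xx_inv]), ← hge _ (inv_ne_zero h0), hinv _ h0 hsB,
        he, List.map_cons, List.map_cons, xx_inv, sub_self]
  have hz := hpd.eq_zero (rootSet om L ∪ rootSet (om ^ 2) L) (by rw [card_roots hgL]; exact hd')
    (by
      intro t ht
      rcases Finset.mem_union.1 ht with ht | ht
      · obtain ⟨s, hs, ht⟩ := mem_rootSet ht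
        exact hroot s hs _ (Or.inl rfl) t ht
      · obtain ⟨s, hs, ht⟩ := mem_rootSet ht
        exact hroot s hs _ (Or.inr rfl) t ht) t0
  have ht0 : t0 ≠ 0 := (hg.1 t0 (by simp)).1.1
  have hm0 : xx t0 ∉ L.map xx ++ bd B W := by
    have := hg.nodup' hB
    rw [List.cons_append, List.map_cons] at this
    have := (List.Perm.swap _ _ _).nodup_iff.1 this
    intro hm
    exact (List.nodup_cons.1 this).1 ((hperm2 L).mem_iff.2 hm)
  rw [← hge _ ht0, ← hrhs _ ht0 hm0] at hz
  exact mul_left_cancel₀ (pow_ne_zero k ht0) (sub_eq_zero.1 hz)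

lemma SS_nil : SS [] = 1 := by simp [SS, vdm, alt]

lemma SS_single (a : ℂ) : SS [a] = 1 := by
  simp [SS, vdm, alt, phi]

lemma SS_two {a b : ℂ} (h : [a, b].Nodup) : SS [a, b] = 1 := by
  have h0 := vdm_list_ne_zero h
  have : alt phi [a, b].get = vdm [a, b].get := by
    rw [vdm, alt, alt]
    congr 1
    ext i j
    fin_cases j <;> simp [phi]
  rw [SS, this, div_self h0]

/-- The product formula on the right-hand side. -/
def rhs (B : ℂ) (z1 z2 : List ℂ) : ℂ :=
  cst B (z1.length / 2) (z2.length / 2) * SS (z1.map xx) * SS (z2.map xx) *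
    SS (z1.map xx ++ bd B z2)

lemma cst_left (B : ℂ) (n1 n2 : ℕ) :
    cst B (n1 + 1) n2 = -B * (-om) ^ (n1 + n2 + n1) * cst B n1 n2 := by
  have h : (-om) ^ 3 = -1 := by rw [neg_pow, om_cube]; norm_num
  rw [cst, cst, show n1 + 1 + n2 = n1 + n2 + 1 by ring,
    show (n1 + 1) * (n1 + 1) + 2 * (n1 + 1) + (n2 * n2 + 2 * n2) + (n1 + 1) * n2 =
      3 + (n1 + n2 + n1) + (n1 * n1 + 2 * n1 + (n2 * n2 + 2 * n2) + n1 * n2) by ring,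
    pow_add (-om), pow_add (-om) 3, h, pow_succ B]
  ring

lemma cst_comm (B : ℂ) (n1 n2 : ℕ) : cst B n1 n2 = cst B n2 n1 := by
  rw [cst, cst]; congr 2 <;> ring

lemma map_sub_prod (l : List ℂ) (c : ℂ) :
    ((l.map xx).map fun a => a - c).prod = (l.map fun r => xx r - c).prod := by
  rw [List.map_map]; rfl

lemma Psi_nil (B : ℂ) : Psi B [] [] = 1 := by
  simpa [base, gD, gU] using Psi_base B [] []

lemma Psi_single_false (B z : ℂ) : Psi B [z] [false] = 1 := by
  simpa [base, gD, gU] using Psi_base B [] [z]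

lemma Psi_single_true (B z : ℂ) : Psi B [z] [true] = 0 := Psi_eq_zero' _ _ _ (by simp)

theorem Fov_eq {B : ℂ} (hB : B ≠ 0) (m : ℕ) (z1 z2 : List ℂ) (hm : z1.length + z2.length = m)
    (hodd : m % 2 = 1) (hg : Gd B (z1 ++ z2)) : Fov B z1 z2 = rhs B z1 z2 := by
  induction m using Nat.strong_induction_on generalizing z1 z2 with
  | _ m ih =>
  have h0 : ∀ a ∈ z1 ++ z2, a ≠ 0 := fun a ha => (hg.1 a ha).1.1
  rcases lt_trichotomy z1.length z2.length with hlt | heq | hlt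
  · rcases z2 with _ | ⟨t, L⟩
    · simp at hlt
    rcases L with _ | ⟨t', L'⟩
    · have : z1 = [] := by
        rw [← List.length_eq_zero_iff]; simp only [List.length_cons, List.length_nil] at hlt; omega
      subst this
      have hnd := hg.nodup' hB
      simp only [List.nil_append, List.map_cons, List.map_nil] at hnd
      have hnd := (List.Perm.swap _ _ _).nodup_iff.1 hnd
      simp [rhs, bd, cst, SS_nil, SS_single, SS_two hnd, Fov, ov, sumS, iv, Psi_single_true,
        Psi_single_false, Psi_nil]
    set L := t' :: L' with hLdef
    have hL1 : 1 ≤ L.length := by simp [hLdef]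
    clear_value L
    rw [List.length_cons] at hlt hm
    have hg' : Gd B (t :: L ++ z1) := hg.perm List.perm_append_comm
    have hg1 : Gd B z1 := hg.sublist (List.sublist_append_left _ _)
    have h01 : ∀ a ∈ z1, a ≠ 0 := fun a ha => h0 a (by simp [ha])
    have h0L : ∀ a ∈ L, a ≠ 0 := fun a ha => h0 a (by simp [ha])
    have hsw : ∀ l : List ℂ, SS (z1.map xx ++ bd B l) = SS (l.map xx ++ bd B z1) := by
      intro l
      rw [bd, bd, ← List.append_assoc, ← List.append_assoc]
      exact SS_perm (List.perm_append_comm.append_right _)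
    have := interp hB (fun l => Fov B z1 l) z1 L t
      (cst B (z1.length / 2) ((L.length + 1) / 2) * SS (z1.map xx))
      (L.length + z1.length + L.length) ((z1.length + (L.length + 1)) / 2 + (L.length + 1) / 2)
      hg' (fun l l' hp h => Fov_perm_right B z1 hp h)
      (fun w hw hwB => ?_)
      (Fov_poly_right B z1 L (by omega)) (by omega) (by omega) (by omega) ?_
    · rw [this, rhs, List.length_cons, hsw]
    · have e1 : ∀ w : ℂ, w ≠ 0 → Fov B z1 (w :: L) = Fov B z1 (L ++ [w]) := fun w hw =>
        Fov_perm_right B z1 (List.perm_append_singleton _ _).symm (by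
          intro a ha
          rcases List.mem_cons.1 ha with rfl | ha
          exacts [hw, h0L a ha])
      rw [e1 _ hw, e1 _ (inv_ne_zero hw)]
      exact Fov_inv_right B z1 w L hw fun e => hwB (mem_bS.2 (Or.inr (Or.inl e)))
    · intro s R hR z hz hnd
      have hgR : Gd B (R ++ z1) := (hg'.perm (l' := t :: (s :: R) ++ z1)
        ((hR.cons t).append_right z1)).sublist (by
          simp only [List.cons_append]
          exact (List.sublist_cons_self _ _).trans (List.sublist_cons_self _ _))
      have hlen := hR.length_eq
      rw [List.length_cons] at hlen
      have hR0 : ∀ a ∈ R, a ≠ 0 := fun a ha => (hgR.1 a (by simp [ha])).1.1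
      have hnd1 : (xx z :: xx (om * z) :: R.map xx).Nodup := hnd.sublist (by
        simp)
      have i1 := SS_pair hz hnd
      have i2 := SS_pair hz hnd1
      rw [Fov_pair_right hB hz z1 R hR0 h01 (by omega),
        ih (z1.length + R.length) (by omega) z1 R rfl (by omega)
          (hgR.perm List.perm_append_comm)]
      simp only [List.map_cons, List.cons_append]
      rw [i1, i2, rhs, hsw, hlen, show (R.length + 1 + 1) / 2 = R.length / 2 + 1 by omega,
        cst_comm, cst_comm B _ (R.length / 2 + 1), cst_left,
        show (z1.length + R.length) / 2 = R.length / 2 + z1.length / 2 by omega]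
      simp only [bd, List.map_append, List.prod_append, map_sub_prod, List.map_cons, List.map_nil,
        List.prod_cons, List.prod_nil]
      ring
  · omega
  · rcases z1 with _ | ⟨t, L⟩
    · simp at hlt
    rcases L with _ | ⟨t', L'⟩
    · have : z2 = [] := by
        rw [← List.length_eq_zero_iff]; simp only [List.length_cons, List.length_nil] at hlt; omega
      subst this
      have hnd := hg.nodup' hB
      simp only [List.append_nil, List.map_cons, List.map_nil] at hnd
      have hnd := (List.Perm.swap _ _ _).nodup_iff.1 hnd
      simp [rhs, bd, cst, SS_nil, SS_single, SS_two hnd, Fov, ov, sumS, iv, Psi_single_true,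
        Psi_single_false, Psi_nil]
    set L := t' :: L' with hLdef
    have hL1 : 1 ≤ L.length := by simp [hLdef]
    clear_value L
    rw [List.length_cons] at hlt hm
    have hg2 : Gd B z2 := hg.sublist (List.sublist_append_right _ _)
    have h02 : ∀ a ∈ z2, a ≠ 0 := fun a ha => h0 a (by simp [ha])
    have := interp hB (fun l => Fov B l z2) z2 L t
      (cst B ((L.length + 1) / 2) (z2.length / 2) * SS (z2.map xx))
      (L.length + z2.length + L.length) ((L.length + 1 + z2.length) / 2 + (L.length + 1) / 2)
      hg (fun l l' hp h => Fov_perm_left B z2 hp h)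
      (fun w hw hwB => Fov_inv_left B z2 w L hw fun e => hwB (mem_bS.2 (Or.inl e)))
      (Fov_poly_left B L z2 (by omega)) (by omega) (by omega) (by omega) ?_
    · rw [this, rhs, List.length_cons]
      ring
    · intro s R hR z hz hnd
      have hgR : Gd B (R ++ z2) := (hg.perm (l' := t :: (s :: R) ++ z2)
        ((hR.cons t).append_right z2)).sublist (by
          simp only [List.cons_append]
          exact (List.sublist_cons_self _ _).trans (List.sublist_cons_self _ _))
      have hlen := hR.length_eq
      rw [List.length_cons] at hlen
      have hR0 : ∀ a ∈ R, a ≠ 0 := fun a ha => (hgR.1 a (by simp [ha])).1.1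
      have hnd1 : (xx z :: xx (om * z) :: R.map xx).Nodup := hnd.sublist (by
        simp)
      have i1 := SS_pair hz hnd
      have i2 := SS_pair hz hnd1
      rw [Fov_pair_left hB hz R z2 hR0 h02 (by omega),
        ih (R.length + z2.length) (by omega) R z2 rfl (by omega) hgR]
      simp only [List.map_cons, List.cons_append]
      rw [i1, i2, rhs, hlen, show (R.length + 1 + 1) / 2 = R.length / 2 + 1 by omega, cst_left,
        show (R.length + z2.length) / 2 = R.length / 2 + z2.length / 2 by omega]
      simp only [bd, List.map_append, List.prod_append, map_sub_prod, List.map_cons, List.map_nil,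
        List.prod_cons, List.prod_nil]
      ring

end QKZ

namespace QKZ
open Polynomial Matrix Finset

/-- Successive quotients in Newton's interpolation scheme. -/
def dd (p : ℂ[X]) (w : ℕ → ℂ) : ℕ → ℂ[X]
  | 0 => p
  | k + 1 => dd p w k /ₘ (X - C (w k))

lemma dd_expand (p : ℂ[X]) (w : ℕ → ℂ) (m : ℕ) :
    p = ∑ k ∈ range m, C ((dd p w k).eval (w k)) * ∏ s ∈ range k, (X - C (w s)) +
      dd p w m * ∏ s ∈ range m, (X - C (w s)) := by
  induction m with
  | zero => simp [dd]
  | succ m ih =>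
    have := modByMonic_add_div (dd p w m) (X - C (w m))
    rw [modByMonic_X_sub_C_eq_C_eval] at this
    rw [sum_range_succ, prod_range_succ, dd]
    conv_lhs => rw [ih]
    linear_combination (-∏ s ∈ range m, (X - C (w s))) * this

/-- The Vandermonde product of `w 0, …, w (m - 1)`. -/
def vd (m : ℕ) (w : ℕ → ℂ) : ℂ := ∏ j ∈ range m, ∏ i ∈ range j, (w j - w i)

/-- The determinant of divided differences. -/
def Gc (p : ℕ → ℂ[X]) (m : ℕ) (w : ℕ → ℂ) : ℂ :=
  det (of fun k j : Fin m => (dd (p j) w k).eval (w k))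

lemma det_eval_eq (p : ℕ → ℂ[X]) (m : ℕ) (w : ℕ → ℂ) :
    det (of fun i j : Fin m => (p j).eval (w i)) = vd m w * Gc p m w := by
  set L : Matrix (Fin m) (Fin m) ℂ := of fun i k => ∏ s ∈ range k, (w i - w s) with hL
  have hz : ∀ (i : Fin m) (k : ℕ), (i : ℕ) < k → ∏ s ∈ range k, (w i - w s) = 0 := fun i k h =>
    prod_eq_zero (mem_range.2 h) (sub_self _)
  have hdet : det L = vd m w := by
    rw [det_of_isLowerTriangular L fun i k h => hz i k h, vd, ← Fin.prod_univ_eq_prod_range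
      (fun j => ∏ i ∈ range j, (w j - w i))]
    rfl
  rw [← hdet, Gc, ← det_mul]
  congr 1
  ext i j
  rw [mul_apply]
  conv_lhs => rw [of_apply, dd_expand (p j) w m]
  rw [eval_add, eval_mul, eval_prod, eval_finsetSum, prod_eq_zero (mem_range.2 i.2) (by simp),
    mul_zero, add_zero, ← Fin.sum_univ_eq_sum_range (fun k => eval (w i) _)]
  refine sum_congr rfl fun k _ => ?_
  simp [hL, eval_prod, mul_comm]

lemma dd_natDegree (p : ℂ[X]) (w : ℕ → ℂ) (k : ℕ) : (dd p w k).natDegree ≤ p.natDegree := by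
  induction k with
  | zero => rfl
  | succ k ih =>
    rw [dd, natDegree_divByMonic _ (monic_X_sub_C _)]
    omega

lemma continuous_dd_coeff (p : ℂ[X]) (k n : ℕ) : Continuous fun w => (dd p w k).coeff n := by
  induction k generalizing n with
  | zero => exact continuous_const
  | succ k ih =>
    have : (fun w : ℕ → ℂ => (dd p w (k + 1)).coeff n) =
        fun w => ∑ i ∈ Icc (n + 1) p.natDegree, w k ^ (i - (n + 1)) * (dd p w k).coeff i := by
      ext w
      rw [dd, coeff_divByMonic_X_sub_C]
      refine sum_subset (Icc_subset_Icc_right (dd_natDegree _ _ _)) fun i hi hi' => ?_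
      rw [mem_Icc] at hi hi'
      rw [coeff_eq_zero_of_natDegree_lt (by omega), mul_zero]
    rw [this]
    exact continuous_finsetSum _ fun i _ => ((continuous_apply k).pow _).mul (ih i)

lemma continuous_Gc (p : ℕ → ℂ[X]) (m : ℕ) : Continuous (Gc p m) := by
  refine Continuous.matrix_det ?_
  refine continuous_matrix fun k j => ?_
  have : (fun w : ℕ → ℂ => (dd (p j) w k).eval (w k)) =
      fun w => ∑ i ∈ range ((p j).natDegree + 1), (dd (p j) w k).coeff i * w k ^ i := by
    ext w
    exact eval_eq_sum_range' (Nat.lt_succ_of_le (dd_natDegree _ _ _)) _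
  exact this ▸ continuous_finsetSum _ fun i _ =>
    (continuous_dd_coeff _ _ _).mul ((continuous_apply _).pow _)

lemma vd_succ (m : ℕ) (w : ℕ → ℂ) : vd (m + 1) w = vd m w * ∏ i ∈ range m, (w m - w i) := by
  rw [vd, prod_range_succ, vd]

lemma vd_ne_zero {m : ℕ} {w : ℕ → ℂ} (h : ∀ i < m, ∀ j < i, w i ≠ w j) : vd m w ≠ 0 := by
  refine prod_ne_zero_iff.2 fun i hi => prod_ne_zero_iff.2 fun j hj => ?_
  exact sub_ne_zero.2 (h i (mem_range.1 hi) j (mem_range.1 hj))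

lemma prod_Ioi_comm {m : ℕ} (f : Fin m → Fin m → ℂ) :
    ∏ i, ∏ j ∈ Ioi i, f i j = ∏ j, ∏ i ∈ Iio j, f i j :=
  prod_comm' (by simp)

lemma vdm_eq_vd (m : ℕ) (w : ℕ → ℂ) : vdm (fun i : Fin m => w i) = vd m w := by
  induction m with
  | zero => simp [vdm_eq, vd]
  | succ m ih =>
    rw [vd_succ, ← ih, vdm_eq, vdm_eq, prod_Ioi_comm, prod_Ioi_comm, Fin.prod_univ_castSucc]
    simp_rw [Fin.prod_Iio_castSucc]
    congr 1
    rw [Fin.Iio_last_eq_map, prod_map, ← Fin.prod_univ_eq_prod_range (fun i => w m - w i)]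
    rfl

end QKZ

namespace QKZ
open Polynomial Matrix Finset

lemma det_unitriangular_functional {V : Type*} [AddCommGroup V] [Module ℂ V] {g f : ℕ → V}
    (h : ∀ j, f j - g j ∈ Submodule.span ℂ (g '' (range j : Finset ℕ))) (m : ℕ)
    (l : ℕ → V →ₗ[ℂ] ℂ) :
    det (of fun i j : Fin m => l i (f j)) = det (of fun i j : Fin m => l i (g j)) := by
  simp_rw [Submodule.mem_span_image_finset_iff_exists_fun'] at h
  choose c hc using h
  set U : Matrix (Fin m) (Fin m) ℂ := of fun i j =>
    if i = j then 1 else if (i : ℕ) < j then c j i else 0 with hU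
  have hdet : det U = 1 := by
    rw [det_of_isUpperTriangular]
    · exact prod_eq_one fun i _ => by simp [hU]
    · intro i j hij
      have hij' : (j : ℕ) < i := hij
      rw [hU, of_apply, if_neg (by rintro rfl; omega), if_neg (by omega)]
  rw [← mul_one (det (of fun i j : Fin m => l i (g j))), ← hdet, ← det_mul]
  congr 1
  ext i j
  have hf : f j = g j + ∑ k ∈ range j, c j k • g k := by rw [hc]; abel
  rw [mul_apply, of_apply, hf, map_add, map_sum]
  have e : ∀ k : Fin m, (of fun i j : Fin m => l i (g j)) i k * U k j =
      (if k = j then l i (g k) else 0) +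
        (if (k : ℕ) < j then c j k * l i (g k) else 0) := by
    intro k
    rw [hU, of_apply, of_apply]
    by_cases h1 : k = j
    · subst h1; simp
    · by_cases h2 : (k : ℕ) < j <;> simp [h1, h2, mul_comm]
  rw [sum_congr rfl fun k _ => e k, sum_add_distrib, sum_ite_eq' univ j, if_pos (mem_univ _),
    Fin.sum_univ_eq_sum_range (fun k => if k < (j : ℕ) then c j k * l i (g k) else 0),
    ← sum_filter]
  congr 1
  refine sum_congr ?_ fun k _ => by rw [map_smul, smul_eq_mul]
  ext k
  have := j.2
  simp only [mem_range, mem_filter]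
  omega

lemma det_unitriangular {g f : ℕ → ℂ[X]}
    (h : ∀ j, f j - g j ∈ Submodule.span ℂ (g '' (range j : Finset ℕ))) (m : ℕ) (w : ℕ → ℂ) :
    det (of fun i j : Fin m => (f j).eval (w i)) = det (of fun i j : Fin m => (g j).eval (w i)) :=
  det_unitriangular_functional h m fun i => leval (w i)

/-- The polynomials with `Sp n (z + z⁻¹) = (z ^ (n + 1) - z⁻¹ ^ (n + 1)) / (z - z⁻¹)`. -/
def Sp : ℕ → ℂ[X]
  | 0 => 1
  | 1 => X
  | n + 2 => X * Sp (n + 1) - Sp n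

lemma Sp_monic (n : ℕ) : (Sp n).Monic ∧ (Sp n).natDegree = n := by
  induction n using Nat.strong_induction_on with
  | _ n ih =>
  match n with
  | 0 => exact ⟨monic_one, natDegree_one⟩
  | 1 => exact ⟨monic_X, natDegree_X⟩
  | n + 2 =>
    obtain ⟨h1, d1⟩ := ih (n + 1) (by omega)
    obtain ⟨h0, d0⟩ := ih n (by omega)
    have hm : (X * Sp (n + 1)).Monic := monic_X.mul h1
    have hd : (X * Sp (n + 1)).natDegree = n + 2 := by
      rw [monic_X.natDegree_mul h1, natDegree_X, d1]; ring
    have hlt : (Sp n).degree < (X * Sp (n + 1)).degree := by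
      rw [degree_eq_natDegree h0.ne_zero, degree_eq_natDegree hm.ne_zero, d0, hd]
      exact_mod_cast (by omega : n < n + 2)
    refine ⟨hm.sub_of_left hlt, ?_⟩
    rw [Sp, natDegree_eq_of_degree_eq (degree_sub_eq_left_of_degree_lt hlt), hd]

lemma Sp_eval {z : ℂ} (hz : z ≠ 0) (n : ℕ) :
    (Sp n).eval (xx z) * (z - z⁻¹) = z ^ (n + 1) - z⁻¹ ^ (n + 1) := by
  induction n using Nat.strong_induction_on with
  | _ n ih =>
  match n with
  | 0 => simp [Sp]
  | 1 => simp [Sp, xx]; ring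
  | n + 2 =>
    have h1 := ih (n + 1) (by omega)
    have h0 := ih n (by omega)
    have e : z * z⁻¹ = 1 := mul_inv_cancel₀ hz
    rw [Sp, eval_sub, eval_mul, eval_X]
    rw [xx] at *
    linear_combination (z + z⁻¹) * h1 - h0 + (z ^ (n + 1) - z⁻¹ ^ (n + 1)) * e

/-- `X ^ 3 - 3 X`. -/
def tP : ℂ[X] := X ^ 3 - C 3 * X

lemma Sp_add_six (n : ℕ) : Sp (n + 6) = tP * Sp (n + 3) - Sp n := by
  rw [tP, show n + 6 = n + 4 + 2 by ring, Sp, Sp, Sp, show n + 3 = n + 1 + 2 by ring, Sp, Sp]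
  rw [show (3 : ℂ) = 1 + 1 + 1 by norm_num, C_add, C_add, C_1]
  ring

lemma phiP_add_two (n : ℕ) : phiP (n + 2) = tP * phiP n := by
  rw [phiP, phiP, ← tP, show (n + 2) / 2 = n / 2 + 1 by omega, show (n + 2) % 2 = n % 2 by omega]
  ring

lemma tP_mul_mem {j : ℕ} {p : ℂ[X]} (h : p ∈ Submodule.span ℂ (phiP '' (range j : Finset ℕ))) :
    tP * p ∈ Submodule.span ℂ (phiP '' (range (j + 2) : Finset ℕ)) := by
  induction h using Submodule.span_induction with
  | mem x hx =>
    obtain ⟨i, hi, rfl⟩ := hx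
    rw [← phiP_add_two]
    refine Submodule.subset_span ⟨i + 2, ?_, rfl⟩
    simpa using hi
  | zero => simp
  | add x y _ _ hx hy => rw [mul_add]; exact add_mem hx hy
  | smul a x _ hx => rw [mul_smul_comm]; exact Submodule.smul_mem _ _ hx

/-- Every positive integer not divisible by three, in order. -/
def mk (k : ℕ) : ℕ := 3 * (k / 2) + k % 2 + 1

lemma Sp_sub_phiP (j : ℕ) :
    Sp (3 * (j / 2) + j % 2) - phiP j ∈ Submodule.span ℂ (phiP '' (range j : Finset ℕ)) := by
  have mono : ∀ {a b : ℕ}, a ≤ b → Submodule.span ℂ (phiP '' (range a : Finset ℕ)) ≤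
      Submodule.span ℂ (phiP '' (range b : Finset ℕ)) := fun h =>
    Submodule.span_mono (Set.image_mono (by exact_mod_cast range_mono h))
  have mem : ∀ {a b : ℕ}, a < b → phiP a ∈ Submodule.span ℂ (phiP '' (range b : Finset ℕ)) :=
    fun h => Submodule.subset_span ⟨_, by simpa using h, rfl⟩
  have p0 : phiP 0 = 1 := by simp [phiP]
  have p1 : phiP 1 = X := by simp [phiP]
  have c3 : (C 3 : ℂ[X]) = 3 := rfl
  induction j using Nat.strong_induction_on with
  | _ j ih =>
  match j with
  | 0 => simp [Sp, phiP]
  | 1 => simp [Sp, phiP]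
  | 2 =>
    have : Sp (3 * (2 / 2) + 2 % 2) - phiP 2 = phiP 1 := by
      norm_num [Sp, phiP, c3]; ring
    rw [this]
    exact mem (by norm_num)
  | 3 =>
    have : Sp (3 * (3 / 2) + 3 % 2) - phiP 3 = phiP 0 := by
      norm_num [Sp, phiP, c3]; ring
    rw [this]
    exact mem (by norm_num)
  | j + 4 =>
    have h2 := tP_mul_mem (ih (j + 2) (by omega))
    have h0 := ih j (by omega)
    have e : Sp (3 * ((j + 4) / 2) + (j + 4) % 2) - phiP (j + 4) =
        tP * (Sp (3 * ((j + 2) / 2) + (j + 2) % 2) - phiP (j + 2)) -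
          ((Sp (3 * (j / 2) + j % 2) - phiP j) + phiP j) := by
      rw [show 3 * ((j + 4) / 2) + (j + 4) % 2 = 3 * (j / 2) + j % 2 + 6 by omega, Sp_add_six,
        show 3 * ((j + 2) / 2) + (j + 2) % 2 = 3 * (j / 2) + j % 2 + 3 by omega,
        show j + 4 = j + 2 + 2 by rfl, phiP_add_two (j + 2)]
      ring
    rw [e]
    exact sub_mem h2 (add_mem (mono (by omega) h0) (mem (by omega)))

lemma det_phi_eq (m : ℕ) (w : ℕ → ℂ) :
    det (of fun i j : Fin m => (phiP j).eval (w i)) =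
      det (of fun i j : Fin m => (Sp (mk j - 1)).eval (w i)) :=
  (det_unitriangular Sp_sub_phiP m w).symm

lemma det_Sp_eq (m : ℕ) (w : ℕ → ℂ) :
    det (of fun i j : Fin m => (Sp j).eval (w i)) = vd m w := by
  rw [← vdm_eq_vd]
  exact (det_eval_matrixOfPolynomials_eq_det_vandermonde (fun i : Fin m => w i) (fun j => Sp j)
    (fun j => (Sp_monic j).2) fun j => (Sp_monic j).1).symm

lemma vd_phi_geom {z : ℂ} (hz : z ≠ 0) (m : ℕ) :
    (vd m fun i => xx (z ^ (i + 1))) * Gc phiP m (fun i => xx (z ^ (i + 1))) *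
      ∏ i ∈ range m, (z ^ (i + 1) - (z ^ (i + 1))⁻¹) =
    (vd m fun i => xx (z ^ mk i)) * ∏ i ∈ range m, (z ^ mk i - (z ^ mk i)⁻¹) := by
  rw [← det_eval_eq, det_phi_eq m fun i => xx (z ^ (i + 1)), ← det_Sp_eq, ← Fin.prod_univ_eq_prod_range,
    ← Fin.prod_univ_eq_prod_range, mul_comm, ← det_mul_column, mul_comm, ← det_mul_column,
    ← det_transpose]
  congr 1
  ext i j
  simp only [transpose_apply, of_apply]
  have h1 := Sp_eval (pow_ne_zero (j + 1) hz) (mk i - 1)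
  have h2 := Sp_eval (pow_ne_zero (mk i) hz) j
  rw [mul_comm, h1, mul_comm, h2, show mk i - 1 + 1 = mk i from rfl]
  simp only [← inv_pow, ← pow_mul]
  congr 2 <;> ring

end QKZ

namespace QKZ
open Polynomial Matrix Finset Filter Topology

lemma eq_of_punctured {f g : ℂ → ℂ} {a : ℂ} (hf : ContinuousAt f a) (hg : ContinuousAt g a)
    (h : ∀ᶠ z in 𝓝[≠] a, f z = g z) : f a = g a :=
  tendsto_nhds_unique_of_eventuallyEq (hf.tendsto.mono_left nhdsWithin_le_nhds)
    (hg.tendsto.mono_left nhdsWithin_le_nhds) h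

lemma vd_affine (m : ℕ) (a d : ℂ) (w : ℕ → ℂ) :
    vd m (fun i => a + d * w i) = (∏ j ∈ range m, d ^ j) * vd m w := by
  rw [vd, vd, ← prod_mul_distrib]
  refine prod_congr rfl fun j _ => ?_
  rw [← card_range j, ← prod_const, card_range, ← prod_mul_distrib]
  exact prod_congr rfl fun i _ => by ring

lemma continuous_vd (m : ℕ) : Continuous (vd m) :=
  continuous_finsetProd _ fun j _ => continuous_finsetProd _ fun i _ =>
    (continuous_apply j).sub (continuous_apply i)

lemma xx_pow {z : ℂ} (hz : z ≠ 0) (a : ℕ) :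
    xx (z ^ a) = 2 + (z - 1) ^ 2 * ((z ^ a)⁻¹ * (∑ i ∈ range a, z ^ i) ^ 2) := by
  have h := mul_geom_sum z a
  have e : z ^ a * (z ^ a)⁻¹ = 1 := mul_inv_cancel₀ (pow_ne_zero _ hz)
  rw [xx, show (z - 1) ^ 2 * ((z ^ a)⁻¹ * (∑ i ∈ range a, z ^ i) ^ 2) =
    ((z - 1) * ∑ i ∈ range a, z ^ i) ^ 2 * (z ^ a)⁻¹ by ring, h]
  linear_combination (2 - z ^ a) * e

lemma pow_sub_inv {z : ℂ} (hz : z ≠ 0) (a : ℕ) :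
    z ^ a - (z ^ a)⁻¹ = (z - 1) * ((z ^ a)⁻¹ * ∑ i ∈ range (2 * a), z ^ i) := by
  have h := mul_geom_sum z (2 * a)
  have e : z ^ a * (z ^ a)⁻¹ = 1 := mul_inv_cancel₀ (pow_ne_zero _ hz)
  rw [mul_left_comm, h, two_mul, pow_add]
  linear_combination (-z ^ a) * e

lemma Gc_phi_two (m : ℕ) :
    (vd m fun i => ((i : ℂ) + 1) ^ 2) * Gc phiP m (fun _ => 2) * ∏ i ∈ range m, ((i : ℂ) + 1) =
      (vd m fun i => (mk i : ℂ) ^ 2) * ∏ i ∈ range m, (mk i : ℂ) := by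
  set q : ℕ → ℂ → ℂ := fun a z => (z ^ a)⁻¹ * (∑ i ∈ range a, z ^ i) ^ 2 with hq
  set s : ℕ → ℂ → ℂ := fun a z => (z ^ a)⁻¹ * ∑ i ∈ range (2 * a), z ^ i with hs
  have hcq : ∀ a, ContinuousAt (q a) 1 := fun a =>
    ((continuous_pow a).continuousAt.inv₀ (by simp)).mul (by fun_prop)
  have hcs : ∀ a, ContinuousAt (s a) 1 := fun a =>
    ((continuous_pow a).continuousAt.inv₀ (by simp)).mul (by fun_prop)
  have hcv : ∀ f : ℕ → ℕ, ContinuousAt (fun z => vd m fun i => q (f i) z) 1 := fun f =>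
    (continuous_vd m).continuousAt.comp (f := fun z => fun i => q (f i) z)
      (continuousAt_pi.2 fun i => hcq (f i))
  have hcp : ∀ f : ℕ → ℕ, ContinuousAt (fun z => ∏ i ∈ range m, s (f i) z) 1 := fun f =>
    tendsto_finsetProd _ fun i _ => hcs (f i)
  have hcG : ContinuousAt (fun z => Gc phiP m fun i => 2 + (z - 1) ^ 2 * q (i + 1) z) 1 :=
    (continuous_Gc phiP m).continuousAt.comp
      (f := fun z => fun i => 2 + (z - 1) ^ 2 * q (i + 1) z)
      (continuousAt_pi.2 fun i => continuousAt_const.add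
        (ContinuousAt.mul (by fun_prop) (hcq _)))
  have key := eq_of_punctured (a := 1)
    (((hcv fun i => i + 1).mul hcG).mul (hcp fun i => i + 1)) ((hcv mk).mul (hcp mk)) (by
      have h0 : ∀ᶠ z : ℂ in 𝓝[≠] 1, z ≠ 0 :=
        (eventually_ne_nhds one_ne_zero).filter_mono nhdsWithin_le_nhds
      filter_upwards [h0, self_mem_nhdsWithin] with z hz hz1
      have hz1 : z - 1 ≠ 0 := sub_ne_zero.2 hz1
      have h := vd_phi_geom hz m
      simp_rw [xx_pow hz, pow_sub_inv hz] at h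
      rw [vd_affine, vd_affine] at h
      simp only [prod_mul_distrib] at h
      have hn : (∏ j ∈ range m, ((z - 1) ^ 2) ^ j) * ∏ j ∈ range m, (z - 1) ≠ 0 :=
        mul_ne_zero (prod_ne_zero_iff.2 fun _ _ => pow_ne_zero _ (pow_ne_zero _ hz1))
          (prod_ne_zero_iff.2 fun _ _ => hz1)
      refine mul_left_cancel₀ hn ?_
      simp only [hq, hs, Pi.mul_apply, prod_mul_distrib]
      linear_combination h)
  have hq1 : ∀ a, q a 1 = (a : ℂ) ^ 2 := fun a => by simp [hq]
  have hs1 : ∀ a, s a 1 = 2 * (a : ℂ) := fun a => by simp [hs]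
  simp only [Pi.mul_apply, hq1, hs1, sub_self, prod_mul_distrib] at key
  norm_num at key
  have h2 : (2 : ℂ) ^ m ≠ 0 := pow_ne_zero _ two_ne_zero
  refine mul_left_cancel₀ h2 ?_
  linear_combination key

lemma prod_range_sub_cast (m : ℕ) : ∏ i ∈ range m, ((m : ℂ) - i) = (m.factorial : ℂ) := by
  rw [← prod_range_add_one_eq_factorial, ← prod_range_reflect]
  push_cast
  refine prod_congr rfl fun i hi => ?_
  rw [mem_range] at hi
  rw [Nat.cast_sub (by omega), Nat.cast_sub (by omega)]
  push_cast; ring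

lemma prod_range_add_cast (m k : ℕ) :
    (m.factorial : ℂ) * ∏ i ∈ range k, ((m : ℂ) + 1 + i) = ((m + k).factorial : ℂ) := by
  induction k with
  | zero => simp
  | succ k ih =>
    rw [prod_range_succ, ← mul_assoc, ih, ← add_assoc, Nat.factorial_succ]
    push_cast; ring

lemma prod_sq_diff (m : ℕ) : (∏ i ∈ range m, (((m : ℂ) + 1) ^ 2 - ((i : ℂ) + 1) ^ 2)) * (m + 1) =
    ((2 * m + 1).factorial : ℂ) := by
  have h1 := prod_range_sub_cast m
  have h2 := prod_range_add_cast (m + 1) m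
  rw [show m + 1 + m = 2 * m + 1 by ring] at h2
  rw [← h2, Nat.factorial_succ]
  push_cast
  rw [← h1, mul_assoc, ← prod_mul_distrib, mul_comm]
  congr 1
  exact prod_congr rfl fun i _ => by ring

lemma prod_range_two_mul (f : ℕ → ℂ) (a : ℕ) :
    ∏ i ∈ range (2 * a), f i = ∏ b ∈ range a, (f (2 * b) * f (2 * b + 1)) := by
  induction a with
  | zero => simp
  | succ a ih =>
    rw [show 2 * (a + 1) = 2 * a + 1 + 1 by ring, prod_range_succ, prod_range_succ, ih,
      prod_range_succ, mul_assoc]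

lemma prod_range_fold (F : ℕ → ℂ) (a : ℕ) :
    ∏ b ∈ range a, (F (a + b) * F (a - 1 - b)) = ∏ c ∈ range (2 * a), F c := by
  rw [prod_mul_distrib, prod_range_reflect, two_mul, prod_range_add, mul_comm]

lemma prod_mk_even (a : ℕ) :
    ∏ i ∈ range (2 * a), ((mk (2 * a) : ℂ) ^ 2 - (mk i : ℂ) ^ 2) =
      ∏ c ∈ range (2 * a), ((3 * c + 3) * (3 * c + 2) : ℂ) := by
  rw [prod_range_two_mul, ← prod_range_fold]
  refine prod_congr rfl fun b hb => ?_
  rw [mem_range] at hb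
  obtain ⟨d, rfl⟩ := Nat.exists_eq_add_of_lt hb
  rw [mk, mk, mk, show 2 * (b + d + 1) / 2 = b + d + 1 by omega,
    show 2 * (b + d + 1) % 2 = 0 by omega, show 2 * b / 2 = b by omega,
    show 2 * b % 2 = 0 by omega, show (2 * b + 1) / 2 = b by omega,
    show (2 * b + 1) % 2 = 1 by omega, show b + d + 1 - 1 - b = d by omega]
  push_cast; ring

lemma prod_mk_odd (a : ℕ) :
    ∏ i ∈ range (2 * a + 1), ((mk (2 * a + 1) : ℂ) ^ 2 - (mk i : ℂ) ^ 2) =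
      (∏ c ∈ range (2 * a), ((3 * c + 3) * (3 * c + 4) : ℂ)) * (6 * a + 3) := by
  rw [prod_range_succ, prod_range_two_mul, ← prod_range_fold]
  congr 1
  · refine prod_congr rfl fun b hb => ?_
    rw [mem_range] at hb
    obtain ⟨d, rfl⟩ := Nat.exists_eq_add_of_lt hb
    rw [mk, mk, mk, show (2 * (b + d + 1) + 1) / 2 = b + d + 1 by omega,
      show (2 * (b + d + 1) + 1) % 2 = 1 by omega, show 2 * b / 2 = b by omega,
      show 2 * b % 2 = 0 by omega, show (2 * b + 1) / 2 = b by omega,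
      show (2 * b + 1) % 2 = 1 by omega, show b + d + 1 - 1 - b = d by omega]
    push_cast; ring
  · rw [mk, mk, show (2 * a + 1) / 2 = a by omega, show (2 * a + 1) % 2 = 1 by omega,
      show 2 * a / 2 = a by omega, show 2 * a % 2 = 0 by omega]
    push_cast; ring

lemma Gc_phi_two_succ (m : ℕ) :
    Gc phiP (m + 1) (fun _ => 2) * ((2 * m + 1).factorial : ℂ) =
      (∏ i ∈ range m, ((mk m : ℂ) ^ 2 - (mk i : ℂ) ^ 2)) * mk m * Gc phiP m (fun _ => 2) := by
  have h1 := Gc_phi_two m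
  have h2 := Gc_phi_two (m + 1)
  rw [vd_succ, vd_succ, prod_range_succ, prod_range_succ] at h2
  rw [← prod_sq_diff]
  have hv : (vd m fun i => ((i : ℂ) + 1) ^ 2) ≠ 0 := vd_ne_zero fun i _ j hj => by
    have : (i + 1) ^ 2 ≠ (j + 1) ^ 2 := fun h => by nlinarith
    exact_mod_cast this
  have hp : ∏ i ∈ range m, ((i : ℂ) + 1) ≠ 0 :=
    prod_ne_zero_iff.2 fun i _ => Nat.cast_add_one_ne_zero i
  refine mul_left_cancel₀ (mul_ne_zero hv hp) ?_
  linear_combination h2 - (∏ i ∈ range m, ((mk m : ℂ) ^ 2 - (mk i : ℂ) ^ 2)) * mk m * h1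

lemma prod_three (a : ℕ) : ∏ c ∈ range a, (3 * c + 3 : ℂ) = 3 ^ a * (a.factorial : ℂ) := by
  induction a with
  | zero => simp
  | succ a ih => rw [prod_range_succ, ih, Nat.factorial_succ]; push_cast; ring

lemma prod_six (a : ℕ) : ∏ c ∈ range a, ((3 * c + 2) * (3 * c + 3) * (3 * c + 4) : ℂ) =
    ((3 * a + 1).factorial : ℂ) := by
  induction a with
  | zero => simp
  | succ a ih =>
    rw [prod_range_succ, ih, show 3 * (a + 1) + 1 = 3 * a + 1 + 1 + 1 + 1 by ring,
      Nat.factorial_succ (3 * a + 1 + 1 + 1), Nat.factorial_succ (3 * a + 1 + 1),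
      Nat.factorial_succ (3 * a + 1)]
    push_cast; ring

lemma Gc_phi_two_even_step (a : ℕ) :
    Gc phiP (2 * a + 2) (fun _ => 2) * ((4 * a + 1).factorial * (4 * a + 3).factorial : ℂ) =
      (3 * a + 1) * (3 * a + 2) * (6 * a + 3) * ((6 * a + 1).factorial : ℂ) *
        (3 ^ (2 * a) * ((2 * a).factorial : ℂ)) * Gc phiP (2 * a) (fun _ => 2) := by
  have h1 := Gc_phi_two_succ (2 * a)
  have h2 := Gc_phi_two_succ (2 * a + 1)
  rw [prod_mk_even, show 2 * (2 * a) + 1 = 4 * a + 1 by ring] at h1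
  rw [prod_mk_odd, show 2 * (2 * a + 1) + 1 = 4 * a + 3 by ring,
    show 2 * a + 1 + 1 = 2 * a + 2 by ring] at h2
  have e1 : (mk (2 * a) : ℂ) = 3 * a + 1 := by
    rw [mk, show 2 * a / 2 = a by omega, show 2 * a % 2 = 0 by omega]; push_cast; ring
  have e2 : (mk (2 * a + 1) : ℂ) = 3 * a + 2 := by
    rw [mk, show (2 * a + 1) / 2 = a by omega, show (2 * a + 1) % 2 = 1 by omega]; push_cast; ring
  rw [e1] at h1
  rw [e2] at h2
  have h3 := prod_three (2 * a)
  have h4 := prod_six (2 * a)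
  rw [show 3 * (2 * a) + 1 = 6 * a + 1 by ring] at h4
  rw [← h3, ← h4]
  simp only [prod_mul_distrib] at *
  linear_combination ((4 * a + 1).factorial : ℂ) * h2 +
    (∏ c ∈ range (2 * a), (3 * (c : ℂ) + 3)) * (∏ c ∈ range (2 * a), (3 * (c : ℂ) + 4)) *
      (6 * a + 3) * (3 * a + 2) * h1

lemma Gc_phi_two_odd_step (a : ℕ) :
    Gc phiP (2 * a + 3) (fun _ => 2) * ((4 * a + 3).factorial * (4 * a + 5).factorial : ℂ) =
      (3 * a + 4) * (3 * a + 2) * (6 * a + 3) * (6 * a + 2) * (6 * a + 3) * (6 * a + 5) *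
        (6 * a + 6) * ((6 * a + 1).factorial : ℂ) *
        (3 ^ (2 * a) * ((2 * a).factorial : ℂ)) * Gc phiP (2 * a + 1) (fun _ => 2) := by
  have h1 := Gc_phi_two_succ (2 * (a + 1))
  have h2 := Gc_phi_two_succ (2 * a + 1)
  rw [prod_mk_even, show 2 * (2 * (a + 1)) + 1 = 4 * a + 5 by ring,
    show 2 * (a + 1) + 1 = 2 * a + 3 by ring,
    show range (2 * (a + 1)) = range (2 * a + 1 + 1) by congr 1,
    prod_range_succ, prod_range_succ] at h1
  rw [prod_mk_odd, show 2 * (2 * a + 1) + 1 = 4 * a + 3 by ring,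
    show 2 * a + 1 + 1 = 2 * (a + 1) by ring] at h2
  have e1 : (mk (2 * (a + 1)) : ℂ) = 3 * a + 4 := by
    rw [mk, show 2 * (a + 1) / 2 = a + 1 by omega, show 2 * (a + 1) % 2 = 0 by omega]
    push_cast; ring
  have e2 : (mk (2 * a + 1) : ℂ) = 3 * a + 2 := by
    rw [mk, show (2 * a + 1) / 2 = a by omega, show (2 * a + 1) % 2 = 1 by omega]; push_cast; ring
  rw [e1] at h1
  rw [e2] at h2
  have h3 := prod_three (2 * a)
  have h4 := prod_six (2 * a)
  rw [show 3 * (2 * a) + 1 = 6 * a + 1 by ring] at h4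
  rw [← h3, ← h4]
  push_cast at h1
  simp only [prod_mul_distrib] at *
  linear_combination ((4 * a + 3).factorial : ℂ) * h1 +
    (3 * a + 4) * (∏ c ∈ range (2 * a), (3 * (c : ℂ) + 3)) *
      (∏ c ∈ range (2 * a), (3 * (c : ℂ) + 2)) *
      ((3 * (2 * a) + 3) * (3 * (2 * a) + 2)) * ((3 * (2 * a + 1) + 3) * (3 * (2 * a + 1) + 2)) * h2

lemma gammaN_even_step (a : ℕ) : (gammaN (2 * a + 2) : ℂ) * ((4 * a + 1).factorial *
    (4 * a + 3).factorial : ℂ) = (3 * a + 1) * (3 * a + 2) * (6 * a + 3) *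
      ((6 * a + 1).factorial : ℂ) * ((2 * a).factorial : ℂ) * gammaN (2 * a) := by
  have h : gammaN (2 * a + 2) * ((4 * a + 1).factorial * (4 * a + 3).factorial : ℝ) =
      (3 * a + 1) * (3 * a + 2) * (6 * a + 3) *
      ((6 * a + 1).factorial : ℝ) * ((2 * a).factorial : ℝ) * gammaN (2 * a) := by
    rw [gammaN, gammaN, if_pos (by omega), if_pos (by omega), show (2 * a + 2) / 2 = a + 1 by omega,
      show 2 * a / 2 = a by omega, prod_Icc_succ_top (by omega)]
    rw [show 6 * (a + 1) - 2 = 6 * a + 1 + 1 + 1 + 1 by omega,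
      show 2 * (a + 1) - 1 = 2 * a + 1 by omega,
      show 4 * (a + 1) - 2 = 4 * a + 1 + 1 by omega, show 4 * (a + 1) - 1 = 4 * a + 3 by omega,
      Nat.factorial_succ (6 * a + 1 + 1 + 1), Nat.factorial_succ (6 * a + 1 + 1),
      Nat.factorial_succ (6 * a + 1), Nat.factorial_succ (2 * a), Nat.factorial_succ (4 * a + 1)]
    have f1 := Nat.factorial_pos (4 * a + 1)
    have f2 := Nat.factorial_pos (4 * a + 3)
    generalize ∏ i ∈ Icc 1 a, ((Nat.factorial (6*i-2) : ℝ) * (Nat.factorial (2*i-1) : ℝ)) /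
        ((Nat.factorial (4*i-2) : ℝ) * (Nat.factorial (4*i-1) : ℝ)) = P
    push_cast
    field_simp
    ring
  exact_mod_cast congrArg (fun r : ℝ => (r : ℂ)) h

lemma gammaN_odd_step (a : ℕ) : (gammaN (2 * a + 3) : ℂ) * ((4 * a + 3).factorial *
    (4 * a + 5).factorial : ℂ) = (3 * a + 4) * (3 * a + 2) * (2 * a + 1) * (6 * a + 2) *
      (6 * a + 3) * (6 * a + 5) * (6 * a + 6) *
      ((6 * a + 1).factorial : ℂ) * ((2 * a).factorial : ℂ) * gammaN (2 * a + 1) := by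
  have h : gammaN (2 * a + 3) * ((4 * a + 3).factorial * (4 * a + 5).factorial : ℝ) =
      (3 * a + 4) * (3 * a + 2) * (2 * a + 1) * (6 * a + 2) *
      (6 * a + 3) * (6 * a + 5) * (6 * a + 6) *
      ((6 * a + 1).factorial : ℝ) * ((2 * a).factorial : ℝ) * gammaN (2 * a + 1) := by
    rw [gammaN, gammaN, if_neg (by omega), if_neg (by omega),
      show (2 * a + 3 + 1) / 2 = a + 1 + 1 by omega,
      show (2 * a + 1 + 1) / 2 = a + 1 by omega, prod_range_succ _ (a + 1)]
    rw [show 6 * (a + 1) = 6 * a + 1 + 1 + 1 + 1 + 1 + 1 by omega,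
      show 2 * (a + 1) = 2 * a + 1 + 1 by omega,
      show 4 * (a + 1) + 1 = 4 * a + 5 by omega, show 4 * (a + 1) = 4 * a + 3 + 1 by omega,
      Nat.factorial_succ (6 * a + 1 + 1 + 1 + 1 + 1), Nat.factorial_succ (6 * a + 1 + 1 + 1 + 1),
      Nat.factorial_succ (6 * a + 1 + 1 + 1), Nat.factorial_succ (6 * a + 1 + 1),
      Nat.factorial_succ (6 * a + 1), Nat.factorial_succ (2 * a + 1), Nat.factorial_succ (2 * a),
      Nat.factorial_succ (4 * a + 3)]
    have f1 := Nat.factorial_pos (4 * a + 5)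
    have f2 := Nat.factorial_pos (4 * a + 3)
    generalize ∏ i ∈ range (a + 1),
      (((3*i+1 : ℕ) : ℝ) * (Nat.factorial (6*i) : ℝ) * (Nat.factorial (2*i) : ℝ)) /
        ((Nat.factorial (4*i) : ℝ) * (Nat.factorial (4*i+1) : ℝ)) = P
    push_cast
    field_simp
    ring
  exact_mod_cast congrArg (fun r : ℝ => (r : ℂ)) h

lemma Gc_phi_two_even (a : ℕ) :
    Gc phiP (2 * a) (fun _ => 2) = 3 ^ (a * (a - 1)) * gammaN (2 * a) := by
  induction a with
  | zero => simp [Gc, gammaN]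
  | succ a ih =>
    have h1 := Gc_phi_two_even_step a
    have h2 := gammaN_even_step a
    have f1 : ((4 * a + 1).factorial : ℂ) ≠ 0 := Nat.cast_ne_zero.2 (Nat.factorial_ne_zero _)
    have f2 : ((4 * a + 3).factorial : ℂ) ≠ 0 := Nat.cast_ne_zero.2 (Nat.factorial_ne_zero _)
    have e : (a + 1) * (a + 1 - 1) = 2 * a + a * (a - 1) := by
      cases a <;> simp; ring
    rw [ih] at h1
    rw [e, pow_add, show 2 * (a + 1) = 2 * a + 2 by ring]
    refine mul_right_cancel₀ (mul_ne_zero f1 f2) ?_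
    linear_combination h1 - 3 ^ (2 * a) * 3 ^ (a * (a - 1)) * h2

lemma Gc_phi_two_odd (a : ℕ) :
    Gc phiP (2 * a + 1) (fun _ => 2) = 3 ^ (a * a) * gammaN (2 * a + 1) := by
  induction a with
  | zero => simp [Gc, gammaN, dd, phiP]
  | succ a ih =>
    have h1 := Gc_phi_two_odd_step a
    have h2 := gammaN_odd_step a
    have f1 : ((4 * a + 3).factorial : ℂ) ≠ 0 := Nat.cast_ne_zero.2 (Nat.factorial_ne_zero _)
    have f2 : ((4 * a + 5).factorial : ℂ) ≠ 0 := Nat.cast_ne_zero.2 (Nat.factorial_ne_zero _)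
    rw [ih] at h1
    rw [show (a + 1) * (a + 1) = 1 + 2 * a + a * a by ring, pow_add, pow_add, pow_one,
      show 2 * (a + 1) + 1 = 2 * a + 3 by ring]
    refine mul_right_cancel₀ (mul_ne_zero f1 f2) ?_
    linear_combination h1 - 3 * 3 ^ (2 * a) * 3 ^ (a * a) * h2

lemma Gc_phi_two_eq (m : ℕ) :
    Gc phiP m (fun _ => 2) = 3 ^ ((m / 2) * ((m - 1) / 2)) * gammaN m := by
  rcases Nat.even_or_odd' m with ⟨a, rfl | rfl⟩
  · rw [Gc_phi_two_even, show 2 * a / 2 = a by omega, show (2 * a - 1) / 2 = a - 1 by omega]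
  · rw [Gc_phi_two_odd, show (2 * a + 1) / 2 = a by omega, show (2 * a + 1 - 1) / 2 = a by omega]

end QKZ

namespace QKZ
open PowerSeries Matrix Finset

lemma eq_sum_add_X_pow_mul (f : ℂ⟦X⟧) (M : ℕ) :
    f = ∑ k ∈ range M, coeff k f • (X : ℂ⟦X⟧) ^ k + X ^ M * PowerSeries.mk fun i => coeff (i + M) f := by
  ext n
  rw [map_add, map_sum]
  simp only [map_smul, coeff_X_pow, smul_eq_mul, mul_ite, mul_one, mul_zero, coeff_X_pow_mul',
    coeff_mk, sum_ite_eq, mem_range]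
  by_cases h : n < M
  · simp [h]
  · rw [if_neg h, if_pos (by omega), Nat.sub_add_cancel (by omega), zero_add]

lemma map_eq_sum_coeff {l : ℂ⟦X⟧ →ₗ[ℂ] ℂ} {M : ℕ} (h : ∀ q, l (X ^ M * q) = 0) (f : ℂ⟦X⟧) :
    l f = ∑ k ∈ range M, coeff k f * l (X ^ k) := by
  conv_lhs => rw [eq_sum_add_X_pow_mul f M]
  rw [map_add, h, add_zero, map_sum]
  exact sum_congr rfl fun k _ => by rw [map_smul, smul_eq_mul]

lemma det_functional_coeff {l : ℕ → ℂ⟦X⟧ →ₗ[ℂ] ℂ} (h : ∀ j q, l j (X ^ (j + 1) * q) = 0)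
    (z : ℕ → ℂ⟦X⟧) (m : ℕ) : det (of fun i j : Fin m => l j (z i)) =
      (∏ j ∈ range m, l j (X ^ j)) * det (of fun i j : Fin m => coeff j (z i)) := by
  have hz : ∀ j k q, j < k → l j (X ^ k * q) = 0 := fun j k q hjk => by
    obtain ⟨d, rfl⟩ := Nat.exists_eq_add_of_lt hjk
    rw [show j + d + 1 = j + 1 + d by ring, pow_add, mul_assoc, h]
  have hdet : det (of fun k j : Fin m => l j (X ^ (k : ℕ))) = ∏ j ∈ range m, l j (X ^ j) := by
    rw [det_of_isUpperTriangular, ← Fin.prod_univ_eq_prod_range (fun j => l j (X ^ j))]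
    · rfl
    · intro k j hkj
      have := hz j k 1 hkj
      rwa [mul_one] at this
  rw [← hdet, mul_comm, ← det_mul]
  congr 1
  ext i j
  rw [mul_apply, of_apply, map_eq_sum_coeff (fun q => hz j m q j.2),
    ← Fin.sum_univ_eq_sum_range (fun k => coeff k (z i) * l j (X ^ k))]
  rfl

/-- The difference quotient at zero with respect to `v / (1 + v) ^ 3`. -/
def dl : ℂ⟦X⟧ →ₗ[ℂ] ℂ⟦X⟧ where
  toFun f := (1 + X) ^ 3 * PowerSeries.mk fun i => coeff (i + 1) f
  map_add' f g := by
    rw [← mul_add]; congr 1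
  map_smul' c f := by
    rw [RingHom.id_apply, ← mul_smul_comm]; congr 1

lemma X_mul_dl (f : ℂ⟦X⟧) : X * dl f = (1 + X) ^ 3 * (f - C (coeff 0 f)) := by
  rw [coeff_zero_eq_constantCoeff, sub_const_eq_X_mul_shift]
  simp only [dl, LinearMap.coe_mk, AddHom.coe_mk]
  ring

lemma dl_eq {f t : ℂ⟦X⟧} {a : ℂ} (h : X * t = (1 + X) ^ 3 * (f - C a)) : dl f = t := by
  have ha : a = coeff 0 f := by
    have := congrArg constantCoeff h
    simp at this
    rw [coeff_zero_eq_constantCoeff]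
    linear_combination this
  refine mul_left_cancel₀ X_ne_zero ?_
  rw [X_mul_dl, h, ha]

/-- The coefficients of the expansion in powers of `v / (1 + v) ^ 3`. -/
def WW (k : ℕ) : ℂ⟦X⟧ →ₗ[ℂ] ℂ := (coeff 0).comp (dl ^ k)

lemma WW_zero (f : ℂ⟦X⟧) : WW 0 f = coeff 0 f := rfl

lemma WW_succ (k : ℕ) (f : ℂ⟦X⟧) : WW (k + 1) f = WW k (dl f) := by
  rw [WW, WW, LinearMap.comp_apply, LinearMap.comp_apply, pow_succ, Module.End.mul_apply]

lemma WW_dl_pow (k i : ℕ) (f : ℂ⟦X⟧) : WW k ((dl ^ i) f) = WW (k + i) f := by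
  rw [WW, WW, LinearMap.comp_apply, LinearMap.comp_apply, pow_add, Module.End.mul_apply]

lemma dl_X_pow (k : ℕ) (q : ℂ⟦X⟧) : dl (X ^ (k + 1) * q) = X ^ k * ((1 + X) ^ 3 * q) :=
  dl_eq (a := 0) (by rw [map_zero, sub_zero]; ring)

lemma WW_X_pow (k : ℕ) (q : ℂ⟦X⟧) : WW k (X ^ k * q) = constantCoeff q := by
  induction k generalizing q with
  | zero => rw [WW_zero, pow_zero, one_mul, coeff_zero_eq_constantCoeff]
  | succ k ih => rw [WW_succ, dl_X_pow, ih]; simp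

lemma WW_X_pow_succ (k : ℕ) (q : ℂ⟦X⟧) : WW k (X ^ (k + 1) * q) = 0 := by
  rw [pow_succ, mul_assoc, WW_X_pow]; simp

/-- Coefficients in `u` of `1 / (1 - 3 * u * v - u ^ 2 * v - u * v ^ 2)`. -/
def cP : ℕ → ℂ⟦X⟧
  | 0 => 1
  | 1 => 3 * X + X ^ 2
  | i + 2 => (3 * X + X ^ 2) * cP (i + 1) + X * cP i

lemma dl_cP (i : ℕ) : dl ((1 + X) ^ 2 * cP (i + 3)) =
    (1 + X) ^ 2 * cP (i + 4) + (3 : ℂ) • ((1 + X) ^ 2 * cP (i + 3)) +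
      (3 : ℂ) • ((1 + X) ^ 2 * cP (i + 2)) + (1 + X) ^ 2 * cP (i + 1) := by
  refine dl_eq (a := 0) ?_
  rw [smul_eq_C_mul, smul_eq_C_mul, map_zero, show (C (3 : ℂ) : ℂ⟦X⟧) = 3 from rfl]
  rw [show i + 4 = i + 2 + 2 by rfl, cP, show i + 2 + 1 = i + 1 + 2 by rfl, cP,
    show i + 1 + 1 = i + 2 by rfl, cP]
  ring

lemma dl_cP_mem (i : ℕ) : dl ((1 + X) ^ 2 * cP i) - (1 + X) ^ 2 * cP (i + 1) ∈
    Submodule.span ℂ ((fun i => (1 + X) ^ 2 * cP i) '' (range (i + 1) : Finset ℕ)) := by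
  have mem : ∀ {a b : ℕ}, a < b → (1 + X) ^ 2 * cP a ∈
      Submodule.span ℂ ((fun i => (1 + X) ^ 2 * cP i) '' (range b : Finset ℕ)) :=
    fun h => Submodule.subset_span ⟨_, by simpa using h, rfl⟩
  match i with
  | 0 =>
    have : dl ((1 + X) ^ 2 * cP 0) = (1 + X) ^ 2 * cP 1 + (2 : ℂ) • ((1 + X) ^ 2 * cP 0) := by
      refine dl_eq (a := 1) ?_
      rw [smul_eq_C_mul, show (C (2 : ℂ) : ℂ⟦X⟧) = 2 from rfl, map_one, cP, cP]
      ring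
    rw [this, add_sub_cancel_left]
    exact Submodule.smul_mem _ _ (mem (by omega))
  | 1 =>
    have : dl ((1 + X) ^ 2 * cP 1) = (1 + X) ^ 2 * cP 2 + ((3 : ℂ) • ((1 + X) ^ 2 * cP 1) +
        (3 : ℂ) • ((1 + X) ^ 2 * cP 0)) := by
      refine dl_eq (a := 0) ?_
      rw [smul_eq_C_mul, smul_eq_C_mul, show (C (3 : ℂ) : ℂ⟦X⟧) = 3 from rfl, map_zero]
      simp only [cP]
      ring
    rw [this, add_sub_cancel_left]
    exact add_mem (Submodule.smul_mem _ _ (mem (by omega)))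
      (Submodule.smul_mem _ _ (mem (by omega)))
  | 2 =>
    have : dl ((1 + X) ^ 2 * cP 2) = (1 + X) ^ 2 * cP 3 + ((3 : ℂ) • ((1 + X) ^ 2 * cP 2) +
        (3 : ℂ) • ((1 + X) ^ 2 * cP 1) + (1 + X) ^ 2 * cP 0) := by
      refine dl_eq (a := 0) ?_
      rw [smul_eq_C_mul, smul_eq_C_mul, show (C (3 : ℂ) : ℂ⟦X⟧) = 3 from rfl, map_zero]
      simp only [cP]
      ring
    rw [this, add_sub_cancel_left]
    exact add_mem (add_mem (Submodule.smul_mem _ _ (mem (by omega)))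
      (Submodule.smul_mem _ _ (mem (by omega)))) (mem (by omega))
  | i + 3 =>
    rw [dl_cP, show ∀ a b c d : ℂ⟦X⟧, a + b + c + d - a = b + c + d by intros; ring]
    exact add_mem (add_mem (Submodule.smul_mem _ _ (mem (by omega)))
      (Submodule.smul_mem _ _ (mem (by omega)))) (mem (by omega))

/-- The power series `3 / (1 + v)`. -/
def rS : ℂ⟦X⟧ := C 3 * (1 + X)⁻¹

lemma one_add_X_mul_inv : (1 + X : ℂ⟦X⟧) * (1 + X)⁻¹ = 1 := PowerSeries.mul_inv_cancel _ (by simp)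

lemma one_add_X_mul_rS : (1 + X) * rS = 3 := by
  rw [rS, mul_left_comm, one_add_X_mul_inv, mul_one]; rfl

lemma dl_pow_rS_mem (i : ℕ) : (dl ^ (i + 1)) rS - (-3 : ℂ) • ((1 + X) ^ 2 * cP i) ∈
    Submodule.span ℂ ((fun i => (1 + X) ^ 2 * cP i) '' (range i : Finset ℕ)) := by
  induction i with
  | zero =>
    have : dl rS = (-3 : ℂ) • ((1 + X) ^ 2 * cP 0) := by
      refine dl_eq (a := 3) ?_
      rw [smul_eq_C_mul, show (C (3 : ℂ) : ℂ⟦X⟧) = 3 from rfl, map_neg,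
        show (C (3 : ℂ) : ℂ⟦X⟧) = 3 from rfl, cP]
      linear_combination -(1 + X) ^ 2 * one_add_X_mul_rS
    rw [zero_add, pow_one, this, sub_self]
    exact zero_mem _
  | succ i ih =>
    have hd : ∀ p ∈ Submodule.span ℂ ((fun i => (1 + X) ^ 2 * cP i) '' (range i : Finset ℕ)),
        dl p ∈ Submodule.span ℂ ((fun i => (1 + X) ^ 2 * cP i) '' (range (i + 1) : Finset ℕ)) := by
      intro p hp
      induction hp using Submodule.span_induction with
      | mem x hx =>
        obtain ⟨k, hk, rfl⟩ := hx
        have hk : k < i := by simpa using hk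
        have h1 := Submodule.span_mono (Set.image_mono
          (Finset.coe_subset.2 (range_mono (by omega : k + 1 ≤ i + 1)))) (dl_cP_mem k)
        have h2 : (1 + X) ^ 2 * cP (k + 1) ∈ Submodule.span ℂ
          ((fun i => (1 + X) ^ 2 * cP i) '' (range (i + 1) : Finset ℕ)) :=
          Submodule.subset_span ⟨_, by simpa using hk, rfl⟩
        simpa using add_mem h1 h2
      | zero => rw [map_zero]; exact zero_mem _
      | add x y _ _ hx hy => rw [map_add]; exact add_mem hx hy
      | smul a x _ hx => rw [map_smul]; exact Submodule.smul_mem _ _ hx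
    have h1 := hd _ ih
    rw [map_sub, map_smul, ← Module.End.mul_apply, ← pow_succ'] at h1
    have h2 := Submodule.smul_mem _ (-3 : ℂ) (dl_cP_mem i)
    rw [smul_sub] at h2
    simpa using add_mem h1 h2

end QKZ

namespace QKZ
open PowerSeries Matrix Finset

/-- The power series `1 - 3 * u * v - u ^ 2 * v - u * v ^ 2` in `v`. -/
def nrm (u : ℂ) : ℂ⟦X⟧ := 1 - C (3 * u + u ^ 2) * X - C u * X ^ 2

lemma constantCoeff_nrm (u : ℂ) : constantCoeff (nrm u) = 1 := by simp [nrm]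

lemma nrm_mul_inv (u : ℂ) : nrm u * (nrm u)⁻¹ = 1 :=
  PowerSeries.mul_inv_cancel _ (by simp [constantCoeff_nrm])

/-- The rows of the bordered Hankel matrix. -/
def hRow (n : ℕ) (u : ℂ) (i : ℕ) : ℂ⟦X⟧ :=
  if i < n then (dl ^ (i + 1)) rS else (-3 : ℂ) • ((1 + X) ^ 2 * (C ((1 + u) ^ 2) * (nrm u)⁻¹))

/-- The rows of the reduced matrix. -/
def zRow (n : ℕ) (u : ℂ) (i : ℕ) : ℂ⟦X⟧ := if i < n then nrm u * cP i else C ((1 + u) ^ 2)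

lemma det_WW_hRow (n : ℕ) (u : ℂ) : det (of fun i j : Fin (n + 1) => WW j (hRow n u i)) =
    (-3) ^ (n + 1) * det (of fun i j : Fin (n + 1) => coeff j (zRow n u i)) := by
  set c : ℂ⟦X⟧ := (-3 : ℂ) • ((1 + X) ^ 2 * (nrm u)⁻¹) with hc
  have h1 := det_unitriangular_functional (f := hRow n u) (g := fun i => c * zRow n u i)
    (fun i => by
      have e : ∀ k < n, c * zRow n u k = (-3 : ℂ) • ((1 + X) ^ 2 * cP k) := fun k hk => by
        rw [zRow, if_pos hk, hc, smul_eq_C_mul, smul_eq_C_mul]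
        linear_combination (C (-3)) * (1 + X) ^ 2 * cP k * nrm_mul_inv u
      by_cases hi : i < n
      · rw [hRow, if_pos hi]
        simp only [e i hi]
        refine Submodule.span_le.2 ?_ (dl_pow_rS_mem i)
        rintro _ ⟨k, hk, rfl⟩
        have hk : k < i := by simpa using hk
        have : (1 + X) ^ 2 * cP k = (-3⁻¹ : ℂ) • (c * zRow n u k) := by
          rw [e k (by omega), smul_smul]; norm_num
        change (1 + X) ^ 2 * cP k ∈ _
        rw [this]
        exact Submodule.smul_mem _ _ (Submodule.subset_span ⟨k, by simpa using hk, rfl⟩)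
      · have : hRow n u i - c * zRow n u i = 0 := by
          rw [hRow, zRow, if_neg hi, if_neg hi, hc, smul_eq_C_mul, smul_eq_C_mul]
          ring
        simp only [this]
        exact zero_mem _) (n + 1) WW
  rw [← det_transpose] at h1
  have h2 := det_functional_coeff (l := fun j => (WW j).comp (LinearMap.mulLeft ℂ c))
    (fun j q => by
      rw [LinearMap.comp_apply, LinearMap.mulLeft_apply, mul_left_comm, WW_X_pow_succ])
    (zRow n u) (n + 1)
  have h3 : ∀ j, ((WW j).comp (LinearMap.mulLeft ℂ c)) (X ^ j) = -3 := fun j => by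
    rw [LinearMap.comp_apply, LinearMap.mulLeft_apply, mul_comm, WW_X_pow, hc, smul_eq_C_mul]
    simp [constantCoeff_nrm]
  simp only [h3, prod_const, card_range] at h2
  rw [← h2, ← det_transpose (of fun i j : Fin (n + 1) => ((WW (j : ℕ)).comp _) _)]
  exact h1

/-- The rows of the matrix of binomial coefficients. -/
def bP : ℕ → ℂ⟦X⟧
  | 0 => 1
  | i + 1 => cP (i + 1) + cP i

lemma det_coeff_zRow {n : ℕ} {u : ℂ} (hu : u ≠ 0) :
    det (of fun i j : Fin (n + 1) => coeff j (zRow n u i)) = (1 + u) ^ 2 * u ^ n *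
      det (of fun i j : Fin n => coeff (j + 1) (bP (i + 1)) + u * coeff j (bP i)) := by
  rw [det_succ_row _ (Fin.last n), sum_eq_single 0 (fun j _ hj => by
    have hj' : (j : ℕ) ≠ 0 := fun h => hj (Fin.ext h)
    rw [of_apply, Fin.val_last, zRow, if_neg (lt_irrefl n), coeff_C, if_neg hj', mul_zero,
      zero_mul]) (by simp)]
  have e0 : (of fun i j : Fin (n + 1) => coeff (j : ℕ) (zRow n u i)) (Fin.last n) 0 =
      (1 + u) ^ 2 := by
    rw [of_apply, Fin.val_last, zRow, if_neg (lt_irrefl n)]; simp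
  rw [e0]
  set E : ℕ → ℂ⟦X⟧ := fun i => cP (i + 1) + C u * (X * cP i) with hE
  set f : ℕ → ℂ⟦X⟧ := fun i => (if i = 0 then 0 else E (i - 1)) - C u * E i with hf
  set l : ℕ → ℂ⟦X⟧ →ₗ[ℂ] ℂ := fun j => coeff (j + 1) with hl
  have hsub : ((of fun i j : Fin (n + 1) => coeff (j : ℕ) (zRow n u i)).submatrix
      (Fin.last n).succAbove (0 : Fin (n + 1)).succAbove) =
      (of fun j i : Fin n => l j (f i))ᵀ := by
    ext i j
    rw [submatrix_apply, transpose_apply, of_apply, of_apply, Fin.succAbove_last,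
      Fin.succAbove_zero, Fin.val_castSucc, Fin.val_succ, zRow, if_pos i.2]
    obtain ⟨i, hi⟩ := i
    simp only
    match i with
    | 0 =>
      have : nrm u * cP 0 = f 0 + 1 := by
        simp only [hf, hE, nrm, cP, if_true, map_add, map_mul, map_pow]
        rw [show (C (3 : ℂ) : ℂ⟦X⟧) = 3 from rfl]
        ring
      rw [this, map_add, coeff_one, if_neg (by omega), add_zero]
    | i + 1 =>
      have : nrm u * cP (i + 1) = f (i + 1) := by
        simp only [hf, hE, if_neg (Nat.succ_ne_zero i), Nat.add_sub_cancel, nrm]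
        rw [show i + 1 + 1 = i + 2 by rfl, cP]
        simp only [map_add, map_mul, map_pow]
        rw [show (C (3 : ℂ) : ℂ⟦X⟧) = 3 from rfl]
        ring
      rw [this]
  have mem : ∀ {G : ℕ → ℂ⟦X⟧} {a b : ℕ}, a < b →
      G a ∈ Submodule.span ℂ (G '' (range b : Finset ℕ)) :=
    fun h => Submodule.subset_span ⟨_, by simpa using h, rfl⟩
  have h1 := det_unitriangular_functional (f := f) (g := fun i => (-u) • E i) (fun i => by
    match i with
    | 0 =>
      have : f 0 - (-u) • E 0 = 0 := by simp [hf, smul_eq_C_mul]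
      simp only [this]
      exact zero_mem _
    | i + 1 =>
      have : f (i + 1) - (-u) • E (i + 1) = (-u)⁻¹ • ((-u) • E i) := by
        rw [inv_smul_smul₀ (neg_ne_zero.2 hu)]
        simp [hf, smul_eq_C_mul]
      simp only [this]
      exact Submodule.smul_mem _ _ (mem (G := fun i => (-u) • E i) (Nat.lt_succ_self i))) n l
  have h2 := det_unitriangular_functional
    (f := fun i => E i + if i = 0 then 0 else E (i - 1)) (g := E) (fun i => by
    match i with
    | 0 => simp
    | i + 1 => simpa using mem (Nat.lt_succ_self i)) n l
  rw [hsub, det_transpose, h1]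
  simp only [map_smul, smul_eq_mul]
  rw [show (of fun i j : Fin n => -u * l i (E j)) = (-u) • of fun i j : Fin n => l i (E j) by
    ext i j; rfl, det_smul, ← h2, ← det_transpose, Fintype.card_fin]
  have e2 : (of fun i j : Fin n => l i (E j + if (j : ℕ) = 0 then 0 else E (j - 1)))ᵀ =
      of fun i j : Fin n => coeff (j + 1) (bP (i + 1)) + u * coeff j (bP i) := by
    ext i j
    rw [transpose_apply, of_apply, of_apply]
    obtain ⟨i, hi⟩ := i
    simp only [hl]
    match i with
    | 0 => simp [hE, bP, cP, coeff_C, coeff_one]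
    | i + 1 =>
      simp only [if_neg (Nat.succ_ne_zero i), Nat.add_sub_cancel, hE, bP]
      simp only [map_add, coeff_C_mul, coeff_succ_X_mul]
      ring
  rw [e2]
  have : (-1 : ℂ) ^ n * (-1) ^ n = 1 := by rw [← mul_pow]; norm_num
  rw [Fin.val_last, Fin.val_zero, add_zero, neg_pow]
  generalize det (of fun i j : Fin n => coeff (j + 1) (bP (i + 1)) + u * coeff j (bP i)) = d
  linear_combination (1 + u) ^ 2 * u ^ n * d * this

lemma bP_add_two (i : ℕ) : bP (i + 2) = (3 * X + X ^ 2) * bP (i + 1) + X * bP i := by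
  match i with
  | 0 => simp only [bP, cP]; ring
  | i + 1 => simp only [bP, cP]; ring

/-- Binomial coefficients with an integer lower index. -/
def ich (a : ℕ) (k : ℤ) : ℕ := if 0 ≤ k then a.choose k.toNat else 0

lemma ich_succ (a : ℕ) (k : ℤ) : ich (a + 1) (k + 1) = ich a k + ich a (k + 1) := by
  rcases lt_trichotomy k (-1) with h | rfl | h
  · rw [ich, ich, ich, if_neg (by omega), if_neg (by omega), if_neg (by omega)]
  · simp [ich]
  · obtain ⟨k, rfl⟩ := Int.eq_ofNat_of_zero_le (show 0 ≤ k by omega)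
    rw [ich, ich, ich, if_pos (by omega), if_pos (by omega), if_pos (by omega)]
    exact Nat.choose_succ_succ' a k

lemma ich_of_neg (a : ℕ) {k : ℤ} (h : k < 0) : ich a k = 0 := if_neg (by omega)

lemma coeff_bP (i j : ℕ) : coeff j (bP i) = (ich (i + j + 1) (2 * i - j) : ℂ) := by
  have X2 : ∀ (f : ℂ⟦X⟧), coeff 1 (X ^ 2 * f) = 0 := fun f => by
    rw [pow_two, mul_assoc, ← zero_add 1, coeff_succ_X_mul]; simp
  have X1 : ∀ (f : ℂ⟦X⟧), coeff 1 (X * f) = coeff 0 f := fun f => coeff_succ_X_mul 0 f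
  have X2' : ∀ (k : ℕ) (f : ℂ⟦X⟧), coeff (k + 2) (X ^ 2 * f) = coeff k f := fun k f => by
    rw [pow_two, mul_assoc, coeff_succ_X_mul, coeff_succ_X_mul]
  have c3 : (3 : ℂ⟦X⟧) = C 3 := rfl
  induction i using Nat.strong_induction_on generalizing j with
  | _ i ih =>
  match i, j with
  | 0, 0 => simp [bP, ich]
  | 0, j + 1 => rw [ich_of_neg _ (by push_cast; omega)]; simp [bP, coeff_one]
  | 1, 0 => simp [bP, cP, ich, c3]
  | 1, 1 => simp [bP, cP, ich, c3, coeff_X_pow, coeff_one]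
  | 1, 2 => simp [bP, cP, ich, c3, coeff_X_pow, coeff_one]
  | 1, j + 3 =>
    rw [ich_of_neg _ (by push_cast; omega)]
    simp [bP, cP, c3, coeff_X_pow, coeff_one]
  | i + 2, 0 =>
    rw [bP_add_two]
    simp [ich, Nat.choose_eq_zero_of_lt (show i + 2 + 1 < (2 * ((i : ℤ) + 2)).toNat by omega)]
  | i + 2, 1 =>
    have h1 := ih (i + 1) (by omega) 0
    have h2 := ih i (by omega) 0
    rw [bP_add_two, add_mul, c3, mul_assoc, map_add, map_add, coeff_C_mul, X2,
      X1, X1, h1, h2]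
    match i with
    | 0 => simp [ich]; norm_num [Nat.choose]
    | 1 => simp [ich]
    | i + 2 =>
      have e : ∀ (a : ℕ) (k : ℤ), a < k → ich a k = 0 := fun a k h => by
        rw [ich, if_pos (by omega), Nat.choose_eq_zero_of_lt (by omega)]
      rw [e _ _ (by push_cast; omega), e _ _ (by push_cast; omega), e _ _ (by push_cast; omega)]
      simp
  | i + 2, j + 2 =>
    have h1 := ih (i + 1) (by omega) (j + 1)
    have h2 := ih (i + 1) (by omega) j
    have h3 := ih i (by omega) (j + 1)
    rw [bP_add_two, add_mul, c3, mul_assoc, map_add, map_add, coeff_C_mul, X2', coeff_succ_X_mul,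
      coeff_succ_X_mul, h1, h2, h3]
    rw [show i + 1 + (j + 1) + 1 = i + j + 2 + 1 by ring, show i + 1 + j + 1 = i + j + 2 by ring,
      show i + (j + 1) + 1 = i + j + 2 by ring,
      show i + 2 + (j + 2) + 1 = i + j + 2 + 1 + 1 + 1 by ring]
    push_cast
    rw [show (2 * ((i : ℤ) + 2) - (j + 2)) = 2 * (i : ℤ) - (j + 1) + 1 + 1 + 1 by ring,
      show (2 * ((i : ℤ) + 1) - (j + 1)) = 2 * (i : ℤ) - (j + 1) + 1 + 1 by ring,
      show (2 * ((i : ℤ) + 1) - j) = 2 * (i : ℤ) - (j + 1) + 1 + 1 + 1 by ring]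
    simp only [ich_succ]
    push_cast
    ring

end QKZ

namespace QKZ
open PowerSeries Matrix Finset

/-- The power series `v / (1 + v) ^ 3`. -/
def wS : ℂ⟦X⟧ := X * ((1 + X)⁻¹) ^ 3

lemma dl_wS_mul (f : ℂ⟦X⟧) : dl (wS * f) = f := by
  refine dl_eq (a := 0) ?_
  have h : (1 + X : ℂ⟦X⟧) ^ 3 * ((1 + X)⁻¹) ^ 3 = 1 := by
    rw [← mul_pow, one_add_X_mul_inv, one_pow]
  rw [map_zero, sub_zero, wS]
  linear_combination -X * f * h

lemma WW_wS_pow_mul (k a : ℕ) (f : ℂ⟦X⟧) :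
    WW k (wS ^ a * f) = if a ≤ k then WW (k - a) f else 0 := by
  induction a generalizing k with
  | zero => simp
  | succ a ih =>
    rw [pow_succ', mul_assoc]
    match k with
    | 0 => rw [WW_zero, if_neg (by omega)]; simp [wS]
    | k + 1 => rw [WW_succ, dl_wS_mul, ih, Nat.add_sub_add_right]; simp

lemma WW_one (k : ℕ) : WW k 1 = if k = 0 then 1 else 0 := by
  match k with
  | 0 => simp [WW_zero]
  | k + 1 =>
    rw [WW_succ, dl_eq (a := 1) (t := 0) (by simp), map_zero, if_neg (by omega)]

/-- Substitution of `3 / (1 + v) - 1` into polynomials. -/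
def io : Polynomial ℂ →ₐ[ℂ] ℂ⟦X⟧ := Polynomial.aeval (rS - 1)

lemma io_X : io Polynomial.X = rS - 1 := Polynomial.aeval_X _

lemma io_C (a : ℂ) : io (Polynomial.C a) = C a := Polynomial.aeval_C _ a

lemma rS_sub : rS - 3 = X * (C (-3) * (1 + X)⁻¹) := by
  rw [rS, map_neg, show (C (3 : ℂ) : ℂ⟦X⟧) = 3 from rfl]
  linear_combination 3 * one_add_X_mul_inv

/-- The functionals defining the rows of the confluent matrix. -/
def rowF (n : ℕ) (X0 : ℂ) (k : ℕ) : Polynomial ℂ →ₗ[ℂ] ℂ :=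
  if k < 2 * n + 1 then (WW k).comp io.toLinearMap else Polynomial.leval X0

lemma rowF_lt {n k : ℕ} (h : k < 2 * n + 1) (X0 : ℂ) (p : Polynomial ℂ) :
    rowF n X0 k p = WW k (io p) := by
  rw [rowF, if_pos h]; rfl

lemma rowF_last {n k : ℕ} (h : ¬k < 2 * n + 1) (X0 : ℂ) (p : Polynomial ℂ) :
    rowF n X0 k p = p.eval X0 := by
  rw [rowF, if_neg h]; rfl

lemma det_rowF (p : ℕ → Polynomial ℂ) (n : ℕ) (X0 : ℂ) :
    det (of fun k j : Fin (2 * n + 2) => rowF n X0 k (p j)) =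
      (∏ k ∈ range (2 * n + 1), (-3 : ℂ) ^ k) * (X0 - 2) ^ (2 * n + 1) *
        Gc p (2 * n + 2) (fun i => if i < 2 * n + 1 then 2 else X0) := by
  set w : ℕ → ℂ := fun i => if i < 2 * n + 1 then 2 else X0 with hw
  set L : Matrix (Fin (2 * n + 2)) (Fin (2 * n + 2)) ℂ :=
    of fun k i => rowF n X0 k ((Polynomial.X - Polynomial.C 2) ^ (i : ℕ)) with hL
  have hio : ∀ i : ℕ, io ((Polynomial.X - Polynomial.C 2) ^ i) =
      X ^ i * (C (-3) * (1 + X)⁻¹) ^ i := fun i => by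
    rw [map_pow, map_sub, io_X, io_C, ← mul_pow, ← rS_sub, show (C (2 : ℂ) : ℂ⟦X⟧) = 2 from rfl]
    ring
  have hL0 : ∀ k < 2 * n + 1, ∀ q : ℂ⟦X⟧, ∀ i, k < i → WW k (X ^ i * q) = 0 := by
    intro k _ q i hi
    obtain ⟨d, rfl⟩ := Nat.exists_eq_add_of_lt hi
    rw [show k + d + 1 = k + 1 + d by ring, pow_add, mul_assoc, WW_X_pow_succ]
  have hdet : det L = (∏ k ∈ range (2 * n + 1), (-3 : ℂ) ^ k) * (X0 - 2) ^ (2 * n + 1) := by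
    rw [det_of_isLowerTriangular L, ← Fin.prod_univ_eq_prod_range, Fin.prod_univ_castSucc]
    · congr 1
      · refine Finset.prod_congr rfl fun k _ => ?_
        rw [hL, of_apply, rowF_lt (by rw [Fin.val_castSucc]; exact k.2), hio, Fin.val_castSucc,
          WW_X_pow]
        simp
      · rw [hL, of_apply, rowF_last (by simp)]
        simp
    · intro k i hki
      have hki : (k : ℕ) < i := hki
      have := i.2
      rw [hL, of_apply, rowF_lt (by omega), hio, hL0 k (by omega) _ _ hki]
  have hprod : ∀ i < 2 * n + 2, ∏ s ∈ range i, (Polynomial.X - Polynomial.C (w s)) =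
      (Polynomial.X - Polynomial.C 2) ^ i := fun i hi => by
    have : ∀ s ∈ range i, Polynomial.X - Polynomial.C (w s) = Polynomial.X - Polynomial.C 2 :=
      fun s hs => by
        have : s < 2 * n + 1 := by rw [mem_range] at hs; omega
        simp only [hw, if_pos this]
    rw [Finset.prod_congr rfl this, prod_const, card_range]
  rw [← hdet, Gc, ← det_mul]
  congr 1
  ext k j
  rw [mul_apply, of_apply]
  have hrem : rowF n X0 k (dd (p j) w (2 * n + 2) *
      ∏ s ∈ range (2 * n + 2), (Polynomial.X - Polynomial.C (w s))) = 0 := by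
    rw [prod_range_succ, hprod _ (by omega)]
    by_cases hk : (k : ℕ) < 2 * n + 1
    · rw [rowF_lt hk, map_mul, map_mul io, hio, mul_left_comm, mul_assoc, hL0 k hk _ _ hk]
    · rw [rowF_last hk]; simp [hw]
  conv_lhs => rw [dd_expand (p j) w (2 * n + 2)]
  rw [map_add, hrem, add_zero, map_sum, ← Fin.sum_univ_eq_sum_range (fun i =>
    rowF n X0 k (Polynomial.C ((dd (p j) w i).eval (w i)) *
      ∏ s ∈ range i, (Polynomial.X - Polynomial.C (w s))))]
  refine Finset.sum_congr rfl fun i _ => ?_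
  rw [hprod i i.2, ← Polynomial.smul_eq_C_mul, map_smul, hL, of_apply, of_apply, smul_eq_mul,
    mul_comm]

/-- `(T - 2) ^ (j / 2) * (X + 1) ^ (j % 2)` where `T = X ^ 3 - 3 X`. -/
def hP (j : ℕ) : Polynomial ℂ :=
  (tP - Polynomial.C 2) ^ (j / 2) * (Polynomial.X + Polynomial.C 1) ^ (j % 2)

lemma hP_add_two (j : ℕ) : hP (j + 2) = (tP - Polynomial.C 2) * hP j := by
  rw [hP, hP, show (j + 2) / 2 = j / 2 + 1 by omega, show (j + 2) % 2 = j % 2 by omega]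
  ring

lemma hP_sub_phiP (j : ℕ) :
    hP j - phiP j ∈ Submodule.span ℂ (phiP '' (range j : Finset ℕ)) := by
  have mono : ∀ {a b : ℕ}, a ≤ b → Submodule.span ℂ (phiP '' (range a : Finset ℕ)) ≤
      Submodule.span ℂ (phiP '' (range b : Finset ℕ)) := fun h =>
    Submodule.span_mono (Set.image_mono (Finset.coe_subset.2 (range_mono h)))
  have mem : ∀ {a b : ℕ}, a < b → phiP a ∈ Submodule.span ℂ (phiP '' (range b : Finset ℕ)) :=
    fun h => Submodule.subset_span ⟨_, by simpa using h, rfl⟩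
  induction j using Nat.twoStepInduction with
  | zero => simp [hP, phiP]
  | one =>
    have : hP 1 - phiP 1 = phiP 0 := by simp [hP, phiP]
    rw [this]
    exact mem (by omega)
  | more j ih _ =>
    have : hP (j + 2) - phiP (j + 2) = tP * (hP j - phiP j) +
        (-2 : ℂ) • ((hP j - phiP j) + phiP j) := by
      rw [hP_add_two, phiP_add_two, Polynomial.smul_eq_C_mul, Polynomial.C_neg]
      ring
    rw [this]
    exact add_mem (tP_mul_mem ih)
      (Submodule.smul_mem _ _ (add_mem (mono (by omega) ih) (mem (by omega))))

lemma io_tP_sub : io (tP - Polynomial.C 2) = C (-27) * wS := by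
  have h := one_add_X_mul_inv
  rw [tP, map_sub, map_sub, map_mul, map_pow, io_X, io_C, io_C, rS, wS, map_neg,
    show (C (3 : ℂ) : ℂ⟦X⟧) = 3 from rfl, show (C (2 : ℂ) : ℂ⟦X⟧) = 2 from rfl,
    show (C (27 : ℂ) : ℂ⟦X⟧) = 27 from rfl]
  linear_combination (27 * ((1 + X : ℂ⟦X⟧)⁻¹) ^ 2) * h

lemma io_hP (j : ℕ) : io (hP j) = (-27 : ℂ) ^ (j / 2) • (wS ^ (j / 2) * rS ^ (j % 2)) := by
  rw [hP, map_mul, map_pow, map_pow, io_tP_sub, map_add, io_X, io_C, map_one, sub_add_cancel,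
    mul_pow, smul_eq_C_mul, map_pow]
  ring

lemma eval_hP {u : ℂ} (hu : 1 + u ≠ 0) (j : ℕ) : (hP j).eval (3 / (1 + u) - 1) =
    (-27 : ℂ) ^ (j / 2) * ((u / (1 + u) ^ 3) ^ (j / 2) * (3 / (1 + u)) ^ (j % 2)) := by
  have e : (3 / (1 + u) - 1) ^ 3 - 3 * (3 / (1 + u) - 1) - 2 = -27 * (u / (1 + u) ^ 3) := by
    field_simp
    ring
  rw [hP, tP]
  simp only [Polynomial.eval_mul, Polynomial.eval_pow, Polynomial.eval_sub, Polynomial.eval_add,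
    Polynomial.eval_X, Polynomial.eval_C, sub_add_cancel]
  rw [e, mul_pow, mul_assoc]

end QKZ

namespace QKZ
open PowerSeries Matrix Finset

/-- The map `2 b ↦ b`, `2 b + 1 ↦ 2 m - 1 - b`. -/
def rI (m i : ℕ) : ℕ := if i % 2 = 0 then i / 2 else 2 * m - 1 - i / 2

/-- `rI` as a permutation. -/
def rho (m : ℕ) : Equiv.Perm (Fin (2 * m)) :=
  Equiv.ofBijective (fun i => ⟨rI m i, by have := i.2; rw [rI]; split_ifs <;> omega⟩)
    (Finite.injective_iff_bijective.1 fun i j h => by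
      have h := Fin.mk.inj h
      have := i.2
      have := j.2
      ext
      rw [rI, rI] at h
      split_ifs at h <;> omega)

lemma rho_apply (m : ℕ) (i : Fin (2 * m)) : (rho m i : ℕ) = rI m i := rfl

lemma sign_rho (m : ℕ) : Equiv.Perm.sign (rho m) = 1 := by
  rw [Equiv.Perm.sign_eq_prod_prod_Iio]
  have e : ∀ j : Fin (2 * m), (∏ i ∈ Iio j, if rho m i < rho m j then (1 : ℤˣ) else -1) =
      (-1) ^ ((j : ℕ) / 2) := by
    intro j
    have e1 : (∏ i ∈ Iio j, if rho m i < rho m j then (1 : ℤˣ) else -1) =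
        ∏ i ∈ range j, if rI m i < rI m j then (1 : ℤˣ) else -1 := by
      have : range j = (Iio j).map Fin.valEmbedding := by
        rw [Fin.map_valEmbedding_Iio]
        ext; simp
      rw [this, prod_map]
      rfl
    have hj := j.2
    have pr : ∀ a, ∏ i ∈ range (2 * a), (fun i => if i % 2 = 0 then (1 : ℤˣ) else -1) i =
        (-1) ^ a := by
      intro a
      induction a with
      | zero => rfl
      | succ a ih =>
        rw [show 2 * (a + 1) = 2 * a + 1 + 1 by ring, prod_range_succ, prod_range_succ, ih,
          pow_succ]
        simp
    have ev : ∀ i < (j : ℕ), (if rI m i < rI m j then (1 : ℤˣ) else -1) =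
        if i % 2 = 0 then 1 else -1 := by
      intro i hi
      congr 1
      rw [rI, rI]
      split_ifs <;> apply propext <;> constructor <;> intro <;> omega
    rw [e1, prod_congr rfl fun i hi => ev i (mem_range.1 hi)]
    obtain h | h : (j : ℕ) = 2 * (j / 2) ∨ (j : ℕ) = 2 * (j / 2) + 1 := by omega
    · conv_lhs => rw [h]
      exact pr _
    · conv_lhs => rw [h]
      rw [prod_range_succ, pr]
      simp
  rw [prod_congr rfl fun j _ => e j, Fin.prod_univ_eq_prod_range (fun j => (-1 : ℤˣ) ^ (j / 2))]
  clear e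
  induction m with
  | zero => rfl
  | succ a ih =>
    rw [show 2 * (a + 1) = 2 * a + 1 + 1 by ring, prod_range_succ, prod_range_succ, ih,
      show (2 * a + 1) / 2 = a by omega, show 2 * a / 2 = a by omega, one_mul, ← mul_pow]
    simp

/-- The standard splitting of `Fin (2 * m)` into two halves. -/
def halves (m : ℕ) : Fin m ⊕ Fin m ≃ Fin (2 * m) :=
  finSumFinEquiv.trans (finCongr (by ring))

lemma det_eq_det_blocks {m : ℕ} (e : ℕ → ℕ → ℂ)
    (h : ∀ a < m, ∀ b < m, e a (2 * b) = if a = b then 1 else 0) :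
    det (of fun i j : Fin (2 * m) => e i j) =
      det (of fun i j : Fin m => e (m + i) (2 * (m - 1 - j) + 1) -
        ∑ a ∈ range m, e (m + i) (2 * a) * e a (2 * (m - 1 - j) + 1)) := by
  have hs : Equiv.Perm.sign (rho m).symm = 1 := by
    rw [Equiv.Perm.sign_symm, sign_rho]
  have h1 := Matrix.det_permute' (rho m).symm (of fun i j : Fin (2 * m) => e i j)
  rw [hs] at h1
  simp only [Units.val_one, Int.cast_one, one_mul] at h1
  rw [← h1, ← Matrix.det_submatrix_equiv_self (halves m)]
  have cl : ∀ b : Fin m, ((rho m).symm (halves m (Sum.inl b)) : ℕ) = 2 * b := by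
    intro b
    have hb := b.2
    rw [(Equiv.symm_apply_eq (rho m) (y := ⟨2 * b, by omega⟩)).2]
    ext
    rw [rho_apply, rI, if_pos (by simp)]
    simp [halves]
  have cr : ∀ b : Fin m, ((rho m).symm (halves m (Sum.inr b)) : ℕ) = 2 * (m - 1 - b) + 1 := by
    intro b
    have hb := b.2
    rw [(Equiv.symm_apply_eq (rho m) (y := ⟨2 * (m - 1 - b) + 1, by omega⟩)).2]
    ext
    rw [rho_apply, rI, if_neg (by simp)]
    simp [halves]
    omega
  have rl : ∀ b : Fin m, (halves m (Sum.inl b) : ℕ) = b := fun b => by simp [halves]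
  have rr : ∀ b : Fin m, (halves m (Sum.inr b) : ℕ) = m + b := fun b => by
    simp [halves, add_comm]
  have key : ((of fun i j : Fin (2 * m) => e i j).submatrix id (rho m).symm).submatrix
      (halves m) (halves m) = fromBlocks 1 (of fun a j : Fin m => e a (2 * (m - 1 - j) + 1))
        (of fun i b : Fin m => e (m + i) (2 * b))
        (of fun i j : Fin m => e (m + i) (2 * (m - 1 - j) + 1)) := by
    ext (a | a) (b | b)
    · simp only [submatrix_apply, id_eq, of_apply, fromBlocks_apply₁₁, cl, rl, one_apply,
        h a a.2 b b.2, Fin.ext_iff]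
    · simp only [submatrix_apply, id_eq, of_apply, fromBlocks_apply₁₂, cr, rl]
    · simp only [submatrix_apply, id_eq, of_apply, fromBlocks_apply₂₁, cl, rr]
    · simp only [submatrix_apply, id_eq, of_apply, fromBlocks_apply₂₂, cr, rr]
  rw [key, det_fromBlocks_one₁₁]
  congr 1
  ext i j
  rw [Matrix.sub_apply, mul_apply, of_apply, of_apply]
  simp only [of_apply]
  rw [Fin.sum_univ_eq_sum_range (fun a => e (m + i) (2 * a) * e a (2 * (m - 1 - j) + 1))]

/-- Entries of the confluent matrix in the basis `w ^ b`, `w ^ b r`. -/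
def eF (n : ℕ) (u : ℂ) (k j : ℕ) : ℂ :=
  if k < 2 * n + 1 then WW k (wS ^ (j / 2) * rS ^ (j % 2))
  else (u / (1 + u) ^ 3) ^ (j / 2) * (3 / (1 + u)) ^ (j % 2)

lemma det_rowF_hP (n : ℕ) {u : ℂ} (hu : 1 + u ≠ 0) :
    det (of fun k j : Fin (2 * (n + 1)) => rowF n (3 / (1 + u) - 1) k (hP j)) =
      27 ^ (n * (n + 1)) * det (of fun k j : Fin (2 * (n + 1)) => eF n u k j) := by
  have e : (of fun k j : Fin (2 * (n + 1)) => rowF n (3 / (1 + u) - 1) k (hP j)) =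
      of fun k j : Fin (2 * (n + 1)) => (-27 : ℂ) ^ ((j : ℕ) / 2) *
        (of fun k j : Fin (2 * (n + 1)) => eF n u k j) k j := by
    ext k j
    rw [of_apply, of_apply, of_apply, eF]
    split_ifs with h
    · rw [rowF_lt h, io_hP, map_smul, smul_eq_mul]
    · rw [rowF_last h, eval_hP hu]
  rw [e, det_mul_row (fun j : Fin (2 * (n + 1)) => (-27 : ℂ) ^ ((j : ℕ) / 2)),
    Fin.prod_univ_eq_prod_range (fun j => (-27 : ℂ) ^ (j / 2))]
  congr 1
  clear e
  induction n with
  | zero => simp [prod_range_succ]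
  | succ a ih =>
    rw [show 2 * (a + 1 + 1) = 2 * (a + 1) + 1 + 1 by ring, prod_range_succ, prod_range_succ, ih,
      show (2 * (a + 1) + 1) / 2 = a + 1 by omega, show 2 * (a + 1) / 2 = a + 1 by omega,
      mul_assoc, ← mul_pow, show (-27 : ℂ) * -27 = 27 ^ 2 by norm_num, ← pow_mul, ← pow_add]
    congr 1
    ring

lemma wS_mul_R (n : ℕ) {u : ℂ} (hu : 1 + u ≠ 0) :
    (C (u / (1 + u) ^ 3) - wS) * hRow n u n = C (3 / (1 + u)) - rS := by
  have hA : C (1 + u)⁻¹ * (1 + C u : ℂ⟦X⟧) = 1 := by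
    rw [← map_one (C (R := ℂ)), ← map_add, ← map_mul, inv_mul_cancel₀ hu]
  have hY := one_add_X_mul_inv
  have hN := nrm_mul_inv u
  rw [hRow, if_neg (lt_irrefl n), rS, wS, div_eq_mul_inv, div_eq_mul_inv, ← inv_pow, map_mul,
    map_mul, map_pow, smul_eq_C_mul, map_neg, show (C (3 : ℂ) : ℂ⟦X⟧) = 3 from rfl, map_pow,
    map_add, map_one]
  set N := nrm u with hNd
  have hNp : N = 1 - (3 * C u + C u ^ 2) * X - C u * X ^ 2 := by
    rw [hNd, nrm, map_add, map_mul, map_pow, show (C (3 : ℂ) : ℂ⟦X⟧) = 3 from rfl]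
  set A : ℂ⟦X⟧ := C (1 + u)⁻¹
  set Y : ℂ⟦X⟧ := (1 + X)⁻¹
  set U : ℂ⟦X⟧ := C u
  have hA3 : A ^ 3 * (1 + U) ^ 3 = 1 := by rw [← mul_pow, hA, one_pow]
  have hY3 : Y ^ 3 * (1 + X) ^ 3 = 1 := by rw [← mul_pow, mul_comm Y, hY, one_pow]
  have h1 : U * A ^ 3 - X * Y ^ 3 = A ^ 3 * Y ^ 3 * (U - X) * N := by
    rw [hNp]
    linear_combination X * Y ^ 3 * hA3 - U * A ^ 3 * hY3
  have hA2 : A ^ 3 * (1 + U) ^ 2 = A := by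
    linear_combination (A ^ 2 * (1 + U) + A) * hA
  have hY2 : Y ^ 3 * (1 + X) ^ 2 = Y := by
    linear_combination (Y ^ 2 * (1 + X) + Y) * hY
  calc _ = (A ^ 3 * (1 + U) ^ 2) * (Y ^ 3 * (1 + X) ^ 2) * (-3 * (U - X)) * (N * N⁻¹) := by
        rw [h1]
        ring
    _ = _ := by
        rw [hA2, hY2, hN]
        linear_combination 3 * A * hY - 3 * Y * hA

lemma WW_hRow_last (n j : ℕ) {u : ℂ} (hu : 1 + u ≠ 0) :
    3 / (1 + u) - ∑ k ∈ range (j + 1), (u / (1 + u) ^ 3) ^ k * WW k rS =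
      (u / (1 + u) ^ 3) ^ (j + 1) * WW j (hRow n u n) := by
  set w := u / (1 + u) ^ 3 with hw
  have h := wS_mul_R n hu
  rw [← hw] at h
  have h' : ∀ k, w * WW k (hRow n u n) - WW k (wS * hRow n u n) =
      3 / (1 + u) * WW k 1 - WW k rS := by
    intro k
    have := congrArg (WW k) h
    rw [sub_mul, map_sub, map_sub, ← smul_eq_C_mul, map_smul, smul_eq_mul,
      show C (3 / (1 + u)) = (3 / (1 + u)) • (1 : ℂ⟦X⟧) by rw [smul_eq_C_mul, mul_one],
      map_smul, smul_eq_mul] at this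
    exact this
  induction j with
  | zero =>
    have := h' 0
    rw [WW_one, if_pos rfl, WW_zero (wS * _)] at this
    simp [wS] at this
    simp [this]
  | succ j ih =>
    have h2 := h' (j + 1)
    have h3 := WW_wS_pow_mul (j + 1) 1 (hRow n u n)
    rw [pow_one, if_pos (by omega), Nat.add_sub_cancel] at h3
    rw [WW_one, if_neg (by omega), h3] at h2
    rw [sum_range_succ]
    linear_combination ih - w ^ (j + 1) * h2

lemma det_eF (n : ℕ) {u : ℂ} (hu : 1 + u ≠ 0) :
    det (of fun k j : Fin (2 * (n + 1)) => eF n u k j) =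
      (u / (1 + u) ^ 3) ^ (n + 1) * det (of fun i j : Fin (n + 1) => WW j (hRow n u i)) := by
  have ev : ∀ k b, eF n u k (2 * b) =
      if k < 2 * n + 1 then WW k (wS ^ b) else (u / (1 + u) ^ 3) ^ b := fun k b => by
    rw [eF, Nat.mul_div_cancel_left b two_pos, Nat.mul_mod_right, pow_zero, pow_zero, mul_one,
      mul_one]
  have od : ∀ k b, eF n u k (2 * b + 1) = if k < 2 * n + 1 then WW k (wS ^ b * rS) else
      (u / (1 + u) ^ 3) ^ b * (3 / (1 + u)) := fun k b => by
    rw [eF, show (2 * b + 1) / 2 = b by omega, show (2 * b + 1) % 2 = 1 by omega, pow_one, pow_one]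
  have hw : ∀ k b, WW k (wS ^ b) = if b = k then 1 else 0 := fun k b => by
    have := WW_wS_pow_mul k b 1
    rw [mul_one] at this
    rw [this]
    split_ifs with h1 h2 h2
    · rw [WW_one, if_pos (by omega)]
    · rw [WW_one, if_neg (by omega)]
    · omega
    · rfl
  rw [det_eq_det_blocks (eF n u) fun a ha b hb => by
    rw [ev, if_pos (by omega), hw]
    simp only [eq_comm]]
  set w := u / (1 + u) ^ 3 with hwd
  have e : (of fun i j : Fin (n + 1) => eF n u (n + 1 + i) (2 * (n + 1 - 1 - j) + 1) -
        ∑ a ∈ range (n + 1), eF n u (n + 1 + i) (2 * a) * eF n u a (2 * (n + 1 - 1 - j) + 1)) =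
      of fun i j : Fin (n + 1) => (if (i : ℕ) < n then 1 else w ^ (n + 1)) *
        (of fun i j : Fin (n + 1) => WW j (hRow n u i)) i j := by
    ext i j
    have hi := i.2
    have hj := j.2
    rw [of_apply, of_apply, of_apply]
    by_cases h : (i : ℕ) < n
    · rw [if_pos h, od, if_pos (by omega), one_mul, Finset.sum_eq_zero fun a ha => by
        rw [mem_range] at ha
        rw [ev, if_pos (by omega), hw, if_neg (by omega), zero_mul], sub_zero, WW_wS_pow_mul,
        if_pos (by omega), hRow, if_pos h, WW_dl_pow]
      congr 2
      omega
    · have hi : (i : ℕ) = n := by omega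
      rw [if_neg h, od, if_neg (by omega), hi]
      have : ∀ a ∈ range (n + 1), eF n u (n + 1 + n) (2 * a) * eF n u a (2 * (n + 1 - 1 - j) + 1) =
          if n - j ≤ a then w ^ a * WW (a - (n - j)) rS else 0 := fun a ha => by
        rw [mem_range] at ha
        rw [ev, if_neg (by omega), od, if_pos (by omega), WW_wS_pow_mul, Nat.add_sub_cancel]
        split_ifs <;> simp
      rw [Finset.sum_congr rfl this]
      generalize (j : ℕ) = l at hj
      have hn : n + 1 = n - l + (l + 1) := by omega
      have h0 : ∀ a ∈ range (n - l),
          (if n - l ≤ a then w ^ a * WW (a - (n - l)) rS else 0) = 0 := fun a ha =>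
        if_neg (by rw [mem_range] at ha; omega)
      rw [Nat.add_sub_cancel, hn, ← sum_range_add_sum_Ico _ (Nat.le_add_right (n - l) (l + 1)),
        Finset.sum_eq_zero h0, zero_add, sum_Ico_eq_sum_range, Nat.add_sub_cancel_left, pow_add,
        mul_assoc, hwd, ← WW_hRow_last n l hu, ← hwd, mul_sub, mul_sum]
      congr 1
      refine Finset.sum_congr rfl fun k _ => ?_
      rw [if_pos (by omega), Nat.add_sub_cancel_left, pow_add, mul_assoc]
  rw [e, det_mul_column (fun i : Fin (n + 1) => if (i : ℕ) < n then 1 else w ^ (n + 1)),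
    Fin.prod_univ_castSucc]
  congr 1
  simp

/-- The confluent determinant with all but one point at `2`. -/
lemma Gc_phi_eq_of_ne_zero (n : ℕ) {u : ℂ} (hu : u ≠ 0) (hu1 : 1 + u ≠ 0) :
    Gc phiP (2 * n + 2) (fun i => if i < 2 * n + 1 then 2 else 3 / (1 + u) - 1) * (1 + u) ^ n =
      3 ^ (n * (n + 1)) *
        det (of fun i j : Fin n => coeff (j + 1) (bP (i + 1)) + u * coeff j (bP i)) := by
  have h := det_rowF phiP n (3 / (1 + u) - 1)
  rw [← det_unitriangular_functional hP_sub_phiP (2 * n + 2)] at h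
  change det (of fun k j : Fin (2 * (n + 1)) => rowF n (3 / (1 + u) - 1) k (hP j)) = _ at h
  rw [det_rowF_hP n hu1, det_eF n hu1, det_WW_hRow, det_coeff_zRow hu] at h
  set D := det (of fun i j : Fin n => coeff (j + 1) (bP (i + 1)) + u * coeff j (bP i))
  set G := Gc phiP (2 * n + 2) (fun i => if i < 2 * n + 1 then 2 else 3 / (1 + u) - 1)
  have hp : ∏ k ∈ range (2 * n + 1), (-3 : ℂ) ^ k = (-3) ^ (n * (2 * n + 1)) := by
    rw [prod_pow_eq_pow_sum]
    congr 1
    have := Finset.sum_range_id_mul_two (2 * n + 1)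
    rw [Nat.add_sub_cancel] at this
    linarith
  have hs : 3 / (1 + u) - 1 - 2 = -3 * u / (1 + u) := by
    field_simp
    ring
  have e1 : (-3 : ℂ) ^ (n * (2 * n + 1)) * (-3) ^ (2 * n + 1) =
      (-3) ^ (n + 1) * 9 ^ (n * (n + 1)) := by
    rw [show (9 : ℂ) = (-3) ^ 2 by norm_num, ← pow_mul, ← pow_add, ← pow_add]
    congr 1
    ring
  have e2 : (27 : ℂ) ^ (n * (n + 1)) = 9 ^ (n * (n + 1)) * 3 ^ (n * (n + 1)) := by
    rw [← mul_pow]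
    norm_num
  have hu2 : (1 + u) ^ (3 * (n + 1)) = (1 + u) ^ (2 * n + 1) * (1 + u) ^ (n + 2) := by
    rw [← pow_add]
    congr 1
    ring
  have hu3 : u ^ (2 * n + 1) = u ^ (n + 1) * u ^ n := by
    rw [← pow_add]
    congr 1
    ring
  have n1 := pow_ne_zero (2 * n + 1) hu1
  have n2 := pow_ne_zero (n + 2) hu1
  rw [hp, hs, div_pow, div_pow, ← pow_mul, hu2, mul_pow, e2] at h
  have K : ((-3 : ℂ) ^ (n + 1) * 9 ^ (n * (n + 1)) * u ^ (2 * n + 1) * (1 + u) ^ 2) ≠ 0 := by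
    refine mul_ne_zero (mul_ne_zero (mul_ne_zero ?_ ?_) (pow_ne_zero _ hu)) (pow_ne_zero _ hu1) <;>
      exact pow_ne_zero _ (by norm_num)
  refine mul_left_cancel₀ K ?_
  have h4 : 9 ^ (n * (n + 1)) * 3 ^ (n * (n + 1)) * (u ^ (n + 1) * ((-3) ^ (n + 1) *
      ((1 + u) ^ 2 * u ^ n * D))) =
      (-3) ^ (n * (2 * n + 1)) * ((-3) ^ (2 * n + 1) * u ^ (2 * n + 1)) * G *
        (1 + u) ^ (n + 2) := by
    field_simp at h
    linear_combination h
  linear_combination -h4 + 9 ^ (n * (n + 1)) * 3 ^ (n * (n + 1)) * (-3) ^ (n + 1) *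
    (1 + u) ^ 2 * D * hu3 - G * u ^ (2 * n + 1) * (1 + u) ^ (n + 2) * e1
end QKZ

namespace QKZ
open PowerSeries Matrix Finset Filter Topology

/-- The confluent determinant with all but one point at `2`, without genericity assumption. -/
lemma Gc_phi_eq (n : ℕ) {u : ℂ} (hu1 : 1 + u ≠ 0) :
    Gc phiP (2 * n + 2) (fun i => if i < 2 * n + 1 then 2 else 3 / (1 + u) - 1) * (1 + u) ^ n =
      3 ^ (n * (n + 1)) *
        det (of fun i j : Fin n => coeff (j + 1) (bP (i + 1)) + u * coeff j (bP i)) := by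
  by_cases hu : u = 0
  · have hc : ContinuousAt (fun u : ℂ => 1 + u) u := by fun_prop
    refine eq_of_punctured
      (f := fun u => Gc phiP (2 * n + 2) (fun i => if i < 2 * n + 1 then 2 else 3 / (1 + u) - 1) *
        (1 + u) ^ n)
      (g := fun u => 3 ^ (n * (n + 1)) *
        det (of fun i j : Fin n => coeff (j + 1) (bP (i + 1)) + u * coeff j (bP i))) ?_ ?_ ?_
    · refine ((continuous_Gc phiP (2 * n + 2)).continuousAt.comp
        (continuousAt_pi.2 fun i => ?_)).mul (hc.pow n)
      by_cases h : i < 2 * n + 1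
      · simp only [if_pos h]
        exact continuousAt_const
      · simp only [if_neg h]
        exact (continuousAt_const.div hc hu1).sub continuousAt_const
    · refine Continuous.continuousAt (continuous_const.mul (Continuous.matrix_det ?_))
      refine continuous_matrix fun i j => ?_
      simp only [of_apply]
      fun_prop
    · have h1 : ∀ᶠ z in 𝓝[≠] u, 1 + z ≠ 0 :=
        (hc.eventually_ne hu1).filter_mono nhdsWithin_le_nhds
      filter_upwards [h1, self_mem_nhdsWithin] with z hz hz'
      exact Gc_phi_eq_of_ne_zero n (by rw [hu] at hz'; exact hz') hz
  · exact Gc_phi_eq_of_ne_zero n hu hu1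

lemma zchoose_eq_ich (a : ℕ) (k : ℤ) : zchoose a (a - k) = ich a k := by
  rw [zchoose, ich]
  by_cases h : 0 ≤ k
  · rw [if_pos h]
    lift k to ℕ using h
    split_ifs with h2
    · have : k ≤ a := by omega
      rw [show (a : ℤ) - k = ((a - k : ℕ) : ℤ) by omega, Int.toNat_natCast, Int.toNat_natCast,
        Int.toNat_natCast, Nat.choose_symm this]
    · rw [Int.toNat_natCast, Nat.choose_eq_zero_of_lt (by omega), Nat.cast_zero]
  · rw [if_neg h, if_neg (by omega), Nat.cast_zero]

lemma det_zchoose (n : ℕ) {x : ℝ} (hx : 0 < x) :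
    ((det (of fun i j : Fin n =>
      (x - 1) ^ 2 * (zchoose ((i.1 : ℤ) + j.1 + 1) (2 * (j.1 : ℤ) - i.1 + 1) : ℝ)
      + x * (zchoose ((i.1 : ℤ) + j.1 + 3) (2 * (j.1 : ℤ) - i.1 + 2) : ℝ)) : ℝ) : ℂ) =
    (x : ℂ) ^ n * det (of fun i j : Fin n => coeff (j + 1) (bP (i + 1)) +
      (((x : ℂ) - 1) ^ 2 / x) * coeff j (bP i)) := by
  have hx0 : (x : ℂ) ≠ 0 := by exact_mod_cast hx.ne'
  have e := det_smul (of fun i j : Fin n => coeff (j + 1) (bP (i + 1)) +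
      (((x : ℂ) - 1) ^ 2 / x) * coeff j (bP i)) (x : ℂ)
  rw [Fintype.card_fin] at e
  rw [← e, ← Complex.ofRealHom_eq_coe, RingHom.map_det]
  congr 1
  ext i j
  have h1 := zchoose_eq_ich (i + j + 1) (2 * i - j)
  have h2 := zchoose_eq_ich (i + 1 + (j + 1) + 1) (2 * (i + 1 : ℕ) - (j + 1 : ℕ))
  rw [show ((i + j + 1 : ℕ) : ℤ) - (2 * i - j) = 2 * j - i + 1 by push_cast; ring] at h1
  rw [show ((i + 1 + (j + 1) + 1 : ℕ) : ℤ) - (2 * (i + 1 : ℕ) - (j + 1 : ℕ)) = 2 * j - i + 2 by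
    push_cast; ring] at h2
  simp only [RingHom.mapMatrix_apply, map_apply, of_apply, Matrix.smul_apply, smul_eq_mul, coeff_bP,
    Complex.ofRealHom_eq_coe]
  rw [show ((i.1 : ℤ) + j.1 + 1) = ((i + j + 1 : ℕ) : ℤ) by push_cast; ring,
    show ((i.1 : ℤ) + j.1 + 3) = ((i + 1 + (j + 1) + 1 : ℕ) : ℤ) by push_cast; ring, h1, h2]
  push_cast
  field_simp
  ring

end QKZ

namespace QKZ
open Matrix Finset Filter Topology

lemma norm_om : ‖om‖ = 1 :=
  Complex.norm_eq_one_of_pow_eq_one om_cube (by norm_num)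

lemma norm_Bx (x : ℝ) : ‖Bx x‖ = 1 := by
  have h : (x + om ^ 2 : ℂ) = (starRingEnd ℂ) (x + om) := by
    rw [om_sq, map_add, Complex.conj_ofReal]
    apply Complex.ext
    · rw [Complex.add_re, Complex.add_re, Complex.conj_re]
      simp [om]
      norm_num
    · rw [Complex.add_im, Complex.add_im, Complex.conj_im]
      simp [om]
  rw [Bx, norm_div, h, RCLike.norm_conj, div_self]
  exact norm_ne_zero_iff.2 (add_om_ne x)

lemma norm_of_mem_bS {B a : ℂ} (hB : ‖B‖ = 1) (h : a ∈ bS B) : ‖a‖ = 1 := by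
  rcases mem_bS.1 h with rfl | rfl | rfl | rfl | rfl | rfl <;> simp [hB, norm_om]

lemma Gd_of_norm {B : ℂ} (hB : ‖B‖ = 1) {l : List ℂ} (h1 : ∀ a ∈ l, 1 < ‖a‖)
    (h2 : l.Pairwise fun a b => ‖a‖ ≠ ‖b‖) : Gd B l := by
  have ne : ∀ {a b : ℂ}, ‖a‖ ≠ ‖b‖ → a ≠ b := fun h e => h (congrArg _ e)
  refine ⟨fun a ha => ?_, ?_⟩
  · have ha := h1 a ha
    have haa : 1 < ‖a * a‖ := by rw [norm_mul]; nlinarith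
    refine ⟨⟨ne ?_, ne ?_, ne ?_, ne ?_⟩, fun h => ha.ne' (norm_of_mem_bS hB h)⟩
    · rw [norm_zero]; linarith
    · rw [norm_one]; exact haa.ne'
    · rw [norm_om]; exact haa.ne'
    · rw [norm_pow, norm_om, one_pow]; exact haa.ne'
  · rw [List.pairwise_iff_forall_sublist] at h2 ⊢
    intro a b hab
    have ha := h1 a (hab.subset (by simp))
    have hb := h1 b (hab.subset (by simp))
    have hn := h2 hab
    have hm : 1 < ‖a * b‖ := by rw [norm_mul]; nlinarith
    refine ⟨ne hn, ne ?_, ne ?_, ne ?_, ne ?_, ne ?_⟩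
    · rwa [norm_mul, norm_om, one_mul]
    · rwa [norm_mul, norm_pow, norm_om, one_pow, one_mul]
    · rw [norm_one]; exact hm.ne'
    · rw [norm_om]; exact hm.ne'
    · rw [norm_pow, norm_om, one_pow]; exact hm.ne'

/-- The list `t ^ (a + 1), …, t ^ (a + k)`. -/
def zc (a k : ℕ) (t : ℝ) : List ℂ := (List.range k).map fun i => (t : ℂ) ^ (a + i + 1)

lemma zc_length (a k : ℕ) (t : ℝ) : (zc a k t).length = k := by simp [zc]

lemma zc_append (k l : ℕ) (t : ℝ) : zc 0 k t ++ zc k l t = zc 0 (k + l) t := by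
  simp [zc, List.range_add, Function.comp_def]

lemma zc_one (a k : ℕ) : zc a k 1 = List.replicate k 1 := by
  simp [zc]

lemma zc_getD (f : ℂ → ℂ) (a k : ℕ) (t : ℝ) (i : ℕ) (d : ℂ) :
    ((zc a k t).map f).getD i d = if i < k then f ((t : ℂ) ^ (a + i + 1)) else d := by
  split_ifs with h <;> simp [zc, List.getD_eq_getElem?_getD, h]

lemma Gd_zc {B : ℂ} (hB : ‖B‖ = 1) (k : ℕ) {t : ℝ} (ht : 1 < t) : Gd B (zc 0 k t) := by
  refine Gd_of_norm hB (fun a ha => ?_) ?_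
  · obtain ⟨i, -, rfl⟩ := List.mem_map.1 ha
    rw [norm_pow, Complex.norm_real, Real.norm_of_nonneg (by linarith)]
    exact one_lt_pow₀ ht (by omega)
  · rw [zc, List.pairwise_map]
    refine List.Pairwise.imp (fun {i j} hij => ?_) List.nodup_range
    rw [norm_pow, norm_pow, Complex.norm_real, Real.norm_of_nonneg (by linarith)]
    intro h
    have := pow_right_injective₀ (by linarith : (0 : ℝ) < t) ht.ne' h
    omega

lemma SS_eq_Gc {l : List ℂ} (h : l.Nodup) (d : ℂ) :
    SS l = Gc phiP l.length fun i => l.getD i d := by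
  have hg : l.get = fun i : Fin l.length => (fun i => l.getD i d) i := by
    funext i
    simp
  rw [SS, div_eq_iff (vdm_list_ne_zero h), mul_comm, hg, vdm_eq_vd l.length (fun i => l.getD i d), ← det_eval_eq, alt]
  congr 1
  ext i j
  simp only [of_apply, phiP_eval]

lemma continuousAt_Psi_list {l : ℝ → List ℂ} {a : ℝ} (B : ℂ) (α : List Bool)
    (h : ∀ i, ContinuousAt (fun t => (l t).getD i 0) a) :
    ContinuousAt (fun t => Psi B (l t) α) a :=
  (MvPolynomial.continuous_eval _).continuousAt.comp (continuousAt_pi.2 h)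

lemma ov_eq_sum {n1 n2 : ℕ} (B : ℂ) {z1 z2 : List ℂ} (h1 : z1.length = n1)
    (h2 : z2.length = n2) : ov B z1 z2 = ∑ α : Conf n1, ∑ β : Conf n2,
      Psi B (iv (z1 ++ z2)) (sl α ++ sl β) * Psi B z1 (sl α) * Psi B z2 (sl β) := by
  subst h1 h2
  rw [ov, sumS_eq_sum]
  refine Finset.sum_congr rfl fun α _ => ?_
  rw [sumS_eq_sum, iv_append]

lemma continuousAt_ov (B : ℂ) (n1 n2 : ℕ) :
    ContinuousAt (fun t => ov B (zc 0 n1 t) (zc n1 n2 t)) 1 := by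
  have hp : ∀ k : ℕ, ContinuousAt (fun t : ℝ => (t : ℂ) ^ k) 1 := fun k =>
    (Complex.continuous_ofReal.pow k).continuousAt
  have hz : ∀ a k i, ContinuousAt (fun t => (zc a k t).getD i 0) 1 := fun a k i => by
    have e : ∀ t, (zc a k t).getD i 0 = if i < k then (t : ℂ) ^ (a + i + 1) else 0 := fun t => by
      have := zc_getD id a k t i 0
      rwa [List.map_id] at this
    simp only [e]
    split_ifs
    · exact hp _
    · exact continuousAt_const
  have hi : ∀ a k i, ContinuousAt (fun t => (iv (zc a k t)).getD i 0) 1 := fun a k i => by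
    simp only [iv, zc_getD (·⁻¹) a k _ i 0]
    split_ifs
    · exact (hp _).inv₀ (by simp)
    · exact continuousAt_const
  simp only [ov_eq_sum B (zc_length _ _ _) (zc_length _ _ _), zc_append]
  exact tendsto_finsetSum _ fun α _ => tendsto_finsetSum _ fun β _ =>
    ((continuousAt_Psi_list B _ (hi _ _)).mul (continuousAt_Psi_list B _ (hz _ _))).mul
      (continuousAt_Psi_list B _ (hz _ _))

lemma continuousAt_Gc_zc (a k m : ℕ) (d : ℂ) :
    ContinuousAt (fun t : ℝ => Gc phiP m fun i => if i < k then xx ((t : ℂ) ^ (a + i + 1)) else d)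
      1 := by
  refine (continuous_Gc phiP m).continuousAt.comp (continuousAt_pi.2 fun i => ?_)
  split_ifs
  · have hp : ContinuousAt (fun t : ℝ => (t : ℂ) ^ (a + i + 1)) 1 :=
      (Complex.continuous_ofReal.pow _).continuousAt
    exact hp.add (hp.inv₀ (by simp))
  · exact continuousAt_const

lemma ov_ones {B : ℂ} (hB : ‖B‖ = 1) {n1 n2 : ℕ} (hodd : (n1 + n2) % 2 = 1) :
    ov B (List.replicate n1 1) (List.replicate n2 1) = cst B (n1 / 2) (n2 / 2) *
      Gc phiP n1 (fun _ => 2) * Gc phiP n2 (fun _ => 2) *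
      Gc phiP (n1 + n2 + 1) (fun i => if i < n1 + n2 then 2 else xx (om ^ 2 * B)) := by
  have hB0 : B ≠ 0 := fun h => by simp [h] at hB
  set F : ℝ → ℂ := fun t => Fov B (zc 0 n1 t) (zc n1 n2 t) with hF
  set G : ℝ → ℂ := fun t => cst B (n1 / 2) (n2 / 2) *
    Gc phiP n1 (fun i => if i < n1 then xx ((t : ℂ) ^ (0 + i + 1)) else 2) *
    Gc phiP n2 (fun i => if i < n2 then xx ((t : ℂ) ^ (n1 + i + 1)) else 2) *
    Gc phiP (n1 + n2 + 1)
      (fun i => if i < n1 + n2 then xx ((t : ℂ) ^ (0 + i + 1)) else xx (om ^ 2 * B)) with hG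
  have hFc : ContinuousAt F 1 := by
    have hprod : ∀ a k, ContinuousAt (fun t => (zc a k t).prod) 1 := fun a k => by
      simp only [zc]
      refine (continuous_list_prod _ fun i _ => ?_).continuousAt
      exact Complex.continuous_ofReal.pow _
    simp only [hF, Fov, zc_length]
    exact (((hprod _ _).pow _).mul ((hprod _ _).pow _)).mul (continuousAt_ov B n1 n2)
  have hGc : ContinuousAt G 1 :=
    ((continuousAt_const.mul (continuousAt_Gc_zc _ _ _ _)).mul (continuousAt_Gc_zc _ _ _ _)).mul
      (continuousAt_Gc_zc _ _ _ _)
  have hFG : ∀ t : ℝ, 1 < t → F t = G t := by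
    intro t ht
    have hg := Gd_zc hB (n1 + n2) ht
    rw [← zc_append] at hg
    have hnd := hg.nodup' hB0
    have hnd' : (((zc 0 n1 t) ++ zc n1 n2 t).map xx ++ [xx (om ^ 2 * B)]).Nodup :=
      (List.perm_append_singleton _ _).nodup_iff.2 hnd
    have hnd2 := hnd.of_cons
    rw [List.map_append] at hnd2
    rw [hF, hG]
    simp only
    rw [Fov_eq hB0 (n1 + n2) _ _ (by rw [zc_length, zc_length]) hodd hg, rhs, bd,
      ← List.append_assoc, ← List.map_append, SS_eq_Gc hnd2.of_append_left 2,
      SS_eq_Gc hnd2.of_append_right 2, SS_eq_Gc hnd' (xx (om ^ 2 * B)), zc_append]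
    simp only [List.length_append, List.length_map, zc_length, zc_getD xx]
    congr 1
    congr 1
    funext i
    rw [List.getD_eq_getElem?_getD, List.getElem?_append]
    simp only [List.length_map, zc_length]
    split_ifs with h
    · have := zc_getD xx 0 (n1 + n2) t i 0
      rw [if_pos h] at this
      rw [← this, List.getD_eq_getElem?_getD]
      simp [zc_length, h]
    · rcases Nat.eq_zero_or_pos (i - (n1 + n2)) with h0 | h0
      · simp [h0]
      · simp [h0.ne']
  have key : F 1 = G 1 := by
    refine tendsto_nhds_unique_of_eventuallyEq (l := 𝓝[>] (1 : ℝ))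
      (hFc.tendsto.mono_left nhdsWithin_le_nhds) (hGc.tendsto.mono_left nhdsWithin_le_nhds) ?_
    filter_upwards [self_mem_nhdsWithin] with t ht using hFG t ht
  have hx : xx 1 = 2 := by rw [xx]; norm_num
  simp only [hF, hG, Fov, zc_one, List.prod_replicate, one_pow, one_mul, Complex.ofReal_one, hx,
    ite_self] at key
  exact key

lemma sl_append {N1 N2 : ℕ} (α : Conf N1) (β : Conf N2) :
    sl (Fin.append α β) = sl α ++ sl β := by
  rw [sl, sl, sl, ← List.ofFn_fin_append]
  congr 1
  funext i
  refine Fin.addCases (fun i => ?_) (fun i => ?_) i <;> simp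

lemma fN_mul_overlap {x : ℝ} (hx : 0 < x) {N1 N2 : ℕ} {ψ1 : Conf N1 → ℂ} {ψ2 : Conf N2 → ℂ}
    {ψ : Conf (N1 + N2) → ℂ} (hψ1 : IsGroundState N1 x ψ1) (hψ2 : IsGroundState N2 x ψ2)
    (hψ : IsGroundState (N1 + N2) x ψ) :
    fN (Bx x) (N1 + N2) * fN (Bx x) N1 * fN (Bx x) N2 * overlap N1 N2 ψ ψ1 ψ2 =
      ov (Bx x) (List.replicate N1 1) (List.replicate N2 1) := by
  rw [ov_eq_sum (n1 := N1) (n2 := N2) _ (by simp) (by simp), overlap, mul_sum]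
  refine Finset.sum_congr rfl fun α _ => ?_
  rw [mul_sum]
  refine Finset.sum_congr rfl fun β _ => ?_
  have h := hom_eq_of_isGroundState hx hψ (Fin.append α β)
  have h1 := hom_eq_of_isGroundState hx hψ1 α
  have h2 := hom_eq_of_isGroundState hx hψ2 β
  rw [hom, sl_length] at h h1 h2
  rw [sl_append] at h
  have hi : iv (List.replicate N1 1 ++ List.replicate N2 1) = List.replicate (N1 + N2) (1 : ℂ) := by
    rw [← List.replicate_add, iv, List.map_replicate, inv_one]
  rw [hi, h, h1, h2]
  ring

end QKZ

namespace QKZ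
open Matrix Finset

lemma const_core {B r : ℂ} (h : r * (B - 1) ^ 2 = -3 * B) {n A T E e : ℕ} (he : e = 3 * n + A)
    (hE : n + A + T = E) :
    r ^ n * (B - 1) ^ (2 * n) * (1 - om) ^ (2 * A) * 3 ^ T = B ^ n * (-om) ^ e * 3 ^ E := by
  have h1 : (1 - om) ^ 2 = 3 * -om := by linear_combination om_sq
  have h2 : (-om) ^ 3 = -1 := by linear_combination -om_cube
  rw [pow_mul (B - 1), ← mul_pow, h, pow_mul (1 - om), h1, he, pow_add (-om), pow_mul (-om), h2,
    ← hE, mul_pow, mul_pow, pow_add, pow_add, neg_pow (3 : ℂ)]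
  ring

lemma exists_mul_pred (k : ℕ) : ∃ t, k * (k - 1) = 2 * t ∧ k * k = 2 * t + k := by
  obtain ⟨t, ht⟩ := (Nat.even_mul_pred_self k).two_dvd
  refine ⟨t, ht, ?_⟩
  rw [← ht]
  cases k with
  | zero => rfl
  | succ k => rw [Nat.add_sub_cancel]; ring

lemma const_odd_even {B r : ℂ} (h : r * (B - 1) ^ 2 = -3 * B) (a b : ℕ) :
    r ^ (a + b) * (fN B (2 * a + 1 + 2 * b) * fN B (2 * a + 1) * fN B (2 * b)) =
      B ^ (a + b) * (-om) ^ (a * a + 2 * a + (b * b + 2 * b) + a * b) * 3 ^ (a * a) *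
        3 ^ (b * (b - 1)) * 3 ^ ((a + b) * (a + b + 1)) := by
  obtain ⟨ta, ha, ha'⟩ := exists_mul_pred a
  obtain ⟨tb, hb, hb'⟩ := exists_mul_pred b
  obtain ⟨tn, hn, hn'⟩ := exists_mul_pred (a + b)
  have s : ∀ k t, k * k = 2 * t + k → (k + 1) * (k + 1 - 1) / 2 = t + k := fun k t h => by
    rw [Nat.add_sub_cancel, add_mul, one_mul, h]
    omega
  have hab : (a + b) * (a + b) = a * a + b * b + 2 * (a * b) := by ring
  have hab' : (a + b) * (a + b + 1) = 2 * tn + 2 * (a + b) := by rw [mul_add, hn']; ring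
  rw [fN_eq, fN_eq, fN_eq, show (2 * a + 1 + 2 * b) / 2 = a + b by omega,
    show (2 * a + 1) / 2 = a by omega, show 2 * b / 2 = b by omega,
    show 2 * a + 1 + 2 * b - (a + b) = a + b + 1 by omega, show 2 * a + 1 - a = a + 1 by omega,
    show 2 * b - b = b by omega, ha, hb, hn, s _ _ ha', s _ _ hn', Nat.mul_div_cancel_left _ two_pos]
  have key := const_core h (n := a + b) (A := ta + tb + tn) (T := tn + (a + b) + (ta + a) + tb)
    (E := a * a + 2 * tb + (a + b) * (a + b + 1))
    (e := a * a + 2 * a + (b * b + 2 * b) + a * b) (by omega) (by omega)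
  rw [pow_add 3 (a * a + 2 * tb), pow_add 3 (a * a)] at key
  rw [← mul_assoc, ← mul_assoc] at key
  rw [← key]
  generalize B - 1 = c
  generalize 1 - om = d
  ring

lemma const_identity {B r : ℂ} (h : r * (B - 1) ^ 2 = -3 * B) {N1 N2 : ℕ}
    (hpar : (Even N1 ∧ Odd N2) ∨ (Odd N1 ∧ Even N2)) :
    r ^ ((N1 + N2) / 2) * (fN B (N1 + N2) * fN B N1 * fN B N2) =
      cst B (N1 / 2) (N2 / 2) * 3 ^ (N1 / 2 * ((N1 - 1) / 2)) * 3 ^ (N2 / 2 * ((N2 - 1) / 2)) *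
        3 ^ ((N1 + N2) / 2 * ((N1 + N2) / 2 + 1)) := by
  rcases hpar with ⟨⟨b, rfl⟩, ⟨a, rfl⟩⟩ | ⟨⟨a, rfl⟩, ⟨b, rfl⟩⟩ <;> rw [← two_mul] <;>
  have key := const_odd_even h a b
  · rw [show (2 * b + (2 * a + 1)) / 2 = a + b by omega, show 2 * b / 2 = b by omega,
      show (2 * a + 1) / 2 = a by omega, show (2 * b - 1) / 2 = b - 1 by omega,
      show (2 * a + 1 - 1) / 2 = a by omega, add_comm (2 * b), cst,
      show b * b + 2 * b + (a * a + 2 * a) + b * a = a * a + 2 * a + (b * b + 2 * b) + a * b by ring,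
      add_comm b a]
    linear_combination key
  · rw [show (2 * a + 1 + 2 * b) / 2 = a + b by omega, show 2 * b / 2 = b by omega,
      show (2 * a + 1) / 2 = a by omega, show (2 * b - 1) / 2 = b - 1 by omega,
      show (2 * a + 1 - 1) / 2 = a by omega, cst]
    linear_combination key

lemma cancel_constants {f ov U X C a b c₁ c₂ G D T : ℂ} (h : f * ov = C * (a * c₁) * (b * c₂) * G)
    (hc : U * X * f = C * a * b * T) (hg : G * U = T * D) :
    U * X * f * ov = U * X * f * (c₁ * c₂ * (X * D)) := by
  linear_combination U * X * h - c₁ * c₂ * X * D * hc + C * a * b * c₁ * c₂ * X * hg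

end QKZ

/-- **Theorem 1.1 (mixed-parity case).** For `x > 0` and `N1, N2 ≥ 0` of which
exactly one is odd, with `n = ⌊(N1+N2)/2⌋`, the ground-state overlap is
`O_{N1,N2} = γ_{N1} γ_{N2} det_{i,j=1}^n ((x−1)² C(i+j−1,2j−i) + x C(i+j+1,2j−i+1))`. -/
theorem overlap_mixed_parity (x : ℝ) (hx : 0 < x) (N1 N2 : ℕ)
    (hpar : (Even N1 ∧ Odd N2) ∨ (Odd N1 ∧ Even N2))
    (ψ1 : Conf N1 → ℂ) (ψ2 : Conf N2 → ℂ) (ψ : Conf (N1+N2) → ℂ)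
    (hψ1 : IsGroundState N1 x ψ1) (hψ2 : IsGroundState N2 x ψ2)
    (hψ : IsGroundState (N1+N2) x ψ) :
    overlap N1 N2 ψ ψ1 ψ2 =
      ((gammaN N1 * gammaN N2 *
        Matrix.det (Matrix.of fun i j : Fin ((N1+N2)/2) =>
          (x-1)^2 * (zchoose ((i.1 : ℤ) + j.1 + 1) (2*(j.1 : ℤ) - i.1 + 1) : ℝ)
          + x * (zchoose ((i.1 : ℤ) + j.1 + 3) (2*(j.1 : ℤ) - i.1 + 2) : ℝ)) : ℝ) : ℂ) := by
  have hx0 : (x : ℂ) ≠ 0 := by exact_mod_cast hx.ne'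
  have hodd : (N1 + N2) % 2 = 1 := by
    rcases hpar with ⟨h1, h2⟩ | ⟨h1, h2⟩
    · exact Nat.odd_iff.1 (h1.add_odd h2)
    · exact Nat.odd_iff.1 (h1.add_even h2)
  have n1 := QKZ.add_om_ne x
  have n2 := QKZ.add_om_sq_ne x
  have hq := om_sq
  set B := QKZ.Bx x with hB
  have hu : 1 + ((x : ℂ) - 1) ^ 2 / x = (x + om) * (x + om ^ 2) / x := by
    field_simp
    rw [hq]
    linear_combination hq
  have hu1 : 1 + ((x : ℂ) - 1) ^ 2 / x ≠ 0 := by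
    rw [hu]
    exact div_ne_zero (mul_ne_zero n1 n2) hx0
  have hX : QKZ.xx (om ^ 2 * B) = 3 / (1 + ((x : ℂ) - 1) ^ 2 / x) - 1 := by
    rw [hu, hB, QKZ.xx, QKZ.Bx]
    have := om_ne_zero
    field_simp
    linear_combination (x ^ 2 + x + 1 : ℂ) * hq +
      (x ^ 2 * om + x * (2 * om ^ 2 + 1 + om) + (om ^ 3 + 1 + om + om ^ 2)) * om_cube
  have hr : ((1 + ((x : ℂ) - 1) ^ 2 / x) * x) * (B - 1) ^ 2 = -3 * B := by
    rw [hu, hB, QKZ.Bx]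
    field_simp
    linear_combination hq + (om - 2) * om_cube
  have h := QKZ.fN_mul_overlap hx hψ1 hψ2 hψ
  have hc := QKZ.const_identity hr hpar
  rw [QKZ.ov_ones (QKZ.norm_Bx x) hodd, QKZ.Gc_phi_two_eq, QKZ.Gc_phi_two_eq, ← hB, hX] at h
  have hg := QKZ.Gc_phi_eq ((N1 + N2) / 2) hu1
  rw [show 2 * ((N1 + N2) / 2) + 2 = N1 + N2 + 1 by omega,
    show 2 * ((N1 + N2) / 2) + 1 = N1 + N2 by omega] at hg
  have f0 : QKZ.fN B (N1 + N2) * QKZ.fN B N1 * QKZ.fN B N2 ≠ 0 :=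
    mul_ne_zero (mul_ne_zero (QKZ.fN_ne_zero x _) (QKZ.fN_ne_zero x _)) (QKZ.fN_ne_zero x _)
  rw [Complex.ofReal_mul, Complex.ofReal_mul, QKZ.det_zchoose _ hx]
  have r0 := pow_ne_zero ((N1 + N2) / 2) (mul_ne_zero hu1 hx0)
  refine mul_left_cancel₀ (mul_ne_zero r0 f0) ?_
  rw [mul_pow] at hc ⊢
  exact QKZ.cancel_constants h hc hg

end
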